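/- Let (R, m) be an analytically unramified Cohen-Macaulay local ring of dimension d > 0 with infinite residue field, I an m-primary ideal. Then the first normal Hilbert coefficient satisfies ē₁(I) ≥ e₀(I) − λ(R/closure(I)), where λ denotes length. -/

import Mathlib

set_option synthInstance.maxHeartbeats 1000000
set_option maxHeartbeats 2000000

open IsLocalRing Polynomial Finset

variable {R : Type*}

/-- `x` is integral over the ideal `I`: it satisfies an equation
`x^n + a₁ x^{n-1} + ⋯ + aₙ = 0` with `aᵢ ∈ Iⁱ`. -/
def IsIntegralOverIdeal [CommRing R] (I : Ideal R) (x : R) : Prop :=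
  ∃ n : ℕ, 0 < n ∧ ∃ a : ℕ → R, (∀ i ∈ Finset.Icc 1 n, a i ∈ I ^ i) ∧
    x ^ n + ∑ i ∈ Finset.Icc 1 n, a i * x ^ (n - i) = 0

/-- The integral closure of an ideal (the set of integral elements is an ideal,
so the span equals it). -/
def intCl [CommRing R] (I : Ideal R) : Ideal R :=
  Ideal.span {x | IsIntegralOverIdeal I x}

/-- Length of a module, as the Krull dimension of its lattice of submodules. -/
noncomputable def mlen (R M : Type*) [CommRing R] [AddCommGroup M] [Module R M] :
    WithBot ℕ∞ :=
  Order.krullDim (Submodule R M)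

/-- The quotient module `N/(K ∩ N)` for ideals `N K`. -/
abbrev idealQuot [CommRing R] (N K : Ideal R) :=
  N ⧸ (Submodule.comap N.subtype K)

/-- Depth of `M` with respect to the ideal `J`: sup of lengths of `M`-regular
sequences contained in `J`. -/
noncomputable def rdepth (A : Type*) [CommRing A] (J : Ideal A)
    (M : Type*) [AddCommGroup M] [Module A M] : ℕ∞ :=
  sSup {n : ℕ∞ | ∃ rs : List A, (rs.length : ℕ∞) = n ∧ (∀ x ∈ rs, x ∈ J) ∧
    RingTheory.Sequence.IsRegular M rs}

/-- A local ring is Cohen-Macaulay if its depth equals its Krull dimension. -/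
def IsCMLocal (R : Type*) [CommRing R] [IsLocalRing R] : Prop :=
  (rdepth R (maximalIdeal R) R : WithBot ℕ∞) = ringKrullDim R

/-- A local ring is analytically unramified if its `m`-adic completion is reduced. -/
def AnalyticallyUnramified (R : Type*) [CommRing R] [IsLocalRing R] : Prop :=
  IsReduced (AdicCompletion (maximalIdeal R) R)

/-- An ideal is `m`-primary. -/
def IsMPrimary [CommRing R] [IsLocalRing R] (I : Ideal R) : Prop :=
  I.radical = maximalIdeal R

/-- `J ⊆ I` is a minimal reduction: generated by `d = dim R` elements and
`I^{n+1} = J I^n` for `n ≫ 0`. -/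
def IsMinimalReduction [CommRing R] (d : ℕ) (J I : Ideal R) : Prop :=
  J ≤ I ∧ (∃ s : Fin d → R, J = Ideal.span (Set.range s)) ∧
    ∃ N : ℕ, ∀ n ≥ N, I ^ (n + 1) = J * I ^ n

/-- Normal Hilbert data: `L n = λ(R/ intCl(I^{n+1}))` and for `n ≫ 0` this agrees
with the polynomial whose normalized coefficients are the `e i`. -/
def NormalHilbertData [CommRing R] (d : ℕ) (I : Ideal R) (L : ℕ → ℕ) (e : ℕ → ℤ) : Prop :=
  (∀ n, mlen R (R ⧸ intCl (I ^ (n + 1))) = (L n : WithBot ℕ∞)) ∧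
    ∃ N : ℕ, ∀ n ≥ N, (L n : ℤ) =
      ∑ i ∈ Finset.range (d + 1), (-1 : ℤ) ^ i * e i * ((n + d - i).choose (d - i))

/-- `t` is the Cohen-Macaulay type of the local ring `R` of dimension `d`:
`t = λ((Q : m)/Q)` for every ideal `Q` generated by a maximal regular sequence in `m`. -/
def CMTypeData (R : Type*) [CommRing R] [IsLocalRing R] (d t : ℕ) : Prop :=
  ∀ s : List R, s.length = d → (∀ x ∈ s, x ∈ maximalIdeal R) →
    RingTheory.Sequence.IsRegular R s →
      mlen R (idealQuot ((Ideal.span {x | x ∈ s}).colon (maximalIdeal R))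
        (Ideal.span {x | x ∈ s})) = (t : WithBot ℕ∞)

/-- The quotient module `N/(K ∩ N)` for submodules `N K` of a module. -/
abbrev submoduleQuot {A M : Type*} [CommRing A] [AddCommGroup M] [Module A M]
    (N K : Submodule A M) :=
  N ⧸ (Submodule.comap N.subtype K)


theorem aux_isIntegral_of_mem_adjoin_inv {K : Type*} [Field K] (A : Subring K) (z : K) (hz : z ≠ 0)
    (h : z ∈ Algebra.adjoin A {z⁻¹}) : IsIntegral A z := by
  rw [Algebra.adjoin_singleton_eq_range_aeval] at h
  obtain ⟨p, hp⟩ := h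
  have hp : (aeval z⁻¹) p = z := hp
  set p' : Polynomial A := 1 - X * p with hp'
  have h0 : aeval z⁻¹ p' = 0 := by
    simp [hp', hp, hz]
  have hc : p'.coeff 0 = 1 := by simp [hp']
  refine ⟨p'.reverse, ?_, ?_⟩
  · rw [Monic, reverse_leadingCoeff, trailingCoeff, natTrailingDegree_eq_zero.2, hc]
    right; rw [hc]; exact one_ne_zero
  · letI : Invertible (z⁻¹) := ⟨z, by field_simp, by field_simp⟩
    have := (Polynomial.eval₂_reverse_eq_zero_iff (algebraMap A K) (z⁻¹) p').2 h0
    exact this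

theorem aux_eq_of_height_le_one {A : Type*} [CommRing A] [IsDomain A] (P Q : Ideal A) [P.IsPrime]
    [Q.IsPrime] (hP : P.height ≤ 1) (hQ : Q ≠ ⊥) (hQP : Q ≤ P) : Q = P := by
  by_contra hne
  have hlt : Q < P := lt_of_le_of_ne hQP hne
  have hQf : Q.FiniteHeight := ⟨Or.inr (fun h => by
    have := (Ideal.height_mono hQP).trans hP
    rw [h] at this; simp at this)⟩
  have hbf : (⊥ : Ideal A).FiniteHeight := ⟨Or.inr (fun h => by
    have := (Ideal.height_mono (bot_le.trans hQP : (⊥ : Ideal A) ≤ P)).trans hP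
    rw [h] at this; simp at this)⟩
  have h1 : Q.height < P.height := Ideal.height_strict_mono_of_isPrime hlt
  have h2 : (⊥ : Ideal A).height < Q.height :=
    Ideal.height_strict_mono_of_isPrime (bot_lt_iff_ne_bot.2 hQ)
  have h3 : Q.height < 1 := lt_of_lt_of_le h1 hP
  rw [ENat.lt_one_iff_eq_zero] at h3
  rw [h3] at h2
  exact absurd h2 (by simp)

theorem aux_isIntegral_core {K : Type*} [Field K] (A : Subring K) [IsNoetherianRing A] (τ z : K)
    (hτ : τ ∈ A) (hτ0 : τ ≠ 0)
    (h : ∀ e : ℕ, ∃ r c : ℕ, e * c < r ∧ τ ^ c * z ^ r ∈ A) : IsIntegral A z := by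
  by_contra hcon
  have hz : z ≠ 0 := by rintro rfl; exact hcon isIntegral_zero
  let A' : Subalgebra A K := Algebra.adjoin A {z⁻¹}
  have hN : IsNoetherianRing A' := by
    have : (Algebra.adjoin A (({z⁻¹} : Finset K) : Set K)).FG := ⟨_, rfl⟩
    have h2 : Algebra.FiniteType A A' := by
      rw [← Subalgebra.fg_iff_finiteType]; simpa using this
    exact Algebra.FiniteType.isNoetherianRing A A'
  let s : A' := ⟨z⁻¹, Algebra.subset_adjoin rfl⟩
  have hs0 : s ≠ 0 := fun h => inv_ne_zero hz (congrArg Subtype.val h)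
  have hsu : ¬ IsUnit s := by
    intro hu
    obtain ⟨t, ht⟩ := hu.exists_right_inv
    have ht' : (t : K) = z := by
      have := congrArg Subtype.val ht
      change z⁻¹ * (t : K) = 1 at this
      field_simp at this; exact this
    exact hcon (aux_isIntegral_of_mem_adjoin_inv A z hz (by have := t.2; rwa [ht'] at this))
  let τ' : A' := algebraMap A A' ⟨τ, hτ⟩
  have hτ'0 : τ' ≠ 0 := fun h => hτ0 (congrArg Subtype.val h)
  have key : ∀ e : ℕ, ∃ r c : ℕ, e * c < r ∧ s ^ r ∣ τ' ^ c := by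
    intro e
    obtain ⟨r, c, h1, h2⟩ := h e
    refine ⟨r, c, h1, ⟨algebraMap A A' ⟨_, h2⟩, ?_⟩⟩
    apply Subtype.ext
    change τ ^ c = (z⁻¹) ^ r * (τ ^ c * z ^ r)
    rw [mul_left_comm, ← mul_pow, inv_mul_cancel₀ hz, one_pow, mul_one]
  obtain ⟨M, hM, hsM⟩ := exists_max_ideal_of_mem_nonunits hsu
  obtain ⟨P, hP, -⟩ := Ideal.exists_minimalPrimes_le (I := Ideal.span {s}) (J := M)
    ((Ideal.span_singleton_le_iff_mem _).2 hsM)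
  have : P.IsPrime := hP.1.1
  have hsP : s ∈ P := hP.1.2 (Ideal.mem_span_singleton_self s)
  have hht : P.height ≤ 1 := Ideal.height_le_one_of_isPrincipal_of_mem_minimalPrimes _ P hP
  by_cases hτP : τ' ∈ P
  · have hmin : P ∈ (Ideal.span {τ'}).minimalPrimes := by
      refine ⟨⟨inferInstance, (Ideal.span_singleton_le_iff_mem _).2 hτP⟩, ?_⟩
      rintro Q ⟨hQ, hτQ⟩ hQP
      have : Q ≠ ⊥ := by
        rintro rfl
        exact hτ'0 (by simpa using hτQ)
      exact (aux_eq_of_height_le_one P Q hht this hQP).ge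
    obtain ⟨u, hu, e, hue⟩ : ∃ u, u ∉ P ∧ ∃ e : ℕ, τ' ∣ u * s ^ e := by
      have hx := (IsLocalization.AtPrime.radical_map_of_mem_minimalPrimes
        (Localization.AtPrime P) P _ hmin)
      have h3 : algebraMap A' (Localization.AtPrime P) s ∈
        ((Ideal.span {τ'}).map (algebraMap A' (Localization.AtPrime P))).radical := by
        rw [hx]; exact Ideal.mem_map_of_mem _ hsP
      obtain ⟨e, he⟩ := h3
      rw [← map_pow, IsLocalization.algebraMap_mem_map_algebraMap_iff P.primeCompl] at he
      obtain ⟨u, hu, he⟩ := he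
      exact ⟨u, hu, e, Ideal.mem_span_singleton.1 he⟩
    obtain ⟨r, c, hrc, hd⟩ := key e
    have h4 : s ^ r ∣ u ^ c * s ^ (e * c) := by
      refine hd.trans ?_
      rw [pow_mul, ← mul_pow]
      exact pow_dvd_pow_of_dvd hue c
    obtain ⟨k, hk⟩ : ∃ k, r = e * c + (k + 1) := ⟨r - e * c - 1, by omega⟩
    rw [hk, pow_add, mul_comm (u ^ c)] at h4
    have h5 : s ^ (k + 1) ∣ u ^ c := (mul_dvd_mul_iff_left (pow_ne_zero _ hs0)).1 h4
    have h6 : u ^ c ∈ P := P.mem_of_dvd h5 (Ideal.pow_mem_of_mem P hsP _ (Nat.succ_pos k))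
    exact hu (‹P.IsPrime›.mem_of_pow_mem _ h6)
  · obtain ⟨r, c, hrc, hd⟩ := key 0
    have h6 : τ' ^ c ∈ P := P.mem_of_dvd hd (Ideal.pow_mem_of_mem P hsP _ (by omega))
    exact hτP (‹P.IsPrime›.mem_of_pow_mem _ h6)



theorem aux_isIntegral_ring {C : Type*} [CommRing C] [IsNoetherianRing C] (A : Subring C)
    [IsNoetherianRing A] (τ z : C) (hτ : τ ∈ A) (hu : IsUnit τ)
    (h : ∀ e : ℕ, ∃ r c : ℕ, e * c < r ∧ τ ^ c * z ^ r ∈ A) : IsIntegral A z := by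
  have step : ∀ Q ∈ minimalPrimes C, ∃ g : Polynomial A, g.Monic ∧ aeval z g ∈ Q := by
    intro Q hQ
    have hQp : Q.IsPrime := hQ.1.1
    let K := FractionRing (C ⧸ Q)
    let φ : C →+* K := (algebraMap (C ⧸ Q) K).comp (Ideal.Quotient.mk Q)
    have hker : ∀ c, φ c = 0 → c ∈ Q := by
      intro c hc
      have : (Ideal.Quotient.mk Q) c = 0 := by
        apply IsFractionRing.injective (C ⧸ Q) K
        rw [map_zero]; exact hc
      exact Ideal.Quotient.eq_zero_iff_mem.1 this
    let ψ : A →+* A.map φ := φ.restrict A (A.map φ) (fun x hx => ⟨x, hx, rfl⟩)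
    have hψ : Function.Surjective ψ := by
      rintro ⟨_, x, hx, rfl⟩
      exact ⟨⟨x, hx⟩, rfl⟩
    have hN : IsNoetherianRing (A.map φ) := isNoetherianRing_of_surjective _ _ ψ hψ
    have hintg : IsIntegral (A.map φ) (φ z) := by
      apply aux_isIntegral_core (A.map φ) (φ τ) (φ z) ⟨τ, hτ, rfl⟩ (hu.map φ).ne_zero
      intro e
      obtain ⟨r, c, h1, h2⟩ := h e
      exact ⟨r, c, h1, _, h2, by simp⟩
    obtain ⟨f, hf, hfz⟩ := hintg
    have hlift : f ∈ Polynomial.lifts ψ := by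
      rw [Polynomial.lifts_iff_coeff_lifts]
      intro n
      exact hψ _
    obtain ⟨g, hg, -, hgm⟩ := Polynomial.lifts_and_natDegree_eq_and_monic hlift hf
    refine ⟨g, hgm, hker _ ?_⟩
    rw [← hg, Polynomial.eval₂_map] at hfz
    rw [Polynomial.aeval_def, Polynomial.hom_eval₂]
    exact hfz
  choose! g hg1 hg2 using step
  have hfin : (minimalPrimes C).Finite := minimalPrimes.finite_of_isNoetherianRing C
  let G := ∏ Q ∈ hfin.toFinset, g Q
  have hG : G.Monic := Polynomial.monic_prod_of_monic _ _ (fun Q hQ => hg1 Q (by simpa using hQ))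
  have hnil : IsNilpotent (aeval z G) := by
    rw [← mem_nilradical, nilradical, ← Ideal.sInf_minimalPrimes, Ideal.mem_sInf]
    intro Q hQ
    rw [map_prod]
    rw [← Finset.mul_prod_erase _ _ (hfin.mem_toFinset.2 hQ)]
    exact Ideal.mul_mem_right _ _ (hg2 Q hQ)
  obtain ⟨k, hk⟩ := hnil
  exact ⟨G ^ k, hG.pow k, by rw [← Polynomial.aeval_def, map_pow, hk]⟩

theorem aux_coeff_mul_mem {Γ : Type*} [AddCommMonoid Γ] [CommRing R] (N : Ideal R)
    (g h : AddMonoidAlgebra R Γ) (k : Γ)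
    (H : ∀ i j, i + j = k → g.coeff i * h.coeff j ∈ N) : (g * h).coeff k ∈ N := by
  classical
  rw [AddMonoidAlgebra.coeff_mul]
  refine Submodule.sum_mem _ fun i _ => ?_
  refine Submodule.sum_mem _ fun j _ => ?_
  dsimp only
  split_ifs with hij
  · exact H i j hij
  · exact N.zero_mem

/-- elements of the monoid algebra with coefficients in a multiplicative family of ideals -/
def auxGrSub {Γ : Type*} [AddCommMonoid Γ] [CommRing R] (G : Γ → Ideal R) (h1 : 1 ∈ G 0)
    (hm : ∀ i j, G i * G j ≤ G (i + j)) : Subalgebra R (AddMonoidAlgebra R Γ) where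
  carrier := {g | ∀ i, g.coeff i ∈ G i}
  mul_mem' := by
    intro a b ha hb k
    refine aux_coeff_mul_mem _ _ _ _ fun i j hij => ?_
    subst hij
    exact hm i j (Ideal.mul_mem_mul (ha i) (hb j))
  add_mem' := by
    intro a b ha hb k
    exact Ideal.add_mem _ (ha k) (hb k)
  algebraMap_mem' := by
    classical
    intro r k
    change (AddMonoidAlgebra.single 0 r).coeff k ∈ G k
    rw [AddMonoidAlgebra.coeff_single, Finsupp.single_apply]
    split_ifs with hk
    · subst hk; rw [← mul_one r]; exact Ideal.mul_mem_left _ _ h1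
    · exact Ideal.zero_mem _

theorem aux_integral_of_asymptotic [CommRing R] [IsNoetherianRing R] (J : Ideal R) (y : R) (n : ℕ)
    (h : ∀ e : ℕ, ∃ r c : ℕ, e * c < r ∧ y ^ r ∈ J ^ (n * r - c)) :
    IsIntegralOverIdeal (J ^ n) y := by
  classical
  obtain ⟨s, hs⟩ : J.FG := IsNoetherian.noetherian J
  let gens : Finset (LaurentPolynomial R) :=
    insert (LaurentPolynomial.T (-1)) (s.image fun a => LaurentPolynomial.C a * LaurentPolynomial.T 1)
  let A : Subalgebra R (LaurentPolynomial R) := Algebra.adjoin R (gens : Set (LaurentPolynomial R))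
  have hNA : IsNoetherianRing A := by
    have h2 : Algebra.FiniteType R A := by
      rw [← Subalgebra.fg_iff_finiteType]; exact ⟨gens, rfl⟩
    exact Algebra.FiniteType.isNoetherianRing R A
  have hNA' : IsNoetherianRing A.toSubring := hNA
  have hτA : (LaurentPolynomial.T (-1) : LaurentPolynomial R) ∈ A :=
    Algebra.subset_adjoin (by simp [gens])
  have hC : ∀ r : R, LaurentPolynomial.C r ∈ A := fun r => A.algebraMap_mem r
  have h1A : ∀ x ∈ J, LaurentPolynomial.C x * LaurentPolynomial.T 1 ∈ A := by
    intro x hx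
    rw [← hs] at hx
    induction hx using Submodule.span_induction with
    | mem x hx => exact Algebra.subset_adjoin (by
        simp only [gens, Finset.coe_insert, Finset.coe_image]
        exact Or.inr ⟨x, hx, rfl⟩)
    | zero => simp
    | add x y _ _ hx hy => rw [map_add, add_mul]; exact A.add_mem hx hy
    | smul a x _ hx => rw [smul_eq_mul, map_mul, mul_assoc]; exact A.mul_mem (hC a) hx
  have hNL : IsNoetherianRing (LaurentPolynomial R) :=
    IsLocalization.isNoetherianRing (Submonoid.powers (X : R[X])) _ inferInstance
  have hnA : ∀ (k : ℕ), ∀ x ∈ J ^ k, LaurentPolynomial.C x * LaurentPolynomial.T (k : ℤ) ∈ A := by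
    intro k
    induction k with
    | zero => intro x _; simpa using hC x
    | succ k ih =>
      intro x hx
      rw [pow_succ] at hx
      induction hx using Submodule.mul_induction_on' with
      | mem_mul_mem a ha b hb =>
        have := A.mul_mem (ih a ha) (h1A b hb)
        have e : (LaurentPolynomial.C (a * b) * LaurentPolynomial.T ((k + 1 : ℕ) : ℤ) : LaurentPolynomial R) =
          (LaurentPolynomial.C a * LaurentPolynomial.T (k : ℤ)) * (LaurentPolynomial.C b * LaurentPolynomial.T 1) := by
          rw [map_mul]; push_cast; rw [LaurentPolynomial.T_add]; ring
        rw [e]; exact this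
      | add x _ y _ hx hy => rw [map_add, add_mul]; exact A.add_mem hx hy
  let z : LaurentPolynomial R := LaurentPolynomial.C y * LaurentPolynomial.T (n : ℤ)
  have hzp : ∀ r : ℕ, z ^ r = LaurentPolynomial.C (y ^ r) * LaurentPolynomial.T ((n * r : ℕ) : ℤ) := by
    intro r
    rw [mul_pow, LaurentPolynomial.T_pow, map_pow]
    congr 2; push_cast; ring
  have hintg : IsIntegral A.toSubring z := by
    apply aux_isIntegral_ring A.toSubring (LaurentPolynomial.T (-1)) z hτA
      (LaurentPolynomial.isUnit_T _)
    intro e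
    obtain ⟨r, c, h1, h2⟩ := h e
    refine ⟨r, c, h1, ?_⟩
    have e1 : (LaurentPolynomial.T (-1) : LaurentPolynomial R) ^ c * z ^ r =
        LaurentPolynomial.C (y ^ r) * LaurentPolynomial.T (((n * r : ℕ) : ℤ) - c) := by
      rw [hzp, LaurentPolynomial.T_pow, mul_left_comm, ← LaurentPolynomial.T_add]
      congr 2; first | done | ring
    rw [e1]
    change _ ∈ A
    by_cases hc : c ≤ n * r
    · have := hnA _ _ h2
      rwa [Nat.cast_sub hc] at this
    · have : ((n * r : ℕ) : ℤ) - c = ((c - n * r : ℕ) : ℤ) * (-1) := by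
        rw [Nat.cast_sub (by omega)]; ring
      rw [this, ← LaurentPolynomial.T_pow]
      exact A.mul_mem (hC _) (A.pow_mem hτA _)
  have hAle : ∀ g ∈ A, ∀ i : ℤ, g.coeff i ∈ J ^ i.toNat := by
    have : A ≤ auxGrSub (fun i : ℤ => J ^ i.toNat) (by simp) (fun i j => by
        rw [← pow_add]; exact Ideal.pow_le_pow_right (by omega)) := by
      refine Algebra.adjoin_le ?_
      intro g hg
      simp only [gens, Finset.coe_insert, Finset.coe_image] at hg
      rcases hg with rfl | ⟨a, ha, rfl⟩
      · intro i
        rw [LaurentPolynomial.T, AddMonoidAlgebra.coeff_single, Finsupp.single_apply]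
        split_ifs with hi
        · subst hi; simp
        · simp
      · intro i
        change (LaurentPolynomial.C a * LaurentPolynomial.T 1).coeff i ∈ _
        rw [← LaurentPolynomial.single_eq_C_mul_T, AddMonoidAlgebra.coeff_single, Finsupp.single_apply]
        split_ifs with hi
        · subst hi; simpa using hs ▸ Ideal.subset_span ha
        · simp
    exact fun g hg => this hg
  obtain ⟨p, hp, hpz⟩ := hintg
  have hpz : aeval z p = 0 := hpz
  by_cases hR : Nontrivial R
  swap
  · rw [not_nontrivial_iff_subsingleton] at hR
    exact ⟨1, one_pos, fun _ => 0, by simp, Subsingleton.elim _ _⟩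
  have hnt : Nontrivial A.toSubring := inferInstance
  refine ⟨p.natDegree + 1, Nat.succ_pos _, fun i =>
    if i ≤ p.natDegree then (p.coeff (p.natDegree - i) : LaurentPolynomial R).coeff ((n * i : ℕ) : ℤ) else 0, ?_, ?_⟩
  · intro i hi
    dsimp only
    split_ifs
    · have := hAle _ (p.coeff (p.natDegree - i)).2 ((n * i : ℕ) : ℤ)
      rwa [Int.toNat_natCast, pow_mul] at this
    · exact Ideal.zero_mem _
  · have h1 : (aeval z p).coeff ((n * p.natDegree : ℕ) : ℤ) = 0 := by rw [hpz]; rfl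
    rw [Polynomial.aeval_eq_sum_range, AddMonoidAlgebra.coeff_sum, Finsupp.finset_sum_apply] at h1
    have h2 : ∀ i ∈ Finset.range (p.natDegree + 1),
        (p.coeff i • z ^ i).coeff ((n * p.natDegree : ℕ) : ℤ) =
        (p.coeff i : LaurentPolynomial R).coeff ((n * (p.natDegree - i) : ℕ) : ℤ) * y ^ i := by
      intro i hi
      rw [Subring.smul_def, smul_eq_mul, hzp, ← LaurentPolynomial.single_eq_C_mul_T]
      have : ((n * p.natDegree : ℕ) : ℤ) = ((n * (p.natDegree - i) : ℕ) : ℤ) + ((n * i : ℕ) : ℤ) := by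
        rw [← Nat.cast_add, ← mul_add, Nat.sub_add_cancel (by simpa [Nat.lt_succ_iff] using hi)]
      rw [this]
      exact AddMonoidAlgebra.coeff_mul_single_add _ _ _ _
    rw [Finset.sum_congr rfl h2, ← Finset.sum_range_reflect, Finset.sum_range_succ'] at h1
    have h3 : y * (∑ k ∈ Finset.range p.natDegree, (p.coeff (p.natDegree - (k+1)) : LaurentPolynomial R).coeff ((n * (k+1) : ℕ) : ℤ) * y ^ (p.natDegree - (k + 1)) + y ^ p.natDegree) = 0 := by
      convert congrArg (y * ·) h1 using 1
      · congr 1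
        refine congrArg₂ (· + ·) (Finset.sum_congr rfl fun k hk => ?_) ?_
        · have hk' := Finset.mem_range.1 hk
          have e1 : p.natDegree + 1 - 1 - (k + 1) = p.natDegree - (k + 1) := by omega
          have e2 : p.natDegree - (p.natDegree - (k + 1)) = k + 1 := by omega
          rw [e1, e2]
        · have e1 : p.natDegree + 1 - 1 - 0 = p.natDegree := by omega
          rw [e1, Nat.sub_self, Polynomial.coeff_natDegree, hp.leadingCoeff]
          have : ((1 : A.toSubring) : LaurentPolynomial R) = LaurentPolynomial.C 1 := by simp
          rw [this]
          have : (LaurentPolynomial.C (1 : R)).coeff (((n * 0 : ℕ)) : ℤ) = 1 := by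
            rw [← LaurentPolynomial.single_eq_C, AddMonoidAlgebra.coeff_single]; simp
          rw [this, one_mul]
      · simp
    refine Eq.trans ?_ h3
    rw [mul_add, add_comm, pow_succ', Finset.mul_sum]
    congr 1
    rw [Finset.sum_Icc_succ_top (by omega)]
    dsimp only
    rw [if_neg (by omega), zero_mul, add_zero]
    have : Finset.Icc 1 p.natDegree = (Finset.range p.natDegree).image (· + 1) := by
      ext i; simp only [Finset.mem_Icc, Finset.mem_image, Finset.mem_range]
      constructor
      · intro hi; exact ⟨i - 1, by omega, by omega⟩
      · rintro ⟨j, hj, rfl⟩; omega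
    rw [this, Finset.sum_image (by simp)]
    refine Finset.sum_congr rfl fun k hk => ?_
    have hk' := Finset.mem_range.1 hk
    rw [if_pos (by omega)]
    have e1 : p.natDegree + 1 - (k + 1) = (p.natDegree - (k + 1)) + 1 := by omega
    rw [e1, pow_succ]; ring



theorem aux_ceil_add_nat (a b : ℝ) : ⌈a + b⌉₊ ≤ ⌈a⌉₊ + ⌈b⌉₊ := Nat.ceil_add_le a b

/-- elements with `x^r ∈ J^(rγ - c)` for all `r` and a constant `c` -/
def auxFo [CommRing R] (J : Ideal R) (γ : ℝ) : Ideal R where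
  carrier := {x | ∃ c : ℕ, ∀ r : ℕ, x ^ r ∈ J ^ (⌈r * γ⌉₊ - c)}
  zero_mem' := by
    refine ⟨0, fun r => ?_⟩
    rcases Nat.eq_zero_or_pos r with rfl | hr
    · simp
    · rw [zero_pow hr.ne']; exact Ideal.zero_mem _
  add_mem' := by
    rintro x y ⟨c, hc⟩ ⟨c', hc'⟩
    refine ⟨c + c', fun r => ?_⟩
    rw [add_pow]
    refine Ideal.sum_mem _ fun i hi => Ideal.mul_mem_right _ _ ?_
    have h1 := Ideal.mul_mem_mul (hc i) (hc' (r - i))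
    rw [← pow_add] at h1
    refine Ideal.pow_le_pow_right ?_ h1
    have h2 : (r : ℝ) * γ = (i : ℝ) * γ + ((r - i : ℕ) : ℝ) * γ := by
      rw [← add_mul, ← Nat.cast_add, Nat.add_sub_cancel' (by simpa [Nat.lt_succ_iff] using hi)]
    have h3 := aux_ceil_add_nat ((i : ℝ) * γ) (((r - i : ℕ) : ℝ) * γ)
    rw [← h2] at h3
    omega
  smul_mem' := by
    rintro a x ⟨c, hc⟩
    refine ⟨c, fun r => ?_⟩
    rw [smul_eq_mul, mul_pow]
    exact Ideal.mul_mem_left _ _ (hc r)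

theorem auxFo_anti [CommRing R] (J : Ideal R) {γ δ : ℝ} (h : γ ≤ δ) : auxFo J δ ≤ auxFo J γ := by
  rintro x ⟨c, hc⟩
  refine ⟨c, fun r => Ideal.pow_le_pow_right ?_ (hc r)⟩
  have : ⌈(r : ℝ) * γ⌉₊ ≤ ⌈(r : ℝ) * δ⌉₊ := Nat.ceil_mono (by gcongr)
  omega

theorem auxFo_mul [CommRing R] (J : Ideal R) {γ δ : ℝ} {x y : R} (hx : x ∈ auxFo J γ)
    (hy : y ∈ auxFo J δ) : x * y ∈ auxFo J (γ + δ) := by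
  obtain ⟨c, hc⟩ := hx
  obtain ⟨c', hc'⟩ := hy
  refine ⟨c + c', fun r => ?_⟩
  rw [mul_pow]
  have h1 := Ideal.mul_mem_mul (hc r) (hc' r)
  rw [← pow_add] at h1
  refine Ideal.pow_le_pow_right ?_ h1
  have h3 := aux_ceil_add_nat ((r : ℝ) * γ) ((r : ℝ) * δ)
  rw [← mul_add] at h3
  omega

theorem auxFo_of_pow [CommRing R] (J : Ideal R) {γ : ℝ} {x : R} (m : ℕ) (hm : 0 < m)
    (h : x ^ m ∈ auxFo J (m * γ)) : x ∈ auxFo J γ := by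
  obtain ⟨c, hc⟩ := h
  refine ⟨c + ⌈m * γ⌉₊, fun r => ?_⟩
  have hr : m * (r / m) + r % m = r := Nat.div_add_mod r m
  have hs : r % m < m := Nat.mod_lt _ hm
  set q := r / m
  set s := r % m
  have h1 := hc q
  rw [← pow_mul] at h1
  rw [← hr, pow_add]
  refine Ideal.mul_mem_right _ _ (Ideal.pow_le_pow_right ?_ h1)
  have h2 : ((m * q + s : ℕ) : ℝ) * γ = (q : ℝ) * (m * γ) + s * γ := by push_cast; ring
  have h3 := aux_ceil_add_nat ((q : ℝ) * (m * γ)) (s * γ)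
  rw [← h2] at h3
  have h4 : ⌈(s : ℝ) * γ⌉₊ ≤ ⌈m * γ⌉₊ := by
    rcases le_total 0 γ with hg | hg
    · exact Nat.ceil_mono (by gcongr)
    · rw [Nat.ceil_eq_zero.2 (mul_nonpos_of_nonneg_of_nonpos (by positivity) hg)]; exact Nat.zero_le _
  omega

theorem aux_pow_le_Fo [CommRing R] (J : Ideal R) (n : ℕ) : J ^ n ≤ auxFo J n := by
  intro x hx
  refine ⟨0, fun r => ?_⟩
  rw [← Nat.cast_mul, Nat.ceil_natCast, Nat.sub_zero, mul_comm, pow_mul]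
  exact Ideal.pow_mem_pow hx r

theorem auxFo_top [CommRing R] (J : Ideal R) {γ : ℝ} (h : γ ≤ 0) : auxFo J γ = ⊤ := by
  refine eq_top_iff.2 ((Eq.ge ?_).trans ((aux_pow_le_Fo J 0).trans (auxFo_anti J (by simpa using h))))
  simp

theorem aux_nilpotent [CommRing R] [IsLocalRing R] [IsNoetherianRing R] (x : R)
    (h : ∀ N : ℕ, x ∈ auxFo (maximalIdeal R) N) : IsNilpotent x := by
  by_contra hx
  obtain ⟨p, hp1, hp2⟩ : ∃ p : Ideal R, p ∈ {I : Ideal R | Disjoint (I : Set R) (Submonoid.powers x : Set R)} ∧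
    ∀ J ∈ {I : Ideal R | Disjoint (I : Set R) (Submonoid.powers x : Set R)}, ¬ p < J := set_has_maximal_iff_noetherian.2 (inferInstanceAs (IsNoetherian R R))
    {I : Ideal R | Disjoint (I : Set R) (Submonoid.powers x : Set R)} ⟨⊥, by
      rw [Set.mem_setOf_eq, Set.disjoint_left]
      rintro a ha ⟨n, hn⟩
      rw [SetLike.mem_coe, Ideal.mem_bot] at ha
      exact hx ⟨n, by rw [← ha]; exact hn⟩⟩
  have hpp : p.IsPrime := Ideal.isPrime_of_maximally_disjoint p (Submonoid.powers x) hp1 (by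
    intro J hJ hd
    exact hp2 J hd hJ)
  have hxp : x ∉ p := fun h => Set.disjoint_left.1 hp1 h ⟨1, by simp⟩
  have hQ : ∀ Q : Ideal R, Q.IsPrime → p < Q → x ∈ Q := by
    intro Q hQ hlt
    by_contra hxQ
    refine hp2 Q ?_ hlt
    rw [Set.mem_setOf_eq, Set.disjoint_left]
    rintro a ha ⟨n, rfl⟩
    exact hxQ (hQ.mem_of_pow_mem n ha)
  have hxm : x ∈ maximalIdeal R := by
    obtain ⟨c, hc⟩ := h 1
    have := hc (c + 1)
    have e : ⌈((c + 1 : ℕ) : ℝ) * ((1 : ℕ) : ℝ)⌉₊ - c = 1 := by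
      rw [Nat.cast_one, mul_one, Nat.ceil_natCast]; omega
    rw [e, pow_one] at this
    exact (maximalIdeal.isMaximal R).isPrime.mem_of_pow_mem _ this
  -- primes containing p + (x), minimal
  have hrad : (p ⊔ Ideal.span {x}).radical = maximalIdeal R := by
    have hle : p ⊔ Ideal.span {x} ≤ maximalIdeal R :=
      sup_le (le_maximalIdeal hpp.ne_top) ((Ideal.span_singleton_le_iff_mem _).2 hxm)
    by_contra hne
    have hfin := Ideal.finite_minimalPrimes_of_isNoetherianRing R (p ⊔ Ideal.span {x})
    have hnot : ∀ P ∈ (p ⊔ Ideal.span {x}).minimalPrimes, ¬ maximalIdeal R ≤ P := by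
      intro P hP hmP
      have hPm : P = maximalIdeal R := le_antisymm (le_maximalIdeal hP.1.1.ne_top) hmP
      apply hne
      rw [Ideal.radical_eq_sInf]
      apply le_antisymm
      · exact sInf_le ⟨hle, inferInstance⟩
      · refine le_sInf fun Q hQ' => ?_
        rw [← hPm]
        exact hP.2 ⟨hQ'.2, hQ'.1⟩ (by rw [hPm]; exact le_maximalIdeal hQ'.2.ne_top)
    have hav : ¬ ((maximalIdeal R : Set R) ⊆ ⋃ P ∈ (hfin.toFinset : Set (Ideal R)), (P : Set R)) := by
      rw [Ideal.subset_union_prime (R := R) (f := fun P : Ideal R => P) ⊥ ⊥ (by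
        intro P hP _ _
        exact (hfin.mem_toFinset.1 hP).1.1)]
      rintro ⟨P, hP, hmP⟩
      exact hnot P (hfin.mem_toFinset.1 hP) hmP
    rw [Set.not_subset] at hav
    obtain ⟨y, hym, hyP⟩ := hav
    have hyP' : ∀ P ∈ (p ⊔ Ideal.span {x}).minimalPrimes, y ∉ P := by
      intro P hP hy
      exact hyP (Set.mem_biUnion (hfin.mem_toFinset.2 hP) hy)
    -- pass to the domain
    let D := R ⧸ p
    let π := Ideal.Quotient.mk p
    have hyp : y ∉ p := by
      intro hy
      obtain ⟨P, hP, -⟩ := Ideal.exists_minimalPrimes_le hle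
      exact hyP' P hP (hP.1.2 (Ideal.mem_sup_left hy))
    have hDn : Nontrivial D := Ideal.Quotient.nontrivial_iff.2 hpp.ne_top
    have hDl : IsLocalRing D := IsLocalRing.of_surjective' π Ideal.Quotient.mk_surjective
    have hnu : Ideal.span {π y} ≤ maximalIdeal D := by
      rw [Ideal.span_singleton_le_iff_mem]
      intro hu
      obtain ⟨b, hb⟩ := hu.exists_right_inv
      obtain ⟨b, rfl⟩ := Ideal.Quotient.mk_surjective b
      have h1 : y * b - 1 ∈ p := by
        rw [← Ideal.Quotient.eq, map_mul, map_one]; exact hb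
      have h2 : y * b - 1 ∈ maximalIdeal R := le_maximalIdeal hpp.ne_top h1
      have h3 : (1 : R) ∈ maximalIdeal R := by
        have := Ideal.sub_mem _ (Ideal.mul_mem_right b _ hym) h2
        simpa using this
      exact (Ideal.ne_top_iff_one _).1 (maximalIdeal.isMaximal R).ne_top h3
    obtain ⟨Q, hQ1, -⟩ := Ideal.exists_minimalPrimes_le hnu
    have hQp : Q.IsPrime := hQ1.1.1
    have hQh : Q.height ≤ 1 := Ideal.height_le_one_of_isPrincipal_of_mem_minimalPrimes _ Q hQ1
    have hyQ : π y ∈ Q := hQ1.1.2 (Ideal.mem_span_singleton_self _)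
    have hxQ : x ∈ Q.comap π := by
      refine hQ _ (Ideal.comap_isPrime π Q) (lt_of_le_of_ne ?_ ?_)
      · intro a ha
        rw [Ideal.mem_comap, Ideal.Quotient.eq_zero_iff_mem.2 ha]; exact Q.zero_mem
      · intro he
        exact hyp (he ▸ (by exact hyQ : y ∈ Q.comap π))
    have hple : p ⊔ Ideal.span {x} ≤ Q.comap π := by
      refine sup_le ?_ ((Ideal.span_singleton_le_iff_mem _).2 hxQ)
      intro a ha
      rw [Ideal.mem_comap, Ideal.Quotient.eq_zero_iff_mem.2 ha]; exact Q.zero_mem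
    have : (Q.comap π).IsPrime := Ideal.comap_isPrime π Q
    obtain ⟨P, hP, hPQ⟩ := Ideal.exists_minimalPrimes_le hple
    have hPp : P.IsPrime := hP.1.1
    have hker : RingHom.ker π ≤ P := by
      rw [Ideal.mk_ker]; exact le_sup_left.trans hP.1.2
    have hmapP : (P.map π).IsPrime := Ideal.map_isPrime_of_surjective Ideal.Quotient.mk_surjective hker
    have hPQ' : P.map π = Q := by
      refine aux_eq_of_height_le_one Q (P.map π) hQh ?_ (Ideal.map_le_iff_le_comap.2 hPQ)
      intro h0
      have : π x ∈ P.map π := Ideal.mem_map_of_mem _ (hP.1.2 (Ideal.mem_sup_right (Ideal.mem_span_singleton_self x)))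
      rw [h0, Ideal.mem_bot] at this
      exact hxp (Ideal.Quotient.eq_zero_iff_mem.1 this)
    have : y ∈ P := by
      have h1 : y ∈ (P.map π).comap π := by rw [Ideal.mem_comap, hPQ']; exact hyQ
      rw [Ideal.comap_map_of_surjective π Ideal.Quotient.mk_surjective, ← RingHom.ker_eq_comap_bot] at h1
      exact (sup_le le_rfl hker) h1
    exact hyP' P hP this
  obtain ⟨c, hc⟩ := Ideal.exists_radical_pow_le_of_fg (p ⊔ Ideal.span {x})
    (IsNoetherian.noetherian _)
  rw [hrad] at hc
  have hc1 : maximalIdeal R ^ (c + 1) ≤ p ⊔ Ideal.span {x} := (Ideal.pow_le_pow_right (Nat.le_succ c)).trans hc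
  obtain ⟨c', hc'⟩ := h (2 * (c + 1))
  set r := c' + 1 with hr
  have h1 : maximalIdeal R ^ ((c + 1) * r) ≤ p ⊔ Ideal.span {x ^ r} := by
    rw [pow_mul]
    refine (Ideal.pow_right_mono hc1 r).trans ?_
    intro a ha
    have h2 : Ideal.Quotient.mk p a ∈ Ideal.map (Ideal.Quotient.mk p) ((p ⊔ Ideal.span {x}) ^ r) :=
      Ideal.mem_map_of_mem _ ha
    rw [Ideal.map_pow, Ideal.map_sup, Ideal.map_quotient_self, bot_sup_eq, Ideal.map_span, Set.image_singleton,
      Ideal.span_singleton_pow, Ideal.mem_span_singleton] at h2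
    obtain ⟨b, hb⟩ := h2
    obtain ⟨b, rfl⟩ := Ideal.Quotient.mk_surjective b
    rw [← map_pow, ← map_mul, Ideal.Quotient.eq] at hb
    have : a = (a - x ^ r * b) + x ^ r * b := by ring
    rw [this]
    exact Ideal.add_mem _ (Ideal.mem_sup_left hb) (Ideal.mem_sup_right (Ideal.mul_mem_right _ _ (Ideal.mem_span_singleton_self _)))
  have h2 : x ^ r ∈ maximalIdeal R ^ ((c + 1) * r + 1) := by
    refine Ideal.pow_le_pow_right ?_ (hc' r)
    have e : ⌈(r : ℝ) * ((2 * (c + 1) : ℕ) : ℝ)⌉₊ = r * (2 * (c + 1)) := by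
      rw [← Nat.cast_mul, Nat.ceil_natCast]
    rw [e]
    have : r * (2 * (c + 1)) = (c + 1) * r + (c + 1) * r := by ring
    have h3 : r ≤ (c + 1) * r := Nat.le_mul_of_pos_left _ (Nat.succ_pos c)
    omega
  have h3 : maximalIdeal R ^ ((c + 1) * r) ≤ p ⊔ maximalIdeal R • (maximalIdeal R ^ ((c + 1) * r)) := by
    refine h1.trans (sup_le_sup_left ?_ _)
    rw [Ideal.span_singleton_le_iff_mem, smul_eq_mul, ← pow_succ']
    exact h2
  have h4 : maximalIdeal R ^ ((c + 1) * r) ≤ p :=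
    Submodule.le_of_le_smul_of_le_jacobson_bot (IsNoetherian.noetherian _)
      (by rw [IsLocalRing.jacobson_eq_maximalIdeal _ bot_ne_top]) h3
  exact hxp (hpp.mem_of_pow_mem _ (h4 (Ideal.pow_mem_pow hxm _)))



theorem auxFo_map {A B : Type*} [CommRing A] [CommRing B] (f : A →+* B) (J : Ideal A) (K : Ideal B)
    (h : J.map f ≤ K) (γ : ℝ) {x : A} (hx : x ∈ auxFo J γ) : f x ∈ auxFo K γ := by
  obtain ⟨c, hc⟩ := hx
  refine ⟨c, fun r => ?_⟩
  rw [← map_pow]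
  have := Ideal.mem_map_of_mem f (hc r)
  rw [Ideal.map_pow] at this
  exact Ideal.pow_right_mono h _ this

theorem aux_completion_noetherian_of_surj {P A : Type*} [CommRing A] [CommRing P] (X : Ideal P) (m : Ideal A)
    (ev : P →+* A) (hev : Function.Surjective ev) (hmap : X.map ev = m)
    (hN1 : IsNoetherianRing (AdicCompletion X P)) : IsNoetherianRing (AdicCompletion m A) := by
  have hmapk : ∀ k, (X ^ k).map ev = m ^ k := fun k => by rw [Ideal.map_pow, hmap]
  let q : ∀ k, P ⧸ X ^ k →+* A ⧸ m ^ k := fun k =>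
    Ideal.quotientMap (m ^ k) ev (by rw [← Ideal.map_le_iff_le_comap, hmapk])
  let φ : AdicCompletion X P →+* AdicCompletion m A :=
    AdicCompletion.liftRingHom m (fun k => (q k).comp (AdicCompletion.evalₐ X k).toRingHom) (by
      intro a b hab
      ext x
      obtain ⟨f, rfl⟩ := AdicCompletion.mk_surjective X P x
      simp only [RingHom.comp_apply, AlgHom.toRingHom_eq_coe, RingHom.coe_coe, AdicCompletion.evalₐ_mk]
      simp only [q, Ideal.quotientMap_mk]
      change Ideal.Quotient.mk _ _ = _
      rw [Ideal.Quotient.eq, ← map_sub, ← hmapk]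
      refine Ideal.mem_map_of_mem _ ?_
      have := (f.2 hab)
      have h2 := SModEq.sub_mem.1 this.symm
      simpa using h2)
  refine isNoetherianRing_of_surjective _ _ φ ?_
  intro x
  obtain ⟨f, rfl⟩ := AdicCompletion.mk_surjective m A x
  have hf : ∀ k, f (k + 1) - f k ∈ m ^ k := by
    intro k
    have h2 := SModEq.sub_mem.1 (f.2 (Nat.le_succ k)).symm
    simpa using h2
  have hg : ∀ k, ∃ g : P, g ∈ X ^ k ∧ ev g = f (k + 1) - f k := by
    intro k
    have := hf k
    rw [← hmapk, Ideal.mem_map_iff_of_surjective _ hev] at this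
    exact this
  choose g hg1 hg2 using hg
  have h0 := hev (f 0)
  let p : ℕ → P := fun k => h0.choose + ∑ i ∈ Finset.range k, g i
  have hp : ∀ k, ev (p k) = f k := by
    intro k
    induction k with
    | zero => simpa [p] using h0.choose_spec
    | succ k ih =>
      have : p (k + 1) = p k + g k := by simp [p, Finset.sum_range_succ, add_assoc]
      rw [this, map_add, ih, hg2]; ring
  let F : AdicCompletion.AdicCauchySequence X P := AdicCompletion.AdicCauchySequence.mk X P p (by
    intro k
    rw [SModEq.sub_mem]
    have : p k - p (k + 1) = - g k := by simp [p, Finset.sum_range_succ, ← add_assoc]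
    rw [this]
    simpa using (X ^ k).neg_mem (hg1 k))
  refine ⟨AdicCompletion.mk X P F, ?_⟩
  apply AdicCompletion.ext_evalₐ
  intro k
  rw [AdicCompletion.evalₐ_liftRingHom]
  simp only [RingHom.comp_apply, AlgHom.toRingHom_eq_coe, RingHom.coe_coe, AdicCompletion.evalₐ_mk]
  simp only [q, Ideal.quotientMap_mk]
  exact congrArg _ (hp k)

/-- The completion of a noetherian local ring is noetherian. -/
theorem aux_completion_noetherian (A : Type*) [CommRing A] [IsNoetherianRing A] (m : Ideal A) :
    IsNoetherianRing (AdicCompletion m A) := by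
  obtain ⟨n, s, hs⟩ := Submodule.fg_iff_exists_fin_generating_family.1 (IsNoetherian.noetherian m)
  refine aux_completion_noetherian_of_surj (MvPolynomial.idealOfVars (Fin n) A) m (MvPolynomial.eval s)
    (fun a => ⟨MvPolynomial.C a, by simp⟩) ?_ (isNoetherianRing_of_ringEquiv _
      (MvPowerSeries.toAdicCompletionAlgEquiv (Fin n) A).toRingEquiv)
  simp only [MvPolynomial.idealOfVars, Ideal.map_span, ← hs]
  congr 1
  ext y
  simp

theorem aux_M8 [CommRing R] [IsLocalRing R] [IsNoetherianRing R]
    (hAU : IsReduced (AdicCompletion (maximalIdeal R) R)) (J : Ideal R) (hJ : J ≤ maximalIdeal R) (k : ℕ) :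
    ∃ N : ℕ, auxFo J N ≤ maximalIdeal R ^ k := by
  by_contra hcon
  push Not at hcon
  have hNoeth := aux_completion_noetherian R (maximalIdeal R)
  set m := maximalIdeal R with hm
  have hanti : ∀ a b : ℕ, a ≤ b → auxFo J (b : ℝ) ≤ auxFo J (a : ℝ) := fun a b h =>
    auxFo_anti J (by exact_mod_cast h)
  -- stabilization
  have hst : ∀ M : ℕ, ∃ N : ℕ, ∀ N' ≥ N, auxFo J (N' : ℝ) ⊔ m ^ M = auxFo J (N : ℝ) ⊔ m ^ M := by
    intro M
    have hart : IsArtinianRing (R ⧸ m ^ M) := by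
      rcases Nat.eq_zero_or_pos M with rfl | hM
      · have : Subsingleton (R ⧸ m ^ 0) := by
          rw [Ideal.Quotient.subsingleton_iff]; simp
        infer_instance
      · exact IsLocalRing.quotient_artinian_of_mem_minimalPrimes_of_isLocalRing _ (by
          refine ⟨⟨inferInstance, Ideal.pow_le_self hM.ne'⟩, ?_⟩
          rintro Q ⟨hQ, hle⟩ -
          exact (Ideal.IsPrime.pow_le_iff hM.ne').1 hle)
    have hwf := (IsArtinian.monotone_stabilizes (R := R ⧸ m ^ M) (M := R ⧸ m ^ M)
      ⟨fun N : ℕ => OrderDual.toDual ((auxFo J (N : ℝ)).map (Ideal.Quotient.mk (m ^ M))), fun a b h =>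
        Ideal.map_mono (hanti a b h)⟩)
    obtain ⟨N, hN⟩ := hwf
    refine ⟨N, fun N' hN' => ?_⟩
    have h1 : (auxFo J (N : ℝ)).map (Ideal.Quotient.mk (m ^ M)) = (auxFo J (N' : ℝ)).map (Ideal.Quotient.mk (m ^ M)) := hN N' hN'
    have h2 := congrArg (Ideal.comap (Ideal.Quotient.mk (m ^ M))) h1
    rw [Ideal.comap_map_of_surjective _ Ideal.Quotient.mk_surjective,
      Ideal.comap_map_of_surjective _ Ideal.Quotient.mk_surjective, ← RingHom.ker_eq_comap_bot, Ideal.mk_ker] at h2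
    exact h2.symm
  choose N hN using hst
  have hE : ∀ M, ∀ x ∈ auxFo J (N M : ℝ) ⊔ m ^ M, ∀ N' : ℕ, x ∈ auxFo J (N' : ℝ) ⊔ m ^ M := by
    intro M x hx N'
    rcases le_total (N M) N' with h | h
    · rw [hN M N' h]; exact hx
    · exact sup_le_sup_right (hanti _ _ h) _ hx
  obtain ⟨x0, hx0, hx0k⟩ := Set.not_subset.1 (hcon (N k))
  have hstep : ∀ M, ∀ x ∈ auxFo J (N M : ℝ) ⊔ m ^ M, ∃ y ∈ auxFo J (N (M+1) : ℝ) ⊔ m ^ (M+1), y - x ∈ m ^ M := by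
    intro M x hx
    obtain ⟨y, hy, z, hz, rfl⟩ := Submodule.mem_sup.1 (hE M x hx (N (M+1)))
    exact ⟨y, Ideal.mem_sup_left hy, by simpa using hz⟩
  choose! nx hnx1 hnx2 using hstep
  let u : ℕ → R := fun i => Nat.rec x0 (fun i x => nx (k + i) x) i
  have hu1 : ∀ i, u i ∈ auxFo J (N (k + i) : ℝ) ⊔ m ^ (k + i) := by
    intro i
    induction i with
    | zero => exact Ideal.mem_sup_left hx0
    | succ i ih => exact hnx1 (k + i) (u i) ih
  have hu2 : ∀ i, u (i + 1) - u i ∈ m ^ (k + i) := fun i => hnx2 (k + i) (u i) (hu1 i)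
  let F : AdicCompletion.AdicCauchySequence m R := AdicCompletion.AdicCauchySequence.mk m R u (by
    intro i
    rw [SModEq.sub_mem]
    have := (m ^ (k + i)).neg_mem (hu2 i)
    rw [neg_sub] at this
    have h2 : u i - u (i + 1) ∈ m ^ i := Ideal.pow_le_pow_right (Nat.le_add_left _ _) this
    simpa using h2)
  let x := AdicCompletion.mk m R F
  have hdiff : ∀ i j, u (i + j) - u i ∈ m ^ (k + i) := by
    intro i j
    induction j with
    | zero => simp
    | succ j ih =>
      have := Ideal.add_mem _ (Ideal.pow_le_pow_right (by omega) (hu2 (i + j)) : _ ∈ m ^ (k + i)) ih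
      simpa [← add_assoc] using this
  have hxev : ∀ i, AdicCompletion.evalₐ m i x = Ideal.Quotient.mk _ (u i) := by
    intro i
    exact AdicCompletion.evalₐ_mk m i F
  have hxne : x ≠ 0 := by
    intro h0
    have h1 := hxev k
    rw [h0, map_zero] at h1
    have h2 := Ideal.Quotient.eq_zero_iff_mem.1 h1.symm
    have h3 := hdiff 0 k
    rw [zero_add, add_zero] at h3
    have := Ideal.sub_mem _ h2 h3
    apply hx0k
    simpa [u] using this
  have hmm : m.map (algebraMap R (AdicCompletion m R)) = maximalIdeal (AdicCompletion m R) :=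
    AdicCompletion.maximalIdeal_eq_map.symm
  have hker : ∀ M (z : AdicCompletion m R), AdicCompletion.evalₐ m M z = 0 → z ∈ maximalIdeal (AdicCompletion m R) ^ M := by
    intro M z hz
    have h1 := AdicCompletion.pow_smul_top_eq_ker_eval (I := m) (M := R) (n := M) (IsNoetherian.noetherian m)
    have h2 : z ∈ (AdicCompletion.eval m R M).ker := by
      rw [LinearMap.mem_ker, ← AdicCompletion.factor_evalₐ_eq_eval m z (by simp), hz, map_zero]
    rw [← h1] at h2
    rw [← hmm, ← Ideal.map_pow]
    have h3 := Ideal.smul_top_eq_map (S := AdicCompletion m R) (m ^ M)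
    rw [h3] at h2
    exact h2
  apply hxne
  refine (aux_nilpotent x ?_).eq_zero
  intro n
  obtain ⟨y, hy, z, hz, hyz⟩ := Submodule.mem_sup.1 (hE (k + n) (u n) (hu1 n) n)
  have h1 : algebraMap R (AdicCompletion m R) y ∈ auxFo (maximalIdeal (AdicCompletion m R)) n :=
    auxFo_map _ J _ (by rw [← hmm]; exact Ideal.map_mono hJ) _ hy
  have h2 : x - algebraMap R (AdicCompletion m R) y ∈ maximalIdeal (AdicCompletion m R) ^ n := by
    apply hker
    rw [map_sub, hxev, AlgHom.commutes, Ideal.Quotient.algebraMap_eq, ← map_sub, Ideal.Quotient.eq_zero_iff_mem, ← hyz]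
    simpa using Ideal.pow_le_pow_right (Nat.le_add_left _ _) hz
  have := Ideal.add_mem _ (aux_pow_le_Fo _ n h2) h1
  simpa using this



theorem aux_eval_mem [CommRing R] {σ : Type*} (a : σ → R) (K : Ideal R) (n : ℕ)
    (F : MvPolynomial σ R) (hF : F.IsHomogeneous n) (hK : ∀ u, F.coeff u ∈ K) :
    MvPolynomial.eval a F ∈ K * (Ideal.span (Set.range a)) ^ n := by
  classical
  rw [MvPolynomial.eval_eq]
  refine Ideal.sum_mem _ fun u hu => Ideal.mul_mem_mul (hK u) ?_
  rw [Ideal.mem_span_pow_iff_exists_isHomogeneous]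
  have hdeg : u.degree = n := by
    rw [Finsupp.degree_eq_weight_one]; exact hF (MvPolynomial.mem_support_iff.1 hu)
  exact ⟨MvPolynomial.monomial u 1, MvPolynomial.isHomogeneous_monomial _ hdeg, by simp [MvPolynomial.eval_monomial, Finsupp.prod]⟩

theorem aux_exists_form [CommRing R] {σ : Type*} (a : σ → R) (K : Ideal R) (n : ℕ) (y : R)
    (hy : y ∈ K * (Ideal.span (Set.range a)) ^ n) :
    ∃ G : MvPolynomial σ R, G.IsHomogeneous n ∧ (∀ u, G.coeff u ∈ K) ∧ MvPolynomial.eval a G = y := by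
  refine Submodule.mul_induction_on hy ?_ ?_
  · intro k hk z hz
    obtain ⟨H, hH, rfl⟩ := (Ideal.mem_span_pow_iff_exists_isHomogeneous a z).1 hz
    refine ⟨MvPolynomial.C k * H, ?_, fun u => ?_, by simp⟩
    · simpa using (MvPolynomial.isHomogeneous_C σ k).mul hH
    · rw [MvPolynomial.coeff_C_mul]; exact Ideal.mul_mem_right _ _ hk
  · rintro x y ⟨G, h1, h2, rfl⟩ ⟨G', h1', h2', rfl⟩
    exact ⟨G + G', h1.add h1', fun u => by rw [MvPolynomial.coeff_add]; exact Ideal.add_mem _ (h2 u) (h2' u), by simp⟩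

theorem aux_quasi_of_zero [CommRing R] {σ : Type*} (a : σ → R) (n : ℕ)
    (h : ∀ F : MvPolynomial σ R, F.IsHomogeneous n → MvPolynomial.eval a F = 0 → ∀ u, F.coeff u ∈ Ideal.span (Set.range a))
    (F : MvPolynomial σ R) (hF : F.IsHomogeneous n)
    (hz : MvPolynomial.eval a F ∈ (Ideal.span (Set.range a)) ^ (n + 1)) (u : σ →₀ ℕ) :
    F.coeff u ∈ Ideal.span (Set.range a) := by
  rw [pow_succ'] at hz
  obtain ⟨G, h1, h2, h3⟩ := aux_exists_form a _ n _ hz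
  have h4 := h (F - G) (hF.sub h1) (by rw [map_sub, h3, sub_self]) u
  rw [MvPolynomial.coeff_sub] at h4
  have := Ideal.add_mem _ h4 (h2 u)
  simpa using this

/-- regular sequences, the element `a 0` being the last one. -/
def auxReg [CommRing R] : (r : ℕ) → (Fin r → R) → Prop
  | 0, _ => True
  | r + 1, a => auxReg r (fun i => a i.succ) ∧
      ∀ y, a 0 * y ∈ Ideal.span (Set.range (fun i : Fin r => a i.succ)) →
        y ∈ Ideal.span (Set.range (fun i : Fin r => a i.succ))

theorem aux_range_le [CommRing R] {r : ℕ} (a : Fin (r + 1) → R) :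
    Ideal.span (Set.range (fun i : Fin r => a i.succ)) ≤ Ideal.span (Set.range a) :=
  Ideal.span_mono (by rintro _ ⟨i, rfl⟩; exact ⟨_, rfl⟩)

theorem aux_split [CommRing R] {r : ℕ} (a : Fin (r + 1) → R) (n : ℕ) (F : MvPolynomial (Fin (r + 1)) R)
    (hF : F.IsHomogeneous (n + 1)) : ∃ (F0 : MvPolynomial (Fin r) R) (F1 : MvPolynomial (Fin (r + 1)) R),
      F0.IsHomogeneous (n + 1) ∧ F1.IsHomogeneous n ∧
      MvPolynomial.eval a F = MvPolynomial.eval (fun i : Fin r => a i.succ) F0 + a 0 * MvPolynomial.eval a F1 ∧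
      (∀ u, (∃ v, F.coeff u = F0.coeff v) ∨ (∃ v, F.coeff u = F1.coeff v)) := by
  let f := MvPolynomial.finSuccEquiv R r F
  let F1 := (MvPolynomial.finSuccEquiv R r).symm f.divX
  have hF1 : ∀ i (m : Fin r →₀ ℕ), F1.coeff (m.cons i) = F.coeff (m.cons (i + 1)) := by
    intro i m
    rw [← MvPolynomial.finSuccEquiv_coeff_coeff, ← MvPolynomial.finSuccEquiv_coeff_coeff, AlgEquiv.apply_symm_apply, Polynomial.coeff_divX]
  have ha : a = Fin.cons (a 0) (fun i : Fin r => a i.succ) := (Fin.cons_self_tail a).symm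
  refine ⟨f.coeff 0, F1, hF.finSuccEquiv_coeff_isHomogeneous 0 (n + 1) (zero_add _), ?_, ?_, ?_⟩
  · intro u hu
    rw [← Finsupp.cons_tail u, hF1] at hu
    have h1 := hF hu
    change Finsupp.weight (fun _ => 1) _ = _ at h1
    change Finsupp.weight (fun _ => 1) _ = _
    rw [← Finsupp.degree_eq_weight_one] at h1 ⊢
    simp only [Finsupp.cons_tail, Finsupp.degree_eq_sum, Fin.sum_univ_succ, Finsupp.cons_zero, Finsupp.cons_succ] at h1 ⊢
    simp only [Finsupp.tail_apply] at h1
    omega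
  · conv_lhs => rw [ha, MvPolynomial.eval_eq_eval_mv_eval']
    have h2 : MvPolynomial.eval a F1 = Polynomial.eval (a 0) (Polynomial.map (MvPolynomial.eval (fun i : Fin r => a i.succ)) f.divX) := by
      conv_lhs => rw [ha, MvPolynomial.eval_eq_eval_mv_eval', AlgEquiv.apply_symm_apply]
    rw [h2]
    have h3 : MvPolynomial.finSuccEquiv R r F = f.divX * Polynomial.X + Polynomial.C (f.coeff 0) := (Polynomial.divX_mul_X_add f).symm
    rw [h3]
    simp only [Polynomial.map_add, Polynomial.map_mul, Polynomial.map_X, Polynomial.map_C, Polynomial.eval_add, Polynomial.eval_mul, Polynomial.eval_X, Polynomial.eval_C]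
    ring
  · intro u
    rw [← Finsupp.cons_tail u]
    rcases h : u 0 with _ | i
    · left; exact ⟨u.tail, by rw [MvPolynomial.finSuccEquiv_coeff_coeff]⟩
    · right; exact ⟨u.tail.cons i, by rw [hF1]⟩

theorem aux_quasi_zero [CommRing R] : ∀ (r : ℕ) (a : Fin r → R), auxReg r a → ∀ (n : ℕ)
    (F : MvPolynomial (Fin r) R), F.IsHomogeneous n → MvPolynomial.eval a F = 0 → ∀ u, F.coeff u ∈ Ideal.span (Set.range a) := by
  intro r
  induction r with
  | zero =>
    intro a _ n F hF h0 u
    rw [MvPolynomial.eq_C_of_isEmpty F] at h0 ⊢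
    rw [MvPolynomial.eval_C] at h0
    rw [h0]; simp
  | succ r ih =>
    rintro a ⟨hreg, ha0⟩ n
    set a' : Fin r → R := fun i => a i.succ with ha'
    set J' := Ideal.span (Set.range a') with hJ'
    set J := Ideal.span (Set.range a) with hJ
    have hJJ : J' ≤ J := aux_range_le a
    have claim : ∀ j y, a 0 * y ∈ J' ^ j → y ∈ J' ^ j := by
      intro j
      induction j with
      | zero => intro y _; simp
      | succ j ihj =>
        intro y hy
        have h1 := ihj y (Ideal.pow_le_pow_right (Nat.le_succ j) hy)
        obtain ⟨G, hG, rfl⟩ := (Ideal.mem_span_pow_iff_exists_isHomogeneous a' y).1 h1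
        have h2 := aux_quasi_of_zero a' j (ih a' hreg j) (MvPolynomial.C (a 0) * G)
          (by simpa using (MvPolynomial.isHomogeneous_C _ (a 0)).mul hG) (by simpa using hy)
        rw [pow_succ']
        refine aux_eval_mem a' _ j G hG fun u => ha0 _ ?_
        have := h2 u
        rwa [MvPolynomial.coeff_C_mul] at this
    induction n with
    | zero =>
      intro F hF h0 u
      have : F = MvPolynomial.C (F.coeff 0) := (MvPolynomial.totalDegree_eq_zero_iff_eq_C).1 (Nat.le_zero.1 hF.totalDegree_le)
      rw [this, MvPolynomial.eval_C] at h0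
      rw [this, h0]; simp
    | succ n ihn =>
      intro F hF h0 u
      obtain ⟨F0, F1, hF0, hF1, hev, hco⟩ := aux_split a n F hF
      rw [h0] at hev
      have h1 : a 0 * MvPolynomial.eval a F1 ∈ J' ^ (n + 1) := by
        have h2 : MvPolynomial.eval a' F0 ∈ J' ^ (n + 1) := (Ideal.mem_span_pow_iff_exists_isHomogeneous a' _).2 ⟨F0, hF0, rfl⟩
        have h3 : a 0 * MvPolynomial.eval a F1 = - MvPolynomial.eval a' F0 := by
          rw [eq_neg_iff_add_eq_zero, add_comm]; exact hev.symm
        rw [h3]; exact neg_mem h2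
      have h2 := claim _ _ h1
      have h3 : ∀ v, F1.coeff v ∈ J := aux_quasi_of_zero a n ihn F1 hF1 (Ideal.pow_right_mono hJJ _ h2)
      obtain ⟨H, hH, hHe⟩ := (Ideal.mem_span_pow_iff_exists_isHomogeneous a' _).1 h2
      have h4 := ih a' hreg (n + 1) (F0 + MvPolynomial.C (a 0) * H) (hF0.add (by simpa using (MvPolynomial.isHomogeneous_C _ (a 0)).mul hH))
        (by rw [map_add, map_mul, MvPolynomial.eval_C, hHe]; exact hev.symm)
      have h5 : ∀ v, F0.coeff v ∈ J := by
        intro v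
        have := h4 v
        rw [MvPolynomial.coeff_add, MvPolynomial.coeff_C_mul] at this
        have h6 : a 0 * H.coeff v ∈ J := Ideal.mul_mem_right _ _ (Ideal.subset_span ⟨0, rfl⟩)
        have := Ideal.sub_mem _ (hJJ this) h6
        simpa using this
      rcases hco u with ⟨v, hv⟩ | ⟨v, hv⟩
      · rw [hv]; exact h5 v
      · rw [hv]; exact h3 v

theorem aux_quasi [CommRing R] {r : ℕ} {a : Fin r → R} (h : auxReg r a) (n : ℕ)
    (F : MvPolynomial (Fin r) R) (hF : F.IsHomogeneous n)
    (hz : MvPolynomial.eval a F ∈ (Ideal.span (Set.range a)) ^ (n + 1)) (u : Fin r →₀ ℕ) :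
    F.coeff u ∈ Ideal.span (Set.range a) :=
  aux_quasi_of_zero a n (aux_quasi_zero r a h n) F hF hz u

/-- a form with a unit coefficient is a nonzerodivisor on the associated graded ring. -/
theorem aux_prim [CommRing R] [IsLocalRing R] {r : ℕ} {a : Fin r → R} (h : auxReg r a) (j : ℕ)
    (H : MvPolynomial (Fin r) R) (hH : H.IsHomogeneous j) (hu : MvPolynomial.map (residue R) H ≠ 0) (n : ℕ) (x : R)
    (hJ : Ideal.span (Set.range a) ≤ maximalIdeal R)
    (hx : MvPolynomial.eval a H * x ∈ Ideal.span (Set.range a) ^ (j + n)) : x ∈ Ideal.span (Set.range a) ^ n := by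
  classical
  set J := Ideal.span (Set.range a) with hJd
  induction n with
  | zero => simp
  | succ n ih =>
    have h1 := ih (Ideal.pow_le_pow_right (by omega) hx)
    obtain ⟨G, hG, rfl⟩ := (Ideal.mem_span_pow_iff_exists_isHomogeneous a x).1 h1
    have h2 : ∀ u, (H * G).coeff u ∈ J := aux_quasi h (j + n) (H * G) (hH.mul hG) (by rw [map_mul]; exact hx)
    rw [pow_succ']
    refine aux_eval_mem a J n G hG ?_
    let o : MonomialOrder (Fin r) := MonomialOrder.lex
    set c : Ideal R := Ideal.span (Set.image (fun w => G.coeff w) (G.support : Set _)) with hc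
    have hGc : ∀ w, G.coeff w ∈ c := by
      intro w
      by_cases hw : w ∈ G.support
      · exact Ideal.subset_span ⟨w, hw, rfl⟩
      · rw [MvPolynomial.notMem_support_iff.1 hw]; exact c.zero_mem
    have hcfg : c.FG := ⟨G.support.image (fun w => G.coeff w), by rw [hc, Finset.coe_image]⟩
    suffices hcc : c ≤ J by exact fun u => hcc (hGc u)
    refine Submodule.le_of_le_smul_of_le_jacobson_bot hcfg
      (by rw [IsLocalRing.jacobson_eq_maximalIdeal _ bot_ne_top]) (I := maximalIdeal R) ?_
    set K : Ideal R := J ⊔ maximalIdeal R • c with hK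
    rw [hc, Ideal.span_le]
    by_contra hcon
    have hne : (G.support.filter (fun w => G.coeff w ∉ K)).Nonempty := by
      rw [Set.not_subset] at hcon
      obtain ⟨_, ⟨w, hw, rfl⟩, hwK⟩ := hcon
      exact ⟨w, by simpa using ⟨MvPolynomial.mem_support_iff.1 hw, hwK⟩⟩
    obtain ⟨w, hw, hwmax⟩ := Finset.exists_max_image _ (fun w => o.toSyn w) hne
    have hne' : (H.support.filter (fun v => IsUnit (H.coeff v))).Nonempty := by
      obtain ⟨v, hv⟩ := MvPolynomial.ne_zero_iff.1 hu
      rw [MvPolynomial.coeff_map, residue_ne_zero_iff_isUnit] at hv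
      exact ⟨v, by simpa using ⟨hv.ne_zero, hv⟩⟩
    obtain ⟨v, hv, hvmax⟩ := Finset.exists_max_image _ (fun w => o.toSyn w) hne'
    simp only [Finset.mem_filter] at hw hv
    apply hw.2
    have h3 : (H * G).coeff (v + w) ∈ K := Ideal.mem_sup_left (h2 _)
    rw [MvPolynomial.coeff_mul, ← Finset.add_sum_erase _ _ (Finset.HasAntidiagonal.mem_antidiagonal.2 rfl : (v, w) ∈ Finset.HasAntidiagonal.antidiagonal (v + w))] at h3
    have h4 : ∑ x ∈ (Finset.HasAntidiagonal.antidiagonal (v + w)).erase (v, w), H.coeff x.1 * G.coeff x.2 ∈ K := by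
      refine Ideal.sum_mem _ ?_
      rintro ⟨v', w'⟩ hx'
      rw [Finset.mem_erase, Finset.HasAntidiagonal.mem_antidiagonal] at hx'
      obtain ⟨hne, heq⟩ := hx'
      simp only at heq ⊢
      by_cases hw' : G.coeff w' ∈ K
      · exact Ideal.mul_mem_left _ _ hw'
      have hv' : H.coeff v' ∈ maximalIdeal R := by
        rw [mem_maximalIdeal, mem_nonunits_iff]
        intro hun
        have e1 := hvmax v' (by simpa using ⟨hun.ne_zero, hun⟩)
        have e2 := hwmax w' (by
          simp only [Finset.mem_filter, MvPolynomial.mem_support_iff]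
          exact ⟨fun h => hw' (h ▸ K.zero_mem), hw'⟩)
        have e3 : o.toSyn v' + o.toSyn w' = o.toSyn v + o.toSyn w := by rw [← map_add, ← map_add, heq]
        have e4 : o.toSyn v' = o.toSyn v := by
          by_contra hcne
          have := add_lt_add_of_lt_of_le (lt_of_le_of_ne e1 hcne) e2
          exact this.ne e3
        have e5 : v' = v := o.toSyn.injective e4
        subst e5
        exact hne (by rw [add_left_cancel heq])
      exact Ideal.mem_sup_right (Ideal.mul_mem_mul hv' (hGc w'))
    have h5 := Ideal.sub_mem _ h3 h4
    rw [add_sub_cancel_right] at h5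
    exact (Ideal.unit_mul_mem_iff_mem K hv.2).1 h5



/-- left continuous version of `auxFo` -/
def auxF [CommRing R] (J : Ideal R) (α : ℝ) : Ideal R := ⨅ γ : {γ : ℝ // γ < α}, auxFo J γ

/-- right version of `auxFo` -/
def auxFp [CommRing R] (J : Ideal R) (α : ℝ) : Ideal R where
  carrier := {x | ∃ β, α < β ∧ x ∈ auxFo J β}
  zero_mem' := ⟨α + 1, by linarith, Ideal.zero_mem _⟩
  add_mem' := by
    rintro x y ⟨β, h, hx⟩ ⟨β', h', hy⟩
    exact ⟨min β β', lt_min h h', Ideal.add_mem _ (auxFo_anti J (min_le_left _ _) hx)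
      (auxFo_anti J (min_le_right _ _) hy)⟩
  smul_mem' := by
    rintro c x ⟨β, h, hx⟩
    exact ⟨β, h, Ideal.mul_mem_left _ _ hx⟩

theorem mem_auxF [CommRing R] {J : Ideal R} {α : ℝ} {x : R} :
    x ∈ auxF J α ↔ ∀ γ < α, x ∈ auxFo J γ := by
  simp [auxF, Submodule.mem_iInf]

theorem mem_auxFp [CommRing R] {J : Ideal R} {α : ℝ} {x : R} :
    x ∈ auxFp J α ↔ ∃ β, α < β ∧ x ∈ auxFo J β := Iff.rfl

theorem auxFo_le_F [CommRing R] (J : Ideal R) (α : ℝ) : auxFo J α ≤ auxF J α := by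
  intro x hx
  rw [mem_auxF]
  exact fun γ h => auxFo_anti J h.le hx

theorem auxF_anti [CommRing R] (J : Ideal R) {α β : ℝ} (h : α ≤ β) : auxF J β ≤ auxF J α := by
  intro x hx
  rw [mem_auxF] at *
  exact fun γ h' => hx _ (h'.trans_le h)

theorem auxFp_anti [CommRing R] (J : Ideal R) {α β : ℝ} (h : α ≤ β) : auxFp J β ≤ auxFp J α := by
  rintro x ⟨γ, h1, h2⟩
  exact ⟨γ, h.trans_lt h1, h2⟩

theorem auxF_le_Fp [CommRing R] (J : Ideal R) {α β : ℝ} (h : α < β) : auxF J β ≤ auxFp J α := by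
  intro x hx
  rw [mem_auxF] at hx
  exact ⟨(α + β) / 2, by linarith, hx _ (by linarith)⟩

theorem auxFp_le_F [CommRing R] (J : Ideal R) (α : ℝ) : auxFp J α ≤ auxF J α := by
  rintro x ⟨γ, h1, h2⟩
  exact auxFo_le_F J α (auxFo_anti J h1.le h2)

theorem auxF_mul [CommRing R] (J : Ideal R) {α β : ℝ} {x y : R} (hx : x ∈ auxF J α)
    (hy : y ∈ auxF J β) : x * y ∈ auxF J (α + β) := by
  rw [mem_auxF] at *
  intro γ hγ
  have := auxFo_mul J (hx (α - (α + β - γ) / 2) (by linarith)) (hy (β - (α + β - γ) / 2) (by linarith))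
  convert this using 2
  ring

theorem auxF_mul_Fp [CommRing R] (J : Ideal R) {α β : ℝ} {x y : R} (hx : x ∈ auxF J α)
    (hy : y ∈ auxFp J β) : x * y ∈ auxFp J (α + β) := by
  rw [mem_auxF] at hx
  obtain ⟨β', h, hy⟩ := hy
  refine ⟨_, ?_, auxFo_mul J (hx (α - (β' - β) / 2) (by linarith)) hy⟩
  linarith

theorem auxFp_mul_F [CommRing R] (J : Ideal R) {α β : ℝ} {x y : R} (hx : x ∈ auxFp J α)
    (hy : y ∈ auxF J β) : x * y ∈ auxFp J (α + β) := by
  rw [mul_comm, add_comm]; exact auxF_mul_Fp J hy hx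

theorem auxFp_of_pow [CommRing R] (J : Ideal R) {α : ℝ} {x : R} (m : ℕ) (hm : 0 < m)
    (h : x ^ m ∈ auxFp J (m * α)) : x ∈ auxFp J α := by
  obtain ⟨β, h1, h2⟩ := h
  have hm' : (0 : ℝ) < m := by exact_mod_cast hm
  refine ⟨β / m, by rw [lt_div_iff₀ hm']; linarith, auxFo_of_pow J m hm ?_⟩
  rwa [mul_div_cancel₀ _ hm'.ne']

theorem auxF_one [CommRing R] (J : Ideal R) {α : ℝ} (h : α ≤ 0) : auxF J α = ⊤ :=
  top_le_iff.1 ((auxFo_top J h).ge.trans (auxFo_le_F J α))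

theorem auxF_pow [CommRing R] (J : Ideal R) {α : ℝ} {x : R} (hx : x ∈ auxF J α) (m : ℕ) :
    x ^ m ∈ auxF J (m * α) := by
  induction m with
  | zero => simp [auxF_one]
  | succ m ih =>
    rw [pow_succ]
    have := auxF_mul J ih hx
    convert this using 2
    push_cast; ring

theorem aux_pow_le_F [CommRing R] (J : Ideal R) (n : ℕ) : J ^ n ≤ auxF J n :=
  (aux_pow_le_Fo J n).trans (auxFo_le_F J n)

theorem aux_max_le_Fp [CommRing R] [IsLocalRing R] (J : Ideal R) (c : ℕ) (hc : maximalIdeal R ^ c ≤ J) :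
    maximalIdeal R ≤ auxFp J 0 := by
  intro x hx
  have h1 : x ^ (c + 1) ∈ J ^ 1 := by
    rw [pow_one]
    exact hc (Ideal.pow_le_pow_right (Nat.le_succ c) (Ideal.pow_mem_pow hx _))
  have h2 := aux_pow_le_Fo J 1 h1
  refine ⟨1 / ((c + 1 : ℕ) : ℝ), by positivity, auxFo_of_pow J (c + 1) (Nat.succ_pos c) ?_⟩
  rw [mul_div_cancel₀ _ (by positivity)]
  simpa using h2

theorem aux_one_notMem_Fp [CommRing R] [IsLocalRing R] (J : Ideal R) (hJ : J ≤ maximalIdeal R) :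
    (1 : R) ∉ auxFp J 0 := by
  rintro ⟨β, hβ, c, hc⟩
  obtain ⟨r, hr⟩ := exists_nat_gt ((c + 1 : ℝ) / β)
  have h := hc r
  rw [one_pow] at h
  rw [div_lt_iff₀ hβ] at hr
  have h2 : c + 1 ≤ ⌈(r : ℝ) * β⌉₊ := by
    have := Nat.le_ceil ((r : ℝ) * β)
    have h3 : ((c + 1 : ℕ) : ℝ) ≤ (⌈(r : ℝ) * β⌉₊ : ℝ) := by push_cast; linarith
    exact_mod_cast h3
  have h3 : (1 : R) ∈ maximalIdeal R :=
    hJ (Ideal.pow_le_self (by omega) h)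
  exact (maximalIdeal.isMaximal R).ne_top ((Ideal.eq_top_iff_one _).2 h3)

theorem aux_map_pow_ne [CommRing R] [IsLocalRing R] {σ : Type*} (H : MvPolynomial σ R)
    (hu : MvPolynomial.map (residue R) H ≠ 0) (r : ℕ) : MvPolynomial.map (residue R) (H ^ r) ≠ 0 := by
  rw [map_pow]; exact pow_ne_zero _ hu

theorem aux_tors [CommRing R] [IsLocalRing R] {d : ℕ} {a : Fin d → R} (h : auxReg d a) (j : ℕ)
    (H : MvPolynomial (Fin d) R) (hH : H.IsHomogeneous j) (hu : MvPolynomial.map (residue R) H ≠ 0)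
    (hJ : Ideal.span (Set.range a) ≤ maximalIdeal R) (x : R) (α : ℝ) (hα : 0 ≤ α)
    (hx : MvPolynomial.eval a H * x ∈ auxFp (Ideal.span (Set.range a)) (α + j)) :
    x ∈ auxFp (Ideal.span (Set.range a)) α := by
  obtain ⟨β, h1, c, hc⟩ := hx
  refine ⟨β - j, by linarith, c, fun r => ?_⟩
  have h2 := hc r
  rw [mul_pow, ← map_pow] at h2
  refine aux_prim h (j * r) (H ^ r) (hH.pow r) (aux_map_pow_ne H hu r) _ (x ^ r) hJ ?_
  have h3 : j * r + (⌈(r : ℝ) * (β - j)⌉₊ - c) ≤ ⌈(r : ℝ) * β⌉₊ - c + (j * r + (⌈(r : ℝ) * (β - j)⌉₊ - c) - (⌈(r : ℝ) * β⌉₊ - c)) := by omega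
  have h4 : ⌈(r : ℝ) * β⌉₊ = ⌈(r : ℝ) * (β - j)⌉₊ + j * r := by
    have e : (r : ℝ) * β = (r : ℝ) * (β - j) + ((j * r : ℕ) : ℝ) := by push_cast; ring
    rw [e, Nat.ceil_add_natCast]
    have : 0 ≤ β - j := by linarith
    positivity
  rcases le_or_gt c ⌈(r : ℝ) * (β - j)⌉₊ with hcr | hcr
  · refine Ideal.pow_le_pow_right ?_ h2
    omega
  · rw [Nat.sub_eq_zero_of_le hcr.le, add_zero]
    refine Ideal.mul_mem_right _ _ ?_
    have := aux_eval_mem a ⊤ (j * r) (H ^ r) (hH.pow r) (fun _ => trivial)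
    rwa [Ideal.top_mul] at this

theorem aux_F_integral [CommRing R] [IsNoetherianRing R] (J : Ideal R) (n : ℕ) (x : R) (hx : x ∈ auxF J n) :
    IsIntegralOverIdeal (J ^ n) x := by
  refine aux_integral_of_asymptotic J x n fun e => ?_
  rw [mem_auxF] at hx
  obtain ⟨c, hc⟩ := hx (n - 1 / (2 * (e + 1))) (by
    have : (0 : ℝ) < 1 / (2 * (e + 1)) := by positivity
    linarith)
  refine ⟨2 * (e + 1) * (e * c + 1), (e * c + 1) + c, by
    have e1 : e * (e * c + 1 + c) + 1 = (e + 1) * (e * c + 1) := by ring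
    have e2 : 2 * (e + 1) * (e * c + 1) = 2 * ((e + 1) * (e * c + 1)) := by ring
    omega, ?_⟩
  refine Ideal.pow_le_pow_right ?_ (hc _)
  set M := e * c + 1
  have h1 : ((2 * (e + 1) * M : ℕ) : ℝ) * (n - 1 / (2 * (e + 1))) = ((n * (2 * (e + 1) * M) : ℕ) : ℝ) - (M : ℕ) := by
    push_cast
    field_simp
  rw [h1]
  have h2 : n * (2 * (e + 1) * M) ≤ ⌈((n * (2 * (e + 1) * M) : ℕ) : ℝ) - (M : ℕ)⌉₊ + M := by
    have := Nat.le_ceil (((n * (2 * (e + 1) * M) : ℕ) : ℝ) - (M : ℕ))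
    have h3 : ((n * (2 * (e + 1) * M) : ℕ) : ℝ) ≤ (⌈((n * (2 * (e + 1) * M) : ℕ) : ℝ) - (M : ℕ)⌉₊ : ℝ) + (M : ℕ) := by linarith
    exact_mod_cast h3
  omega

theorem aux_int_pow_mem [CommRing R] (I : Ideal R) (x : R) (hx : IsIntegralOverIdeal I x) :
    ∃ l, ∀ r, x ^ r ∈ I ^ (r + 1 - l) := by
  obtain ⟨l, hl, a, ha, he⟩ := hx
  refine ⟨l, fun r => ?_⟩
  induction r using Nat.strong_induction_on with
  | _ r ih =>
    rcases lt_or_ge r l with h | h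
    · rw [show r + 1 - l = 0 by omega]; simp
    · have h1 : x ^ r = - ∑ i ∈ Finset.Icc 1 l, a i * x ^ (r - i) := by
        have : x ^ (r - l) * (x ^ l + ∑ i ∈ Finset.Icc 1 l, a i * x ^ (l - i)) = 0 := by rw [he, mul_zero]
        rw [mul_add, ← pow_add, Nat.sub_add_cancel h] at this
        rw [eq_neg_of_add_eq_zero_left this, Finset.mul_sum]
        congr 1
        refine Finset.sum_congr rfl fun i hi => ?_
        rw [Finset.mem_Icc] at hi
        rw [mul_left_comm, ← pow_add]
        congr 2; omega
      rw [h1]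
      refine neg_mem (Ideal.sum_mem _ fun i hi => ?_)
      have h2 := ha i hi
      rw [Finset.mem_Icc] at hi
      have h3 := Ideal.mul_mem_mul h2 (ih (r - i) (by omega))
      rw [← pow_add] at h3
      exact Ideal.pow_le_pow_right (by omega) h3

theorem aux_intCl_le_Fo [CommRing R] (I J : Ideal R) (c : ℕ) (hIJ : ∀ m, I ^ (m + c) ≤ J ^ m) (n : ℕ) :
    intCl (I ^ n) ≤ auxFo J n := by
  refine Ideal.span_le.2 fun x hx => ?_
  obtain ⟨l, hl⟩ := aux_int_pow_mem _ _ hx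
  refine ⟨n * l + c, fun r => ?_⟩
  rw [← Nat.cast_mul, Nat.ceil_natCast]
  rcases le_or_gt (r * n) (n * l + c) with h | h
  · rw [Nat.sub_eq_zero_of_le h]; simp
  · refine hIJ _ ?_
    have := hl r
    rw [← pow_mul] at this
    refine Ideal.pow_le_pow_right ?_ this
    have h5 : n * (r + 1 - l) ≥ n * r - n * l := by
      rw [← Nat.mul_sub]; exact Nat.mul_le_mul_left _ (by omega)
    rw [mul_comm r n] at *
    omega



/-- length of `R/W` -/
noncomputable def auxLen [CommRing R] (W : Ideal R) : ℕ∞ := Module.length R (R ⧸ W)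

theorem auxLen_anti [CommRing R] {W W' : Ideal R} (h : W ≤ W') : auxLen W' ≤ auxLen W :=
  Module.length_le_of_surjective (Submodule.factor h) (Submodule.factor_surjective h)

theorem auxLen_strict [CommRing R] {W W' : Ideal R} (h : W ≤ W') (x : R) (hx : x ∈ W') (hx' : x ∉ W) :
    auxLen W' + 1 ≤ auxLen W := by
  unfold auxLen
  rw [Module.length_eq_add_of_exact (LinearMap.ker (Submodule.factor h)).subtype (Submodule.factor h)
    (Submodule.subtype_injective _) (Submodule.factor_surjective h) (LinearMap.exact_subtype_ker_map _), add_comm]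
  gcongr
  have : Nontrivial (LinearMap.ker (Submodule.factor h)) := by
    refine ⟨⟨⟨Submodule.Quotient.mk x, ?_⟩, 0, ?_⟩⟩
    · rw [LinearMap.mem_ker]
      exact (Submodule.Quotient.mk_eq_zero _).2 hx
    · intro h0
      rw [Subtype.ext_iff] at h0
      exact hx' ((Submodule.Quotient.mk_eq_zero _).1 h0)
  exact Order.one_le_iff_pos.2 Module.length_pos

/-- relations module -/
def auxRel [CommRing R] {ι : Type*} [Fintype ι] (g : ι → R) (W : Ideal R) : Submodule R (ι → R) :=
  LinearMap.ker ((Submodule.mkQ W).comp (Fintype.linearCombination R g))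

theorem mem_auxRel [CommRing R] {ι : Type*} [Fintype ι] (g : ι → R) (W : Ideal R) (r : ι → R) :
    r ∈ auxRel g W ↔ ∑ i, r i * g i ∈ W := by
  rw [auxRel, LinearMap.mem_ker, LinearMap.comp_apply, Submodule.mkQ_apply, Submodule.Quotient.mk_eq_zero,
    Fintype.linearCombination_apply]
  rfl

theorem auxLen_split [CommRing R] {ι : Type*} [Fintype ι] (g : ι → R) (W : Ideal R)
    (h : W ≤ Ideal.span (Set.range g)) :
    auxLen W = auxLen (Ideal.span (Set.range g)) + Module.length R ((ι → R) ⧸ auxRel g W) := by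
  set φ := (Submodule.mkQ W).comp (Fintype.linearCombination R g) with hφ
  have e : ((ι → R) ⧸ auxRel g W) ≃ₗ[R] LinearMap.range φ := φ.quotKerEquivRange
  unfold auxLen
  rw [e.length_eq, add_comm]
  refine Module.length_eq_add_of_exact (LinearMap.range φ).subtype (Submodule.factor h)
    (Submodule.subtype_injective _) (Submodule.factor_surjective h) ?_
  intro y
  obtain ⟨y, rfl⟩ := Submodule.mkQ_surjective _ y
  have h1 : (Submodule.factor h) (Submodule.mkQ W y) = 0 ↔ y ∈ Ideal.span (Set.range g) :=
    Submodule.Quotient.mk_eq_zero _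
  rw [h1]
  simp only [Submodule.coe_subtype, Subtype.range_coe_subtype, Set.mem_setOf_eq, LinearMap.mem_range]
  constructor
  · intro hy
    have hy' : y ∈ LinearMap.range (Fintype.linearCombination R g) := by rwa [Fintype.range_linearCombination]
    obtain ⟨r, rfl⟩ := hy'
    exact ⟨r, rfl⟩
  · rintro ⟨r, hr⟩
    have h2 : Fintype.linearCombination R g r - y ∈ W := (Submodule.Quotient.eq W).1 hr
    have h3 : Fintype.linearCombination R g r ∈ LinearMap.range (Fintype.linearCombination R g) := ⟨r, rfl⟩
    rw [Fintype.range_linearCombination] at h3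
    have := Submodule.sub_mem _ h3 (h h2)
    simpa using this

theorem auxLen_pi [CommRing R] (ι : Type*) [Fintype ι] (G : Ideal R) :
    Module.length R ((ι → R) ⧸ Submodule.pi Set.univ (fun _ : ι => G)) = Fintype.card ι * auxLen G := by
  classical
  rw [(Submodule.quotientPi (fun _ : ι => G)).length_eq, Module.length_pi, ENat.card_eq_coe_fintype_card]
  rfl

theorem auxLen_mul_le [CommRing R] {ι : Type*} [Fintype ι] (g : ι → R) (G : Ideal R) :
    auxLen (Ideal.span (Set.range g) * G) ≤ auxLen (Ideal.span (Set.range g)) + Fintype.card ι * auxLen G := by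
  rw [auxLen_split g _ Ideal.mul_le_left, ← auxLen_pi]
  gcongr
  have hle : Submodule.pi Set.univ (fun _ : ι => G) ≤ auxRel g (Ideal.span (Set.range g) * G) := by
    intro r hr
    rw [mem_auxRel]
    refine Ideal.sum_mem _ fun i _ => ?_
    rw [mul_comm (r i)]
    exact Ideal.mul_mem_mul (Ideal.subset_span ⟨i, rfl⟩) (hr i trivial)
  exact Module.length_le_of_surjective (Submodule.factor hle) (Submodule.factor_surjective hle)

theorem auxLen_ge [CommRing R] {ι : Type*} [Fintype ι] (g : ι → R) (G W : Ideal R)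
    (hW : W ≤ Ideal.span (Set.range g)) (h : ∀ r : ι → R, ∑ i, r i * g i ∈ W → ∀ i, r i ∈ G) :
    auxLen (Ideal.span (Set.range g)) + Fintype.card ι * auxLen G ≤ auxLen W := by
  rw [auxLen_split g _ hW, ← auxLen_pi]
  gcongr
  have hle : auxRel g W ≤ Submodule.pi Set.univ (fun _ : ι => G) := by
    intro r hr i _
    rw [mem_auxRel] at hr
    exact h r hr i
  exact Module.length_le_of_surjective (Submodule.factor hle) (Submodule.factor_surjective hle)

/-- monomial values -/
noncomputable def auxMon [CommRing R] {d : ℕ} (a : Fin d → R) (n : ℕ)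
    (u : ((Finset.univ : Finset (Fin d)).finsuppAntidiag n : Finset (Fin d →₀ ℕ))) : R :=
  MvPolynomial.eval a (MvPolynomial.monomial (u : Fin d →₀ ℕ) 1)

theorem aux_mem_antidiag {d n : ℕ} (u : Fin d →₀ ℕ) :
    u ∈ (Finset.univ : Finset (Fin d)).finsuppAntidiag n ↔ u.degree = n := by
  rw [Finset.mem_finsuppAntidiag, Finsupp.degree_eq_sum]
  simp

theorem auxMon_span [CommRing R] {d : ℕ} (a : Fin d → R) (n : ℕ) :
    Ideal.span (Set.range (auxMon a n)) = Ideal.span (Set.range a) ^ n := by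
  apply le_antisymm
  · rw [Ideal.span_le]
    rintro _ ⟨u, rfl⟩
    have := aux_eval_mem a ⊤ n (MvPolynomial.monomial (u : Fin d →₀ ℕ) 1)
      (MvPolynomial.isHomogeneous_monomial _ ((aux_mem_antidiag _).1 u.2)) (fun _ => trivial)
    rwa [Ideal.top_mul] at this
  · intro y hy
    obtain ⟨G, hG, -, rfl⟩ := aux_exists_form a ⊤ n y (by rwa [Ideal.top_mul])
    rw [G.as_sum, map_sum]
    refine Ideal.sum_mem _ fun u hu => ?_
    have hd : u ∈ (Finset.univ : Finset (Fin d)).finsuppAntidiag n := by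
      rw [aux_mem_antidiag]
      have := hG (MvPolynomial.mem_support_iff.1 hu)
      rw [← this]
      exact DFunLike.congr_fun (Finsupp.degree_eq_weight_one (R := ℕ)) u
    have : MvPolynomial.eval a (MvPolynomial.monomial u (G.coeff u)) = G.coeff u * auxMon a n ⟨u, hd⟩ := by
      simp [auxMon, MvPolynomial.eval_monomial]
    rw [this]
    exact Ideal.mul_mem_left _ _ (Ideal.subset_span ⟨_, rfl⟩)

theorem aux_card_mon (d : ℕ) (hd : 0 < d) (n : ℕ) :
    Fintype.card ((Finset.univ : Finset (Fin d)).finsuppAntidiag n : Finset (Fin d →₀ ℕ)) = (n + d - 1).choose (d - 1) := by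
  rw [Fintype.card_coe, Finset.card_finsuppAntidiag_nat_eq_choose, Finset.card_univ, Fintype.card_fin]
  rw [← Nat.choose_symm (by omega : d - 1 ≤ n + d - 1)]
  congr 1 <;> omega

theorem auxLen_pow [CommRing R] {d : ℕ} (hd : 0 < d) {a : Fin d → R} (h : auxReg d a) (n : ℕ) :
    auxLen (Ideal.span (Set.range a) ^ n) = ((n + d - 1).choose d : ℕ) * auxLen (Ideal.span (Set.range a)) := by
  induction n with
  | zero =>
    have : auxLen (⊤ : Ideal R) = 0 := by
      unfold auxLen
      exact Module.length_eq_zero_iff.2 (Ideal.Quotient.subsingleton_iff.2 rfl)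
    rw [pow_zero, Ideal.one_eq_top, this, Nat.choose_eq_zero_of_lt (by omega)]
    simp
  | succ n ih =>
    have key : auxLen (Ideal.span (Set.range a) ^ (n + 1)) = auxLen (Ideal.span (Set.range a) ^ n) +
        ((n + d - 1).choose (d - 1) : ℕ) * auxLen (Ideal.span (Set.range a)) := by
      rw [← aux_card_mon d hd n]
      apply le_antisymm
      · have := auxLen_mul_le (auxMon a n) (Ideal.span (Set.range a))
        rwa [auxMon_span, ← pow_succ] at this
      · have := auxLen_ge (auxMon a n) (Ideal.span (Set.range a)) (Ideal.span (Set.range a) ^ (n + 1))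
          (by rw [auxMon_span]; exact Ideal.pow_le_pow_right (Nat.le_succ n)) ?_
        · rwa [auxMon_span] at this
        · intro r hr i
          classical
          set F : MvPolynomial (Fin d) R := ∑ u : ((Finset.univ : Finset (Fin d)).finsuppAntidiag n : Finset (Fin d →₀ ℕ)), MvPolynomial.monomial (u : Fin d →₀ ℕ) (r u) with hF
          have h1 : F.IsHomogeneous n := MvPolynomial.IsHomogeneous.sum _ _ _ fun u _ =>
            MvPolynomial.isHomogeneous_monomial _ ((aux_mem_antidiag _).1 u.2)
          have h2 : MvPolynomial.eval a F = ∑ i, r i * auxMon a n i := by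
            rw [hF, map_sum]
            refine Finset.sum_congr rfl fun u _ => ?_
            simp [auxMon, MvPolynomial.eval_monomial]
          have h3 := aux_quasi h n F h1 (by rwa [h2]) i
          rw [hF, MvPolynomial.coeff_sum] at h3
          simp only [MvPolynomial.coeff_monomial] at h3
          rw [Finset.sum_eq_single i] at h3
          · simpa using h3
          · intro b _ hb
            rw [if_neg (fun h => hb (Subtype.ext h))]
          · simp
    rw [key, ih, ← add_mul]
    congr 1
    obtain ⟨e, rfl⟩ : ∃ e, d = e + 1 := ⟨d - 1, by omega⟩
    have : (n + 1 + (e + 1) - 1).choose (e + 1) = (n + (e + 1) - 1).choose e + (n + (e + 1) - 1).choose (e + 1) := by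
      rw [show n + 1 + (e + 1) - 1 = (n + (e + 1) - 1) + 1 by omega, Nat.choose_succ_succ]
    rw [this]
    push_cast
    rw [add_comm]



theorem auxN_A {S K ι T : Type*} [CommRing S] [IsDomain S] [Field K] [Algebra S K] [IsFractionRing S K]
    [Fintype ι] (w : T → ι → S)
    (hw : ∀ v : ι → S, (∀ t, ∑ i, v i * w t i = 0) → v = 0) :
    ∃ δ : S, δ ≠ 0 ∧ ∀ (v : ι → S) (g : S), (∀ t, g ∣ ∑ i, v i * w t i) → ∀ i, g ∣ δ * v i := by
  classical
  have hinj : Function.Injective (algebraMap S K) := IsFractionRing.injective S K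
  set W : T → ι → K := fun t i => algebraMap S K (w t i) with hW
  have hspan : Submodule.span K (Set.range W) = ⊤ := by
    by_contra hne
    obtain ⟨f, hf, hle⟩ := Submodule.exists_le_ker_of_lt_top _ (lt_top_iff_ne_top.2 hne)
    obtain ⟨b, hb⟩ := IsLocalization.exist_integer_multiples (nonZeroDivisors S) Finset.univ
      (fun i => f (Pi.single i 1))
    choose z hz using fun i => hb i (Finset.mem_univ i)
    have hz0 : z = 0 := by
      apply hw
      intro t
      apply hinj
      have h1 : f (W t) = 0 := hle (Submodule.subset_span ⟨t, rfl⟩)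
      rw [f.pi_apply_eq_sum_univ] at h1
      rw [map_sum, map_zero]
      have h2 : ∀ i, algebraMap S K (z i * w t i) = algebraMap S K b * (W t i • f (fun j => if i = j then 1 else 0)) := by
        intro i
        have e : (fun j => if i = j then (1 : K) else 0) = Pi.single i 1 := by
          ext j; simp [Pi.single_apply, eq_comm]
        rw [map_mul, hz i, e]
        simp only [hW, smul_eq_mul, Submonoid.smul_def, Algebra.smul_def]
        ring
      simp only [h2]
      rw [← Finset.mul_sum, h1, mul_zero]
    apply hf
    refine LinearMap.pi_ext' fun i => LinearMap.ext_ring ?_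
    have h3 := hz i
    rw [hz0] at h3
    simp only [Pi.zero_apply, map_zero, Submonoid.smul_def, Algebra.smul_def] at h3
    have h4 : algebraMap S K b ≠ 0 := by
      rw [Ne, map_eq_zero_iff _ hinj]; exact nonZeroDivisors.coe_ne_zero b
    simpa using (mul_eq_zero.1 h3.symm).resolve_left h4
  have hall : ∀ x : ι → K, ∃ δ : S, δ ≠ 0 ∧ ∀ (v : ι → S) (g : S), (∀ t, g ∣ ∑ i, v i * w t i) →
      ∃ m : S, algebraMap S K δ * ∑ i, algebraMap S K (v i) * x i = algebraMap S K (g * m) := by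
    intro x
    have hx : x ∈ Submodule.span K (Set.range W) := by rw [hspan]; trivial
    induction hx using Submodule.span_induction with
    | mem x hx =>
      obtain ⟨t, rfl⟩ := hx
      refine ⟨1, one_ne_zero, fun v g h => ?_⟩
      obtain ⟨m, hm⟩ := h t
      refine ⟨m, ?_⟩
      rw [← hm, map_one, one_mul, map_sum]
      simp [hW]
    | zero => exact ⟨1, one_ne_zero, fun v g h => ⟨0, by simp⟩⟩
    | add x y _ _ hx hy =>
      obtain ⟨δ, h0, h⟩ := hx
      obtain ⟨δ', h0', h'⟩ := hy
      refine ⟨δ * δ', mul_ne_zero h0 h0', fun v g hg => ?_⟩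
      obtain ⟨m, hm⟩ := h v g hg
      obtain ⟨m', hm'⟩ := h' v g hg
      refine ⟨δ' * m + δ * m', ?_⟩
      simp only [Pi.add_apply, mul_add, Finset.sum_add_distrib]
      rw [map_add, map_mul (algebraMap S K) δ δ']
      have e1 : algebraMap S K (g * (δ' * m)) = algebraMap S K δ' * algebraMap S K (g * m) := by
        simp only [map_mul]; ring
      have e2 : algebraMap S K (g * (δ * m')) = algebraMap S K δ * algebraMap S K (g * m') := by
        simp only [map_mul]; ring
      rw [e1, e2, ← hm, ← hm']
      ring
    | smul c x _ hx =>
      obtain ⟨δ, h0, h⟩ := hx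
      obtain ⟨⟨p, s⟩, hps⟩ := IsLocalization.surj (nonZeroDivisors S) c
      refine ⟨δ * s, mul_ne_zero h0 (nonZeroDivisors.coe_ne_zero s), fun v g hg => ?_⟩
      obtain ⟨m, hm⟩ := h v g hg
      refine ⟨p * m, ?_⟩
      simp only at hps
      have e1 : ∑ i, algebraMap S K (v i) * (c • x) i = c * ∑ i, algebraMap S K (v i) * x i := by
        rw [Finset.mul_sum]
        refine Finset.sum_congr rfl fun i _ => ?_
        simp only [Pi.smul_apply, smul_eq_mul]; ring
      have e2 : algebraMap S K (g * (p * m)) = algebraMap S K p * algebraMap S K (g * m) := by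
        simp only [map_mul]; ring
      rw [e1, e2, ← hm, ← hps, map_mul]
      ring
  choose δ h0 h using fun i => hall (Pi.single i 1)
  refine ⟨∏ i, δ i, Finset.prod_ne_zero_iff.2 fun i _ => h0 i, fun v g hg i => ?_⟩
  obtain ⟨m, hm⟩ := h i v g hg
  rw [Finset.sum_eq_single i] at hm
  · rw [Pi.single_eq_same, mul_one, ← map_mul] at hm
    rw [← Finset.mul_prod_erase _ _ (Finset.mem_univ i), mul_right_comm, hinj hm]
    exact Dvd.dvd.mul_right (Dvd.intro _ rfl) _
  · intro j _ hj
    rw [Pi.single_eq_of_ne hj, mul_zero]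
  · simp

theorem auxN_k0 {k V : Type*} [Field k] [AddCommGroup V] [Module k V] (y : V) (hy : y ≠ 0) :
    ∃ κ : V →+ k, (∀ (x : k) z, κ (x • z) = x * κ z) ∧ κ y ≠ 0 := by
  obtain ⟨f, hf⟩ := Module.Projective.exists_dual_ne_zero k hy
  exact ⟨f.toAddMonoidHom, fun x z => by simp, hf⟩

theorem auxN_k {k : Type*} [Field k] (p n : ℕ) [ExpChar k p] (y : k) (hy : y ≠ 0) :
    ∃ κ : k →+ k, (∀ (x : k) z, κ (x ^ p ^ n * z) = x * κ z) ∧ κ y ≠ 0 :=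
  @auxN_k0 k k _ _ (Module.compHom k (iterateFrobenius k p n)) y hy

theorem auxN_B {k σ : Type*} [Field k] (p n : ℕ) [ExpChar k p] (c : MvPolynomial σ k) (hc : c ≠ 0) :
    ∃ l : MvPolynomial σ k →+ MvPolynomial σ k,
      (∀ h c', l (h ^ p ^ n * c') = h * l c') ∧ l c ≠ 0 := by
  classical
  obtain ⟨v0, hv0⟩ := MvPolynomial.ne_zero_iff.1 hc
  obtain ⟨κ, hκ, hκ0⟩ := auxN_k p n _ hv0
  have hq : 0 < p ^ n := pow_pos (expChar_pos k p) n
  set q := p ^ n with hqd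
  let dv : (σ →₀ ℕ) → (σ →₀ ℕ) := fun v => v.mapRange (· / q) (Nat.zero_div q)
  let F : (σ →₀ ℕ) → k →+ MvPolynomial σ k := fun v =>
    if ∀ i, v i % q = v0 i % q then ((MvPolynomial.monomial (dv v)).toAddMonoidHom).comp κ else 0
  let l : MvPolynomial σ k →+ MvPolynomial σ k :=
    (Finsupp.liftAddHom F).comp (AddMonoidAlgebra.coeffAddEquiv (R := k) (M := σ →₀ ℕ)).toAddMonoidHom
  have hl : ∀ v y, l (MvPolynomial.monomial v y) = F v y := by
    intro v y
    change Finsupp.liftAddHom F (Finsupp.single v y) = _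
    simp
  refine ⟨l, ?_, ?_⟩
  · intro h c'
    have hfrob : ∀ x y : MvPolynomial σ k, (x + y) ^ q = x ^ q + y ^ q := fun x y => add_pow_expChar_pow x y p n
    induction h using MvPolynomial.induction_on' with
    | monomial u x =>
      induction c' using MvPolynomial.induction_on' with
      | monomial v y =>
        rw [MvPolynomial.monomial_pow, MvPolynomial.monomial_mul, hl, hl]
        have e1 : (∀ i, (q • u + v) i % q = v0 i % q) ↔ ∀ i, v i % q = v0 i % q := by
          refine forall_congr' fun i => ?_
          simp [Nat.mul_add_mod]
        have e2 : dv (q • u + v) = u + dv v := by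
          ext i
          simp [dv, Nat.mul_add_div hq]
        by_cases hv : ∀ i, v i % q = v0 i % q
        · simp only [F]
          rw [if_pos (e1.2 hv), if_pos hv]
          simp only [AddMonoidHom.comp_apply, LinearMap.toAddMonoidHom_coe]
          rw [hκ, e2, MvPolynomial.monomial_mul]
        · simp only [F]
          rw [if_neg (fun h => hv (e1.1 h)), if_neg hv]
          simp
      | add a b ha hb => rw [mul_add, map_add, ha, hb, map_add, mul_add]
    | add a b ha hb => rw [hfrob, add_mul, map_add, ha, hb, add_mul]
  · intro h0
    have key : ∀ c : MvPolynomial σ k, (l c).coeff (dv v0) = κ (c.coeff v0) := by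
      intro c
      induction c using MvPolynomial.induction_on' with
      | monomial v y =>
        rw [hl, MvPolynomial.coeff_monomial]
        by_cases hv : ∀ i, v i % q = v0 i % q
        · simp only [F]
          rw [if_pos hv]
          simp only [AddMonoidHom.comp_apply, LinearMap.toAddMonoidHom_coe]
          rw [MvPolynomial.coeff_monomial]
          by_cases hvv : v = v0
          · rw [if_pos hvv, if_pos (by rw [hvv])]
          · rw [if_neg hvv, if_neg, map_zero]
            intro hd
            apply hvv
            ext i
            have h1 := DFunLike.congr_fun hd i
            simp only [dv, Finsupp.mapRange_apply] at h1
            rw [← Nat.div_add_mod (v i) q, h1, hv i, Nat.div_add_mod]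
        · simp only [F]
          rw [if_neg hv, if_neg (fun h => hv (fun i => by rw [h]))]
          simp
      | add a b ha hb => rw [map_add, MvPolynomial.coeff_add, ha, hb, MvPolynomial.coeff_add, map_add]
    apply hκ0
    rw [← key, h0, MvPolynomial.coeff_zero]

theorem auxN_coord {S K E : Type*} [CommRing S] [IsDomain S] [Field K] [Algebra S K] [IsFractionRing S K]
    [Field E] [Algebra K E] [Algebra S E] [IsScalarTower S K E] {ι : Type*} [Fintype ι]
    (b : Module.Basis ι K E) (s : Finset E) :
    ∃ δ : S, δ ≠ 0 ∧ ∀ x ∈ Submodule.span S (s : Set E), ∀ i, ∃ m : S, algebraMap S K δ * b.repr x i = algebraMap S K m := by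
  classical
  obtain ⟨δ, hδ⟩ := IsLocalization.exist_integer_multiples (nonZeroDivisors S) (s ×ˢ (Finset.univ : Finset ι))
    (fun z => b.repr z.1 z.2)
  refine ⟨δ, nonZeroDivisors.coe_ne_zero δ, fun x hx => ?_⟩
  induction hx using Submodule.span_induction with
  | mem x hx =>
    intro i
    obtain ⟨m, hm⟩ := hδ (x, i) (by simpa using hx)
    refine ⟨m, ?_⟩
    rw [hm, Algebra.smul_def]
  | zero => exact fun i => ⟨0, by simp⟩
  | add x y _ _ hx hy =>
    intro i
    obtain ⟨m, hm⟩ := hx i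
    obtain ⟨m', hm'⟩ := hy i
    refine ⟨m + m', ?_⟩
    rw [map_add, map_add, ← hm, ← hm', Finsupp.add_apply, mul_add]
  | smul c x _ hx =>
    intro i
    obtain ⟨m, hm⟩ := hx i
    refine ⟨c * m, ?_⟩
    rw [← algebraMap_smul K c x, map_smul, Finsupp.smul_apply, smul_eq_mul, map_mul, ← hm]
    ring

theorem auxNagata {k K L : Type*} {d : ℕ} [Field k] [Field K] [Algebra (MvPolynomial (Fin d) k) K]
    [IsFractionRing (MvPolynomial (Fin d) k) K] [Field L] [Algebra K L] [Algebra (MvPolynomial (Fin d) k) L]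
    [IsScalarTower (MvPolynomial (Fin d) k) K L] [FiniteDimensional K L] :
    Module.Finite (MvPolynomial (Fin d) k) (integralClosure (MvPolynomial (Fin d) k) L) := by
  classical
  obtain ⟨p, hp⟩ := ExpChar.exists k
  have hinj : Function.Injective (algebraMap (MvPolynomial (Fin d) k) K) := IsFractionRing.injective _ K
  have hS : ExpChar (MvPolynomial (Fin d) k) p := inferInstance
  have hK : ExpChar K p := expChar_of_injective_algebraMap hinj p
  have hL : ExpChar L p := expChar_of_injective_algebraMap (algebraMap K L).injective p
  let E := separableClosure K L
  have hE : ExpChar E p := expChar_of_injective_algebraMap (algebraMap K E).injective p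
  have hpi : IsPurelyInseparable E L := inferInstance
  have hst : IsScalarTower (MvPolynomial (Fin d) k) E L := IsScalarTower.of_algebraMap_eq (fun r => by
    rw [IsScalarTower.algebraMap_apply (MvPolynomial (Fin d) k) K L, IsScalarTower.algebraMap_apply (MvPolynomial (Fin d) k) K E,
      ← IsScalarTower.algebraMap_apply K E L])
  have hC : Module.Finite (MvPolynomial (Fin d) k) (integralClosure (MvPolynomial (Fin d) k) E) :=
    IsIntegralClosure.finite _ K E _
  let e := Module.finBasis K L
  let y := Module.finBasis K E
  choose n0 hn0 using fun i => IsPurelyInseparable.pow_mem E p (e i)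
  let n := ∑ i, n0 i
  have hEi : ∀ i, ∃ x : E, algebraMap E L x = e i ^ p ^ n := by
    intro i
    obtain ⟨x, hx⟩ := hn0 i
    have hle : n0 i ≤ n := Finset.single_le_sum (f := n0) (fun _ _ => Nat.zero_le _) (Finset.mem_univ i)
    refine ⟨x ^ p ^ (n - n0 i), ?_⟩
    rw [map_pow, hx, ← pow_mul, ← pow_add, Nat.add_sub_cancel' hle]
  choose x hx using hEi
  have hq : p ^ n ≠ 0 := (pow_pos (expChar_pos k p) n).ne'
  obtain ⟨t, ht⟩ := hC.fg_top
  let s : Finset E := t.image (fun z : integralClosure (MvPolynomial (Fin d) k) E => (z : E)) ∪ Finset.univ.image x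
  obtain ⟨D, hD0, hD⟩ := auxN_coord (S := MvPolynomial (Fin d) k) y s
  have hsx : ∀ i, x i ∈ Submodule.span (MvPolynomial (Fin d) k) (s : Set E) := fun i =>
    Submodule.subset_span (by simp [s])
  have hsC : ∀ z : E, IsIntegral (MvPolynomial (Fin d) k) z → z ∈ Submodule.span (MvPolynomial (Fin d) k) (s : Set E) := by
    intro z hz
    have h1 : (⟨z, hz⟩ : integralClosure (MvPolynomial (Fin d) k) E) ∈ Submodule.span (MvPolynomial (Fin d) k) (t : Set _) := by
      rw [ht]; trivial
    have h2 := Submodule.mem_map_of_mem (f := (integralClosure (MvPolynomial (Fin d) k) E).val.toLinearMap) h1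
    rw [Submodule.map_span] at h2
    refine Submodule.span_mono ?_ h2
    rintro _ ⟨w, hw, rfl⟩
    simp only [s, Finset.coe_union, Finset.coe_image]
    exact Or.inl ⟨w, hw, rfl⟩
  choose c hc using fun i j => hD (x i) (hsx i) j
  have hpow : ∀ h : Fin (Module.finrank K L) → K, algebraMap E L (∑ i, h i ^ p ^ n • x i) = (∑ i, h i • e i) ^ p ^ n := by
    intro h
    rw [map_sum, sum_pow_char_pow p n]
    refine Finset.sum_congr rfl fun i _ => ?_
    rw [Algebra.smul_def, map_mul, hx, _root_.smul_pow, Algebra.smul_def, ← IsScalarTower.algebraMap_apply]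
  have hcoord : ∀ (h : Fin (Module.finrank K L) → K) j, algebraMap _ K D * y.repr (∑ i, h i ^ p ^ n • x i) j
      = ∑ i, h i ^ p ^ n * algebraMap _ K (c i j) := by
    intro h j
    rw [map_sum, Finsupp.finsetSum_apply, Finset.mul_sum]
    refine Finset.sum_congr rfl fun i _ => ?_
    rw [← hc, map_smul, Finsupp.smul_apply, smul_eq_mul]
    ring
  let T := {l : MvPolynomial (Fin d) k →+ MvPolynomial (Fin d) k // ∀ h c', l (h ^ p ^ n * c') = h * l c'}
  obtain ⟨δ, hδ0, hδ⟩ := auxN_A (S := MvPolynomial (Fin d) k) (K := K)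
    (fun (z : T × Fin (Module.finrank K E)) i => z.1.1 (c i z.2)) (by
      intro v hv
      have h1 : ∀ j, ∑ i, v i ^ p ^ n * c i j = 0 := by
        intro j
        by_contra hne
        obtain ⟨l, hl, hl0⟩ := auxN_B p n _ hne
        apply hl0
        rw [map_sum]
        simp only [hl]
        exact hv (⟨l, hl⟩, j)
      have h2 : ∑ i, (algebraMap _ K (v i)) ^ p ^ n • x i = 0 := by
        apply y.repr.injective
        ext j
        have h3 := hcoord (fun i => algebraMap _ K (v i)) j
        have h4 : ∑ i, (algebraMap _ K (v i)) ^ p ^ n * algebraMap _ K (c i j) = algebraMap (MvPolynomial (Fin d) k) K 0 := by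
          rw [← h1 j]; simp
        rw [h4, map_zero] at h3
        simpa using (mul_eq_zero.1 h3).resolve_left (fun h => hD0 ((map_eq_zero_iff _ hinj).1 h))
      have h5 := hpow (fun i => algebraMap _ K (v i))
      rw [h2, map_zero] at h5
      have h6 := pow_eq_zero_iff hq |>.1 h5.symm
      have h7 := Fintype.linearIndependent_iff.1 e.linearIndependent _ h6
      ext1 i
      exact hinj (by rw [h7 i]; simp))
  have hδK : algebraMap _ K δ ≠ 0 := by rwa [Ne, map_eq_zero_iff _ hinj]
  have main : ∀ b : L, IsIntegral (MvPolynomial (Fin d) k) b → ∀ i, ∃ m, algebraMap _ K δ * e.repr b i = algebraMap (MvPolynomial (Fin d) k) K m := by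
    intro b hb i
    have h1 : algebraMap E L (∑ i, (e.repr b i) ^ p ^ n • x i) = b ^ p ^ n := by
      rw [hpow, e.sum_repr]
    have h2 : IsIntegral (MvPolynomial (Fin d) k) (∑ i, (e.repr b i) ^ p ^ n • x i) := by
      rw [← isIntegral_algebraMap_iff (algebraMap E L).injective, h1]
      exact hb.pow _
    obtain ⟨g, hg⟩ := IsLocalization.exist_integer_multiples (nonZeroDivisors (MvPolynomial (Fin d) k)) Finset.univ
      (fun i => e.repr b i)
    choose gi hgi using fun i => hg i (Finset.mem_univ i)
    have hgK : algebraMap (MvPolynomial (Fin d) k) K g ≠ 0 := by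
      rw [Ne, map_eq_zero_iff _ hinj]; exact nonZeroDivisors.coe_ne_zero g
    have h3 : ∀ j, ∃ m, ∑ i, gi i ^ p ^ n * c i j = (g : MvPolynomial (Fin d) k) ^ p ^ n * m := by
      intro j
      obtain ⟨m, hm⟩ := hD _ (hsC _ h2) j
      refine ⟨m, hinj ?_⟩
      rw [hcoord] at hm
      rw [map_mul, ← hm, map_sum, map_pow, Finset.mul_sum]
      refine Finset.sum_congr rfl fun i _ => ?_
      rw [map_mul, map_pow, hgi, Algebra.smul_def, mul_pow]
      ring
    obtain ⟨m, hm⟩ := hδ gi g (by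
      rintro ⟨⟨l, hl⟩, j⟩
      obtain ⟨m, hm⟩ := h3 j
      refine ⟨l m, ?_⟩
      rw [← hl, ← hm, map_sum]
      simp only [hl]) i
    refine ⟨m, ?_⟩
    have h8 := congrArg (algebraMap _ K) hm
    rw [map_mul, map_mul, hgi, Algebra.smul_def] at h8
    apply mul_left_cancel₀ hgK
    rw [← h8]; ring
  have hle : Subalgebra.toSubmodule (integralClosure (MvPolynomial (Fin d) k) L) ≤
      Submodule.span (MvPolynomial (Fin d) k) (Set.range fun i => (algebraMap _ K δ)⁻¹ • e i) := by
    intro b hb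
    choose m hm using main b hb
    have : b = ∑ i, m i • ((algebraMap _ K δ)⁻¹ • e i) := by
      conv_lhs => rw [← e.sum_repr b]
      refine Finset.sum_congr rfl fun i _ => ?_
      rw [← algebraMap_smul K (m i), ← hm, smul_smul]
      congr 1
      field_simp
    rw [this]
    exact Submodule.sum_mem _ fun i _ => Submodule.smul_mem _ _ (Submodule.subset_span ⟨i, rfl⟩)
  have := isNoetherian_span_of_finite (MvPolynomial (Fin d) k) (Set.finite_range fun i => (algebraMap (MvPolynomial (Fin d) k) K δ)⁻¹ • e i)
  exact Module.Finite.of_injective (Submodule.inclusion hle) (Submodule.inclusion_injective hle)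



theorem auxF_one_mem [CommRing R] (J : Ideal R) : (1 : R) ∈ auxF J 0 := by
  rw [auxF_one J le_rfl]; trivial

theorem auxF_mul_le [CommRing R] (J : Ideal R) (i j : ℝ) : auxF J i * auxF J j ≤ auxF J (i + j) :=
  Ideal.mul_le.2 fun _ hr _ hs => auxF_mul J hr hs

/-- the extended Rees algebra of the filtration -/
def auxRB [CommRing R] (J : Ideal R) : Subalgebra R (AddMonoidAlgebra R ℝ) :=
  auxGrSub (auxF J) (auxF_one_mem J) (auxF_mul_le J)

theorem mem_auxRB [CommRing R] {J : Ideal R} {f : AddMonoidAlgebra R ℝ} :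
    f ∈ auxRB J ↔ ∀ i, f.coeff i ∈ auxF J i := Iff.rfl

/-- the ideal of elements whose coefficients have larger order -/
def auxRP [CommRing R] (J : Ideal R) : Ideal (auxRB J) where
  carrier := {f | ∀ i, (f : AddMonoidAlgebra R ℝ).coeff i ∈ auxFp J i}
  zero_mem' := fun i => by simp
  add_mem' := fun {f g} hf hg i => by
    have : ((f + g : auxRB J) : AddMonoidAlgebra R ℝ).coeff i =
      (f : AddMonoidAlgebra R ℝ).coeff i + (g : AddMonoidAlgebra R ℝ).coeff i := by simp
    rw [this]; exact add_mem (hf i) (hg i)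
  smul_mem' := fun g f hf i => by
    change ((g : AddMonoidAlgebra R ℝ) * (f : AddMonoidAlgebra R ℝ)).coeff i ∈ _
    refine aux_coeff_mul_mem _ _ _ _ fun j k hjk => ?_
    subst hjk
    exact auxF_mul_Fp J (g.2 j) (hf k)

theorem mem_auxRP [CommRing R] {J : Ideal R} {f : auxRB J} :
    f ∈ auxRP J ↔ ∀ i, (f : AddMonoidAlgebra R ℝ).coeff i ∈ auxFp J i := Iff.rfl

theorem auxFp_neg [CommRing R] (J : Ideal R) {α : ℝ} (h : α < 0) : auxFp J α = ⊤ :=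
  top_le_iff.1 ((auxF_one J (le_refl (0 : ℝ))).ge.trans (auxF_le_Fp J h))

theorem aux_lead [CommRing R] (J : Ideal R) (f g : AddMonoidAlgebra R ℝ) (hf : f ∈ auxRB J) (hg : g ∈ auxRB J)
    (α β : ℝ) (hα : ∀ i < α, f.coeff i ∈ auxFp J i) (hβ : ∀ i < β, g.coeff i ∈ auxFp J i) :
    (f * g).coeff (α + β) - f.coeff α * g.coeff β ∈ auxFp J (α + β) := by
  classical
  have e1 : f = (f - AddMonoidAlgebra.single α (f.coeff α)) + AddMonoidAlgebra.single α (f.coeff α) := by ring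
  have e2 : (AddMonoidAlgebra.single α (f.coeff α) * g).coeff (α + β) = f.coeff α * g.coeff β := by
    rw [AddMonoidAlgebra.coeff_single_mul_add]
  have e3 : (f * g).coeff (α + β) - f.coeff α * g.coeff β =
      ((f - AddMonoidAlgebra.single α (f.coeff α)) * g).coeff (α + β) := by
    rw [sub_mul, AddMonoidAlgebra.coeff_sub, Finsupp.sub_apply, e2]
  rw [e3]
  refine aux_coeff_mul_mem _ _ _ _ fun i j hij => ?_
  rw [← hij, AddMonoidAlgebra.coeff_sub, Finsupp.sub_apply, AddMonoidAlgebra.coeff_single, Finsupp.single_apply]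
  rcases lt_trichotomy i α with h | h | h
  · rw [if_neg h.ne', sub_zero]
    exact auxFp_mul_F J (hα i h) (hg j)
  · rw [if_pos h.symm, h, sub_self, zero_mul]
    exact Ideal.zero_mem _
  · rw [if_neg h.ne, sub_zero]
    exact auxF_mul_Fp J (hf i) (hβ j (by linarith))

theorem aux_exists_lead [CommRing R] (J : Ideal R) (f : AddMonoidAlgebra R ℝ) (h : ¬ ∀ i, f.coeff i ∈ auxFp J i) :
    ∃ α, 0 ≤ α ∧ f.coeff α ∉ auxFp J α ∧ ∀ i < α, f.coeff i ∈ auxFp J i := by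
  classical
  push Not at h
  obtain ⟨i0, hi0⟩ := h
  let s := f.coeff.support.filter (fun i => f.coeff i ∉ auxFp J i)
  have hmem : ∀ i, f.coeff i ∉ auxFp J i → i ∈ s := by
    intro i hi
    simp only [s, Finset.mem_filter, Finsupp.mem_support_iff]
    exact ⟨fun h0 => hi (h0 ▸ Ideal.zero_mem _), hi⟩
  have hs : s.Nonempty := ⟨i0, hmem i0 hi0⟩
  have hmin := s.min'_mem hs
  have h1 := (Finset.mem_filter.1 hmin).2
  refine ⟨s.min' hs, ?_, h1, ?_⟩
  · by_contra hneg
    exact h1 (by rw [auxFp_neg J (not_le.1 hneg)]; trivial)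
  · intro i hi
    by_contra hc
    exact absurd (s.min'_le i (hmem i hc)) (not_le.2 hi)

theorem auxQ_reduced [CommRing R] (J : Ideal R) : IsReduced (auxRB J ⧸ auxRP J) := by
  refine isReduced_iff_pow_one_lt 2 (by norm_num) |>.2 ?_
  intro b hb
  obtain ⟨f, rfl⟩ := Ideal.Quotient.mk_surjective b
  rw [← map_pow, Ideal.Quotient.eq_zero_iff_mem] at hb
  rw [Ideal.Quotient.eq_zero_iff_mem]
  by_contra hf
  obtain ⟨α, -, h1, h2⟩ := aux_exists_lead J f hf
  apply h1
  apply auxFp_of_pow J 2 (by norm_num)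
  have h3 := aux_lead J f f f.2 f.2 α α h2 h2
  have h4 := hb (α + α)
  have h5 := sub_mem h4 h3
  rw [pow_two, show ((2 : ℕ) : ℝ) * α = α + α by push_cast; ring]
  convert h5 using 1
  change _ = (((f : AddMonoidAlgebra R ℝ) ^ 2).coeff (α + α)) - _
  rw [pow_two]; ring

/-- evaluation into the Rees algebra -/
noncomputable def auxPsi [CommRing R] {d : ℕ} (a : Fin d → R) : MvPolynomial (Fin d) R →ₐ[R] auxRB (Ideal.span (Set.range a)) :=
  MvPolynomial.aeval (fun i => ⟨AddMonoidAlgebra.single 1 (a i), fun j => by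
    classical
    rw [AddMonoidAlgebra.coeff_single, Finsupp.single_apply]
    split_ifs with h
    · rw [← h]
      have := aux_pow_le_F (Ideal.span (Set.range a)) 1
      rw [pow_one, Nat.cast_one] at this
      exact this (Ideal.subset_span ⟨i, rfl⟩)
    · exact Ideal.zero_mem _⟩)

theorem auxPsi_monomial [CommRing R] {d : ℕ} (a : Fin d → R) (u : Fin d →₀ ℕ) (r : R) :
    (auxPsi a (MvPolynomial.monomial u r) : AddMonoidAlgebra R ℝ) =
      AddMonoidAlgebra.single (u.degree : ℝ) (MvPolynomial.eval a (MvPolynomial.monomial u r)) := by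
  rw [auxPsi, MvPolynomial.aeval_monomial, MvPolynomial.eval_monomial]
  simp only [Finsupp.prod_fintype, pow_zero, implies_true]
  rw [Subalgebra.coe_mul, Subalgebra.coe_algebraMap, AddMonoidAlgebra.coe_algebraMap]
  push_cast
  have : ∀ i : Fin d, (AddMonoidAlgebra.single (1 : ℝ) (a i)) ^ u i = AddMonoidAlgebra.single (u i : ℝ) (a i ^ u i) := by
    intro i
    rw [AddMonoidAlgebra.single_pow]; simp
  simp only [this]
  have h2 : ∀ s : Finset (Fin d), ∏ i ∈ s, (AddMonoidAlgebra.single (u i : ℝ) (a i ^ u i)) =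
      AddMonoidAlgebra.single ((∑ i ∈ s, u i : ℕ) : ℝ) (∏ i ∈ s, a i ^ u i) := by
    intro s
    induction s using Finset.induction_on with
    | empty => simp [AddMonoidAlgebra.one_def]
    | insert i s hi ih => rw [Finset.prod_insert hi, ih, AddMonoidAlgebra.single_mul_single, Finset.prod_insert hi, Finset.sum_insert hi]; push_cast; rfl
  rw [h2, Function.comp_apply, AddMonoidAlgebra.single_mul_single, zero_add, Finsupp.degree_eq_sum]
  rfl

theorem auxPsi_hom [CommRing R] {d : ℕ} (a : Fin d → R) (j : ℕ) (H : MvPolynomial (Fin d) R) (hH : H.IsHomogeneous j) :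
    (auxPsi a H : AddMonoidAlgebra R ℝ) = AddMonoidAlgebra.single (j : ℝ) (MvPolynomial.eval a H) := by
  have h1 : auxPsi a H = ∑ u ∈ H.support, auxPsi a (MvPolynomial.monomial u (H.coeff u)) := by
    rw [← map_sum, MvPolynomial.support_sum_monomial_coeff]
  have h2 : MvPolynomial.eval a H = ∑ u ∈ H.support, MvPolynomial.eval a (MvPolynomial.monomial u (H.coeff u)) := by
    rw [← map_sum, MvPolynomial.support_sum_monomial_coeff]
  rw [h1, h2]
  rw [AddSubmonoidClass.coe_finset_sum]
  have h3 : ∀ s : Finset (Fin d →₀ ℕ), AddMonoidAlgebra.single (j : ℝ) (∑ u ∈ s, MvPolynomial.eval a (MvPolynomial.monomial u (H.coeff u)))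
      = ∑ u ∈ s, AddMonoidAlgebra.single (j : ℝ) (MvPolynomial.eval a (MvPolynomial.monomial u (H.coeff u))) := by
    intro s
    exact map_sum (AddMonoidAlgebra.singleAddHom (j : ℝ)) _ _
  rw [h3]
  refine Finset.sum_congr rfl fun u hu => ?_
  have h4 : j = u.degree := hH.degree_eq_sum_deg_support hu
  rw [auxPsi_monomial, ← h4]

theorem auxPsi_coeff [CommRing R] {d : ℕ} (a : Fin d → R) (j : ℕ) (H : MvPolynomial (Fin d) R) :
    (auxPsi a H : AddMonoidAlgebra R ℝ).coeff (j : ℝ) = MvPolynomial.eval a (MvPolynomial.homogeneousComponent j H) := by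
  classical
  have h1 : auxPsi a H = ∑ i ∈ Finset.range (H.totalDegree + 1), auxPsi a (MvPolynomial.homogeneousComponent i H) := by
    rw [← map_sum, MvPolynomial.sum_homogeneousComponent]
  rw [h1, AddSubmonoidClass.coe_finset_sum, AddMonoidAlgebra.coeff_sum, Finsupp.finsetSum_apply]
  simp only [auxPsi_hom a _ _ (MvPolynomial.homogeneousComponent_isHomogeneous _ H), AddMonoidAlgebra.coeff_single,
    Finsupp.single_apply, Nat.cast_inj]
  rw [Finset.sum_ite_eq' (Finset.range _) j]
  split_ifs with h
  · rfl
  · rw [MvPolynomial.homogeneousComponent_eq_zero _ _ (by simpa using h), map_zero]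

theorem auxPsi_coeff_ne [CommRing R] {d : ℕ} (a : Fin d → R) (γ : ℝ) (hγ : ∀ j : ℕ, (j : ℝ) ≠ γ) (H : MvPolynomial (Fin d) R) :
    (auxPsi a H : AddMonoidAlgebra R ℝ).coeff γ = 0 := by
  classical
  have h1 : auxPsi a H = ∑ i ∈ Finset.range (H.totalDegree + 1), auxPsi a (MvPolynomial.homogeneousComponent i H) := by
    rw [← map_sum, MvPolynomial.sum_homogeneousComponent]
  rw [h1, AddSubmonoidClass.coe_finset_sum, AddMonoidAlgebra.coeff_sum, Finsupp.finsetSum_apply]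
  simp only [auxPsi_hom a _ _ (MvPolynomial.homogeneousComponent_isHomogeneous _ H), AddMonoidAlgebra.coeff_single,
    Finsupp.single_apply, hγ, if_false, Finset.sum_const_zero]



theorem aux_finite_abs {k B : Type*} {d : ℕ} [Field k] [CommRing B] [Algebra (MvPolynomial (Fin d) k) B]
    [IsReduced B] (htf : ∀ (s : MvPolynomial (Fin d) k) (b : B), s ≠ 0 → s • b = 0 → b = 0)
    (hintg : ∀ b : B, IsIntegral (MvPolynomial (Fin d) k) b)
    (n : ℕ) (hrank : ∀ s : Finset B, (LinearIndependent (MvPolynomial (Fin d) k) fun i : s => (i : B)) → s.card ≤ n) :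
    Module.Finite (MvPolynomial (Fin d) k) B := by
  classical
  set S := MvPolynomial (Fin d) k with hS
  let K := FractionRing S
  let L := Localization (Algebra.algebraMapSubmonoid B (nonZeroDivisors S))
  letI : Algebra K L := localizationAlgebra (nonZeroDivisors S) B
  haveI : IsScalarTower S K L := isScalarTower_localizationAlgebra _ _
  have hfd : FiniteDimensional K L := by
    rw [FiniteDimensional, ← Module.rank_lt_aleph0_iff]
    have h1 : Module.rank S B ≤ n := rank_le hrank
    have h2 := IsLocalizedModule.lift_rank_eq (nonZeroDivisors S) (IsScalarTower.toAlgHom S B L).toLinearMap le_rfl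
    have h3 := IsLocalization.rank_eq (N := L) K (nonZeroDivisors S) le_rfl
    rw [← h3] at h2
    have h4 := Cardinal.lift_le.2 h1
    rw [← h2] at h4
    rw [← Cardinal.lift_lt_aleph0]
    refine h4.trans_lt ?_
    rw [Cardinal.lift_natCast]
    exact Cardinal.natCast_lt_aleph0
  have hart : IsArtinianRing L := IsArtinianRing.of_finite K L
  have hred : IsReduced L := inferInstance
  have hfin : Fintype (MaximalSpectrum L) := Fintype.ofFinite _
  have hinj : Function.Injective (algebraMap B L) := by
    rw [injective_iff_map_eq_zero]
    intro b hb
    rw [IsLocalization.map_eq_zero_iff (Algebra.algebraMapSubmonoid B (nonZeroDivisors S))] at hb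
    obtain ⟨⟨_, s, hs, rfl⟩, hb⟩ := hb
    refine htf s b (nonZeroDivisors.ne_zero hs) ?_
    rw [Algebra.smul_def]; exact hb
  letI : ∀ M : MaximalSpectrum L, Field (L ⧸ M.asIdeal) := fun M => by
    haveI := M.isMaximal
    exact Ideal.Quotient.field M.asIdeal
  have hN : ∀ M : MaximalSpectrum L, Module.Finite S (integralClosure S (L ⧸ M.asIdeal)) := by
    intro M
    haveI : FiniteDimensional K (L ⧸ M.asIdeal) := Module.Finite.of_surjective (Ideal.Quotient.mkₐ K M.asIdeal).toLinearMap Ideal.Quotient.mk_surjective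
    exact auxNagata (K := K)
  let ev : ∀ M : MaximalSpectrum L, B →ₐ[S] L ⧸ M.asIdeal := fun M => (Ideal.Quotient.mkₐ S M.asIdeal).comp (IsScalarTower.toAlgHom S B L)
  let θ : B →ₗ[S] (∀ M : MaximalSpectrum L, integralClosure S (L ⧸ M.asIdeal)) :=
    LinearMap.pi fun M => ((ev M).codRestrict (integralClosure S (L ⧸ M.asIdeal)) (fun b => (hintg b).map (ev M))).toLinearMap
  have hθ : Function.Injective θ := by
    rw [injective_iff_map_eq_zero]
    intro b hb
    apply hinj
    apply (IsArtinianRing.equivPi L).injective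
    ext M
    have := congrArg Subtype.val (congrFun hb M)
    rw [map_zero, map_zero, IsArtinianRing.equivPi_apply]
    exact this
  exact Module.Finite.of_injective θ hθ



/-- the residue field maps to the graded ring -/
noncomputable def auxRes [CommRing R] [IsLocalRing R] {d : ℕ} (a : Fin d → R)
    (hm : maximalIdeal R ≤ auxFp (Ideal.span (Set.range a)) 0) :
    ResidueField R →+* (auxRB (Ideal.span (Set.range a)) ⧸ auxRP (Ideal.span (Set.range a))) :=
  Ideal.Quotient.lift (maximalIdeal R)
    (algebraMap R (auxRB (Ideal.span (Set.range a)) ⧸ auxRP (Ideal.span (Set.range a)))) (fun r hr => by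
      classical
      change Ideal.Quotient.mk (auxRP (Ideal.span (Set.range a))) (algebraMap R _ r) = 0
      rw [Ideal.Quotient.eq_zero_iff_mem]
      intro i
      rw [Subalgebra.coe_algebraMap, AddMonoidAlgebra.coe_algebraMap, Function.comp_apply,
        AddMonoidAlgebra.coeff_single, Finsupp.single_apply]
      split_ifs with h
      · rw [← h]; exact hm hr
      · exact Ideal.zero_mem _)

/-- structure map from the polynomial ring over the residue field -/
noncomputable def auxPhi [CommRing R] [IsLocalRing R] {d : ℕ} (a : Fin d → R)
    (hm : maximalIdeal R ≤ auxFp (Ideal.span (Set.range a)) 0) :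
    MvPolynomial (Fin d) (ResidueField R) →+* (auxRB (Ideal.span (Set.range a)) ⧸ auxRP (Ideal.span (Set.range a))) :=
  MvPolynomial.eval₂Hom (auxRes a hm) (fun i => Ideal.Quotient.mk _ (auxPsi a (MvPolynomial.X i)))

theorem auxPhi_map [CommRing R] [IsLocalRing R] {d : ℕ} (a : Fin d → R)
    (hm : maximalIdeal R ≤ auxFp (Ideal.span (Set.range a)) 0) (H : MvPolynomial (Fin d) R) :
    auxPhi a hm (MvPolynomial.map (residue R) H) = Ideal.Quotient.mk _ (auxPsi a H) := by
  have : (auxPhi a hm).comp (MvPolynomial.map (residue R)) =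
      (Ideal.Quotient.mk (auxRP (Ideal.span (Set.range a)))).comp (auxPsi a).toRingHom := by
    apply MvPolynomial.ringHom_ext
    · intro r
      rw [RingHom.comp_apply, MvPolynomial.map_C, auxPhi, MvPolynomial.coe_eval₂Hom, MvPolynomial.eval₂_C]
      change algebraMap R (auxRB (Ideal.span (Set.range a)) ⧸ auxRP (Ideal.span (Set.range a))) r =
        Ideal.Quotient.mk (auxRP (Ideal.span (Set.range a))) (auxPsi a (algebraMap R _ r))
      rw [AlgHom.commutes]; rfl
    · intro i
      rw [RingHom.comp_apply, MvPolynomial.map_X, auxPhi, MvPolynomial.coe_eval₂Hom, MvPolynomial.eval₂_X]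
      rfl
  exact RingHom.congr_fun this H

theorem auxPsi_mem_max [CommRing R] [IsLocalRing R] {d : ℕ} (a : Fin d → R)
    (hm : maximalIdeal R ≤ auxFp (Ideal.span (Set.range a)) 0) (H : MvPolynomial (Fin d) R) (j : ℕ)
    (hj : MvPolynomial.map (residue R) (MvPolynomial.homogeneousComponent j H) = 0) :
    (auxPsi a H : AddMonoidAlgebra R ℝ).coeff (j : ℝ) ∈ auxFp (Ideal.span (Set.range a)) j := by
  rw [auxPsi_coeff]
  have h1 := aux_eval_mem a (maximalIdeal R) j _ (MvPolynomial.homogeneousComponent_isHomogeneous j H) (fun u => by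
    have := congrArg (MvPolynomial.coeff u) hj
    rw [MvPolynomial.coeff_map, MvPolynomial.coeff_zero] at this
    exact Ideal.Quotient.eq_zero_iff_mem.1 this)
  refine (Ideal.mul_le.2 ?_) h1
  intro r hr s hs
  have := auxFp_mul_F (Ideal.span (Set.range a)) (hm hr) (aux_pow_le_F _ j hs)
  rwa [zero_add] at this

theorem auxPhi_tf [CommRing R] [IsLocalRing R] {d : ℕ} (a : Fin d → R) (h : auxReg d a)
    (hJ : Ideal.span (Set.range a) ≤ maximalIdeal R)
    (hm : maximalIdeal R ≤ auxFp (Ideal.span (Set.range a)) 0)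
    (s : MvPolynomial (Fin d) (ResidueField R)) (b) (hs : s ≠ 0) (hb : auxPhi a hm s * b = 0) : b = 0 := by
  classical
  obtain ⟨H, rfl⟩ := MvPolynomial.map_surjective (residue R) residue_surjective s
  obtain ⟨f, rfl⟩ := Ideal.Quotient.mk_surjective b
  rw [auxPhi_map, ← map_mul, Ideal.Quotient.eq_zero_iff_mem] at hb
  rw [Ideal.Quotient.eq_zero_iff_mem]
  by_contra hf
  obtain ⟨α, h0, h1, h2⟩ := aux_exists_lead _ _ hf
  have hex : ∃ j, MvPolynomial.map (residue R) (MvPolynomial.homogeneousComponent j H) ≠ 0 := by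
    by_contra hcon
    push Not at hcon
    apply hs
    rw [← MvPolynomial.sum_homogeneousComponent H, map_sum]
    exact Finset.sum_eq_zero fun i _ => hcon i
  have hj := Nat.find_spec hex
  have hmin : ∀ i < Nat.find hex, _ := fun i hi => not_not.1 (Nat.find_min hex hi)
  set j := Nat.find hex
  have h3 := aux_lead _ (auxPsi a H) f (auxPsi a H).2 f.2 j α (fun i hi => by
    by_cases hi' : ∃ n : ℕ, (n : ℝ) = i
    · obtain ⟨n, rfl⟩ := hi'
      exact auxPsi_mem_max a hm H n (hmin n (by exact_mod_cast hi))
    · push Not at hi'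
      rw [auxPsi_coeff_ne a i hi']; exact Ideal.zero_mem _) h2
  have h4 := hb (j + α)
  have h5 := sub_mem h4 h3
  apply h1
  refine aux_tors h j _ (MvPolynomial.homogeneousComponent_isHomogeneous j H) hj hJ _ α h0 ?_
  rw [← auxPsi_coeff, add_comm α]
  convert h5 using 1
  change _ = ((auxPsi a H : AddMonoidAlgebra R ℝ) * (f : AddMonoidAlgebra R ℝ)).coeff (j + α) - _
  ring

theorem auxF_chain [CommRing R] (J : Ideal R) (A : Finset ℝ) : ∀ (N : ℝ), (∀ α ∈ A, α < N) →
    ∑ α ∈ A, Module.length R (Submodule.map (Submodule.mkQ (auxFp J α)) (auxF J α)) ≤ auxLen (auxF J N) := by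
  classical
  induction A using Finset.induction_on_max with
  | empty => intro N _; simp
  | insert α A hA ih =>
    intro N hN
    rw [Finset.sum_insert (fun h => lt_irrefl _ (hA α h))]
    have h1 := ih α hA
    have h2 : auxLen (auxFp J α) = Module.length R (Submodule.map (Submodule.mkQ (auxFp J α)) (auxF J α)) + auxLen (auxF J α) := by
      rw [auxLen, Module.length_eq_add_of_exact (Submodule.map (Submodule.mkQ (auxFp J α)) (auxF J α)).subtype
        (Submodule.mkQ _) (Submodule.subtype_injective _) (Submodule.mkQ_surjective _)
        (by rw [LinearMap.exact_iff, Submodule.ker_mkQ, Submodule.range_subtype])]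
      congr 1
      exact (Submodule.quotientQuotientEquivQuotient _ _ (auxFp_le_F J α)).length_eq
    calc _ ≤ _ := add_le_add le_rfl h1
      _ = _ := h2.symm
      _ ≤ _ := auxLen_anti (auxF_le_Fp J (hN α (Finset.mem_insert_self _ _)))

theorem auxLen_max [CommRing R] [IsLocalRing R] : 1 ≤ auxLen (maximalIdeal R) := by
  have := auxLen_strict (le_top : maximalIdeal R ≤ ⊤) 1 trivial (Ideal.ne_top_iff_one _ |>.1 (Ideal.IsMaximal.ne_top inferInstance))
  exact le_trans (by simp) this

theorem aux_count [CommRing R] [IsLocalRing R] (J : Ideal R) {ι : Type*} [Fintype ι] (f : ι → auxRB J) (N : ℝ)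
    (hN : ∀ i α, N ≤ α → (f i : AddMonoidAlgebra R ℝ).coeff α = 0)
    (hind : ∀ r : ι → R, ∑ i, r i • f i ∈ auxRP J → ∀ i, r i ∈ maximalIdeal R) :
    (Fintype.card ι : ℕ∞) ≤ auxLen (auxF J N) := by
  classical
  let A : Finset ℝ := Finset.univ.biUnion fun i => (f i : AddMonoidAlgebra R ℝ).coeff.support
  have hA : ∀ α ∈ A, α < N := by
    intro α hα
    simp only [A, Finset.mem_biUnion, Finset.mem_univ, true_and, Finsupp.mem_support_iff] at hα
    obtain ⟨i, hi⟩ := hα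
    by_contra hc
    exact hi (hN i α (not_lt.1 hc))
  have hA' : ∀ i, ∀ α ∉ A, (f i : AddMonoidAlgebra R ℝ).coeff α = 0 := by
    intro i α hα
    by_contra hc
    exact hα (by simp only [A, Finset.mem_biUnion, Finset.mem_univ, true_and, Finsupp.mem_support_iff]; exact ⟨i, hc⟩)
  let cf : ∀ α : A, (ι → R) →ₗ[R] Submodule.map (Submodule.mkQ (auxFp J (α : ℝ))) (auxF J (α : ℝ)) := fun α =>
    LinearMap.codRestrict _ ((Submodule.mkQ (auxFp J (α : ℝ))).comp
      (Fintype.linearCombination R (fun i => (f i : AddMonoidAlgebra R ℝ).coeff (α : ℝ)))) (fun r => by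
        refine Submodule.mem_map_of_mem ?_
        rw [Fintype.linearCombination_apply]
        exact Submodule.sum_mem _ fun i _ => Submodule.smul_mem _ _ ((f i).2 _))
  let θ := LinearMap.pi cf
  have hcoe : ∀ (r : ι → R) (α : ℝ), ((∑ i, r i • f i : auxRB J) : AddMonoidAlgebra R ℝ).coeff α =
      ∑ i, r i * (f i : AddMonoidAlgebra R ℝ).coeff α := by
    intro r α
    rw [AddSubmonoidClass.coe_finset_sum, AddMonoidAlgebra.coeff_sum, Finsupp.finsetSum_apply]
    rfl
  have hker : LinearMap.ker θ ≤ Submodule.pi Set.univ (fun _ : ι => maximalIdeal R) := by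
    intro r hr
    have h1 := hind r (by
      intro α
      rw [hcoe]
      by_cases hα : α ∈ A
      · have h2 := congrArg Subtype.val (congrFun hr ⟨α, hα⟩)
        have h3 : Submodule.mkQ (auxFp J α) (∑ i, r i * (f i : AddMonoidAlgebra R ℝ).coeff α) = 0 := by
          refine Eq.trans ?_ h2
          simp [θ, cf, Fintype.linearCombination_apply]
        exact (Submodule.Quotient.mk_eq_zero _).1 h3
      · rw [Finset.sum_eq_zero fun i _ => by rw [hA' i α hα, mul_zero]]
        exact Ideal.zero_mem _)
    intro i _
    exact h1 i
  calc (Fintype.card ι : ℕ∞) ≤ Fintype.card ι * auxLen (maximalIdeal R) := by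
        conv_lhs => rw [← mul_one (Fintype.card ι : ℕ∞)]
        gcongr
        exact auxLen_max
    _ = Module.length R ((ι → R) ⧸ Submodule.pi Set.univ (fun _ : ι => maximalIdeal R)) := (auxLen_pi ι _).symm
    _ ≤ Module.length R ((ι → R) ⧸ LinearMap.ker θ) :=
        Module.length_le_of_surjective (Submodule.factor hker) (Submodule.factor_surjective hker)
    _ = Module.length R (LinearMap.range θ) := θ.quotKerEquivRange.length_eq
    _ ≤ _ := Module.length_le_of_injective (LinearMap.range θ).subtype (Submodule.subtype_injective _)
    _ = ∑ α : A, Module.length R (Submodule.map (Submodule.mkQ (auxFp J (α : ℝ))) (auxF J (α : ℝ))) := by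
        rw [Module.length_pi_of_fintype]
    _ = ∑ α ∈ A, Module.length R (Submodule.map (Submodule.mkQ (auxFp J α)) (auxF J α)) := by
        rw [← Finset.sum_coe_sort A]
    _ ≤ _ := auxF_chain J A N hA



theorem aux_rank [CommRing R] [IsLocalRing R] {d : ℕ} (hd : 0 < d) (a : Fin d → R) (h : auxReg d a)
    (hm : maximalIdeal R ≤ auxFp (Ideal.span (Set.range a)) 0) (E : ℕ) (hE : auxLen (Ideal.span (Set.range a)) = E)
    {ι : Type*} [Fintype ι] (g : ι → auxRB (Ideal.span (Set.range a)) ⧸ auxRP (Ideal.span (Set.range a)))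
    (hg : ∀ c : ι → MvPolynomial (Fin d) (ResidueField R), ∑ i, auxPhi a hm (c i) * g i = 0 → ∀ i, c i = 0) :
    Fintype.card ι ≤ E * (d + 1) ^ d := by
  classical
  choose f hf using fun i => Ideal.Quotient.mk_surjective (g i)
  let D : ℕ := ∑ i, ∑ β ∈ (f i : AddMonoidAlgebra R ℝ).coeff.support, (⌈β⌉₊ + 1)
  have hD : ∀ i α, (D : ℝ) ≤ α → (f i : AddMonoidAlgebra R ℝ).coeff α = 0 := by
    intro i α hα
    by_contra hc
    have h1 : ⌈α⌉₊ + 1 ≤ ∑ β ∈ (f i : AddMonoidAlgebra R ℝ).coeff.support, (⌈β⌉₊ + 1) :=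
      Finset.single_le_sum (f := fun β : ℝ => ⌈β⌉₊ + 1) (fun _ _ => Nat.zero_le _) (Finsupp.mem_support_iff.2 hc)
    have h2 : (∑ β ∈ (f i : AddMonoidAlgebra R ℝ).coeff.support, (⌈β⌉₊ + 1)) ≤ D :=
      Finset.single_le_sum (f := fun i => ∑ β ∈ (f i : AddMonoidAlgebra R ℝ).coeff.support, (⌈β⌉₊ + 1)) (fun _ _ => Nat.zero_le _) (Finset.mem_univ i)
    have h3 : ((⌈α⌉₊ + 1 : ℕ) : ℝ) ≤ D := by exact_mod_cast h1.trans h2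
    have h4 := Nat.le_ceil α
    push_cast at h3
    linarith
  set c : ℕ := D + d with hc
  let ex : (Fin d → Fin (c + 1)) → (Fin d →₀ ℕ) := fun u => Finsupp.equivFunOnFinite.symm (fun j => (u j : ℕ))
  have hex : Function.Injective ex := by
    intro u v huv
    ext j
    exact DFunLike.congr_fun huv j
  have hdeg : ∀ u, (ex u).degree ≤ d * c := by
    intro u
    rw [Finsupp.degree_eq_sum]
    calc ∑ i, ex u i ≤ ∑ i : Fin d, c := Finset.sum_le_sum fun i _ => Nat.le_of_lt_succ (u i).2
      _ = d * c := by simp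
  let F : (Fin d → Fin (c + 1)) × ι → auxRB (Ideal.span (Set.range a)) := fun z =>
    auxPsi a (MvPolynomial.monomial (ex z.1) 1) * f z.2
  have hcount := aux_count (Ideal.span (Set.range a)) F ((d * c + D : ℕ) : ℝ) (by
    rintro ⟨u, i⟩ α hα
    have e : α = ((ex u).degree : ℝ) + (α - ((ex u).degree : ℝ)) := by ring
    change ((auxPsi a (MvPolynomial.monomial (ex u) 1) : AddMonoidAlgebra R ℝ) * (f i : AddMonoidAlgebra R ℝ)).coeff α = 0
    rw [auxPsi_monomial, e, AddMonoidAlgebra.coeff_single_mul_add, hD i _ ?_, mul_zero]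
    have h1 : ((ex u).degree : ℝ) ≤ ((d * c : ℕ) : ℝ) := by exact_mod_cast hdeg u
    push_cast at hα h1
    linarith) (by
    intro r hr
    let H : ι → MvPolynomial (Fin d) R := fun i => ∑ u, MvPolynomial.monomial (ex u) (r (u, i))
    have h1 : ∑ z, r z • F z = ∑ i, auxPsi a (H i) * f i := by
      rw [Fintype.sum_prod_type, Finset.sum_comm]
      refine Finset.sum_congr rfl fun i _ => ?_
      simp only [H, map_sum]
      rw [Finset.sum_mul]
      refine Finset.sum_congr rfl fun u _ => ?_
      simp only [F]
      rw [← smul_mul_assoc, ← map_smul, MvPolynomial.smul_monomial, smul_eq_mul, mul_one]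
    rw [h1, ← Ideal.Quotient.eq_zero_iff_mem, map_sum] at hr
    have h2 := hg (fun i => MvPolynomial.map (residue R) (H i)) (by
      rw [← hr]
      refine Finset.sum_congr rfl fun i _ => ?_
      rw [auxPhi_map, map_mul, hf])
    rintro ⟨u, i⟩
    have h3 := congrArg (MvPolynomial.coeff (ex u)) (h2 i)
    rw [MvPolynomial.coeff_map, MvPolynomial.coeff_zero] at h3
    have h4 : MvPolynomial.coeff (ex u) (H i) = r (u, i) := by
      simp only [H, MvPolynomial.coeff_sum, MvPolynomial.coeff_monomial, hex.eq_iff]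
      simp
    rw [h4] at h3
    exact Ideal.Quotient.eq_zero_iff_mem.1 h3)
  have h5 := hcount.trans (auxLen_anti (aux_pow_le_F (Ideal.span (Set.range a)) (d * c + D)))
  rw [auxLen_pow hd h, hE] at h5
  have h6 : Fintype.card ((Fin d → Fin (c + 1)) × ι) ≤ (d * c + D + d - 1).choose d * E := by exact_mod_cast h5
  rw [Fintype.card_prod, Fintype.card_fun, Fintype.card_fin, Fintype.card_fin] at h6
  have h7 : (d * c + D + d - 1).choose d ≤ ((d + 1) * (c + 1)) ^ d := by
    refine (Nat.choose_le_pow _ _).trans (Nat.pow_le_pow_left ?_ _)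
    have : (d + 1) * (c + 1) = d * c + d + c + 1 := by ring
    omega
  have h8 : (c + 1) ^ d * Fintype.card ι ≤ (c + 1) ^ d * (E * (d + 1) ^ d) := by
    calc _ ≤ _ := h6
      _ ≤ ((d + 1) * (c + 1)) ^ d * E := Nat.mul_le_mul_right _ h7
      _ = _ := by rw [mul_pow]; ring
  exact Nat.le_of_mul_le_mul_left h8 (pow_pos (Nat.succ_pos c) d)

theorem aux_homog_integral [CommRing R] [IsLocalRing R] [IsNoetherianRing R] {d : ℕ} (hd : 0 < d) (a : Fin d → R) (h : auxReg d a)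
    (hJ : Ideal.span (Set.range a) ≤ maximalIdeal R)
    (hm : maximalIdeal R ≤ auxFp (Ideal.span (Set.range a)) 0) (E : ℕ) (hE : auxLen (Ideal.span (Set.range a)) = E)
    (σ : ℝ) (x : R) (f : auxRB (Ideal.span (Set.range a))) (hf : (f : AddMonoidAlgebra R ℝ) = AddMonoidAlgebra.single σ x) :
    (auxPhi a hm).IsIntegralElem (Ideal.Quotient.mk (auxRP (Ideal.span (Set.range a))) f) := by
  classical
  have hxF : x ∈ auxF (Ideal.span (Set.range a)) σ := by
    have := f.2 σ
    rwa [hf, AddMonoidAlgebra.coeff_single, Finsupp.single_eq_same] at this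
  by_cases hx : x ∈ auxFp (Ideal.span (Set.range a)) σ
  · have : Ideal.Quotient.mk (auxRP (Ideal.span (Set.range a))) f = 0 := by
      rw [Ideal.Quotient.eq_zero_iff_mem]
      intro i
      rw [hf, AddMonoidAlgebra.coeff_single, Finsupp.single_apply]
      split_ifs with hi
      · rwa [← hi]
      · exact Ideal.zero_mem _
    rw [this]
    exact (auxPhi a hm).isIntegralElem_zero
  have hσ : 0 ≤ σ := by
    by_contra hc
    exact hx (by rw [auxFp_neg (Ideal.span (Set.range a)) (not_le.1 hc)]; trivial)
  have hpow : ∀ i : ℕ, ((f ^ i : auxRB (Ideal.span (Set.range a))) : AddMonoidAlgebra R ℝ) = AddMonoidAlgebra.single (i * σ) (x ^ i) := by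
    intro i
    rw [SubmonoidClass.coe_pow, hf, AddMonoidAlgebra.single_pow, nsmul_eq_mul]
  -- rationality
  have hrat : ∃ m n : ℕ, 0 < m ∧ (m : ℝ) * σ = n := by
    by_contra hcon
    push Not at hcon
    have hn := aux_rank hd a h hm E hE (fun i : Fin (E * (d + 1) ^ d + 1) => Ideal.Quotient.mk (auxRP (Ideal.span (Set.range a))) f ^ (i : ℕ)) (by
      intro c hc i0
      choose H hH using fun i => MvPolynomial.map_surjective (residue R) residue_surjective (c i)
      have h1 : ∑ i : Fin (E * (d + 1) ^ d + 1), auxPsi a (H i) * f ^ (i : ℕ) ∈ auxRP (Ideal.span (Set.range a)) := by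
        rw [← Ideal.Quotient.eq_zero_iff_mem, map_sum, ← hc]
        refine Finset.sum_congr rfl fun i _ => ?_
        rw [map_mul, map_pow, ← hH, auxPhi_map]
      have hcoef : ∀ (i : Fin (E * (d + 1) ^ d + 1)) (γ : ℝ),
          ((auxPsi a (H i) * f ^ (i : ℕ) : auxRB (Ideal.span (Set.range a))) : AddMonoidAlgebra R ℝ).coeff (γ + i * σ) =
          (auxPsi a (H i) : AddMonoidAlgebra R ℝ).coeff γ * x ^ (i : ℕ) := by
        intro i γ
        change ((auxPsi a (H i) : AddMonoidAlgebra R ℝ) * ((f ^ (i : ℕ) : auxRB (Ideal.span (Set.range a))) : AddMonoidAlgebra R ℝ)).coeff (γ + i * σ) = _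
        rw [hpow, AddMonoidAlgebra.coeff_mul_single_add]
      have h2 : auxPsi a (H i0) * f ^ (i0 : ℕ) ∈ auxRP (Ideal.span (Set.range a)) := by
        intro δ
        have e0 : δ = (δ - i0 * σ) + i0 * σ := by ring
        by_cases hj : ∃ j : ℕ, (j : ℝ) = δ - i0 * σ
        · obtain ⟨j, hj⟩ := hj
          have h3 := h1 δ
          rw [AddSubmonoidClass.coe_finset_sum, AddMonoidAlgebra.coeff_sum, Finsupp.finsetSum_apply,
            Finset.sum_eq_single i0] at h3
          · exact h3
          · intro i _ hi
            have e1 : δ = (δ - i * σ) + i * σ := by ring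
            rw [e1, hcoef, auxPsi_coeff_ne, zero_mul]
            intro j' hj'
            have hne : (i : ℕ) ≠ (i0 : ℕ) := fun h => hi (Fin.ext h)
            have e3 : ((i : ℕ) : ℝ) * σ - (i0 : ℕ) * σ = j - j' := by rw [hj, hj']; ring
            rcases lt_or_gt_of_ne hne with hlt | hlt
            · have hlt' : (((i0 : ℕ) - (i : ℕ) : ℕ) : ℝ) = (i0 : ℕ) - (i : ℕ) := Nat.cast_sub hlt.le
              have h4 : (j : ℝ) ≤ j' := by
                have : (((i0 : ℕ) - (i : ℕ) : ℕ) : ℝ) * σ ≥ 0 := by positivity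
                rw [hlt'] at this; linarith
              refine hcon ((i0 : ℕ) - i) (j' - j) (by omega) ?_
              rw [hlt', Nat.cast_sub (by exact_mod_cast h4)]
              linarith
            · have hlt' : (((i : ℕ) - (i0 : ℕ) : ℕ) : ℝ) = (i : ℕ) - (i0 : ℕ) := Nat.cast_sub hlt.le
              have h4 : (j' : ℝ) ≤ j := by
                have : (((i : ℕ) - (i0 : ℕ) : ℕ) : ℝ) * σ ≥ 0 := by positivity
                rw [hlt'] at this; linarith
              refine hcon ((i : ℕ) - i0) (j - j') (by omega) ?_
              rw [hlt', Nat.cast_sub (by exact_mod_cast h4)]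
              linarith
          · simp
        · push Not at hj
          rw [e0, hcoef, auxPsi_coeff_ne a _ hj, zero_mul]
          exact Ideal.zero_mem _
      by_contra hne
      have h3 : Ideal.Quotient.mk (auxRP (Ideal.span (Set.range a))) f ^ (i0 : ℕ) = 0 := by
        refine auxPhi_tf a h hJ hm (c i0) _ hne ?_
        rw [← hH, auxPhi_map, ← map_pow, ← map_mul, Ideal.Quotient.eq_zero_iff_mem]
        exact h2
      haveI := auxQ_reduced (Ideal.span (Set.range a))
      have h4 := eq_zero_of_pow_eq_zero h3
      rw [Ideal.Quotient.eq_zero_iff_mem] at h4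
      apply hx
      have h5 := h4 σ
      rwa [hf, AddMonoidAlgebra.coeff_single, Finsupp.single_eq_same] at h5)
    rw [Fintype.card_fin] at hn
    omega
  obtain ⟨m, n, hm0, hmn⟩ := hrat
  have h1 : x ^ m ∈ auxF (Ideal.span (Set.range a)) (n : ℝ) := by
    rw [← hmn]; exact auxF_pow (Ideal.span (Set.range a)) hxF m
  obtain ⟨N, hN, c, hc, hsum⟩ := aux_F_integral (Ideal.span (Set.range a)) n _ h1
  have hG : ∀ i, ∃ G : MvPolynomial (Fin d) R, i ∈ Finset.Icc 1 N → G.IsHomogeneous (n * i) ∧ MvPolynomial.eval a G = c i := by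
    intro i
    by_cases hi : i ∈ Finset.Icc 1 N
    · obtain ⟨G, h2, -, h3⟩ := aux_exists_form a ⊤ (n * i) (c i) (by
        rw [Ideal.top_mul, pow_mul]; exact hc i hi)
      exact ⟨G, fun _ => ⟨h2, h3⟩⟩
    · exact ⟨0, fun h => absurd h hi⟩
  choose G hG using hG
  have hrel : f ^ (m * N) + ∑ i ∈ Finset.Icc 1 N, auxPsi a (G i) * f ^ (m * (N - i)) = 0 := by
    apply Subtype.ext
    rw [Subalgebra.coe_add, AddSubmonoidClass.coe_finset_sum, hpow]
    have h2 : ∀ i ∈ Finset.Icc 1 N, ((auxPsi a (G i) * f ^ (m * (N - i)) : auxRB (Ideal.span (Set.range a))) : AddMonoidAlgebra R ℝ) =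
        AddMonoidAlgebra.single ((m * N : ℕ) * σ) (c i * (x ^ m) ^ (N - i)) := by
      intro i hi
      rw [Subalgebra.coe_mul, hpow, auxPsi_hom a _ _ (hG i hi).1, (hG i hi).2, AddMonoidAlgebra.single_mul_single, pow_mul]
      congr 1
      rw [Finset.mem_Icc] at hi
      push_cast [Nat.cast_sub hi.2]
      rw [← hmn]; ring
    rw [Finset.sum_congr rfl h2, show ∀ y : ℕ → R, ∑ i ∈ Finset.Icc 1 N, AddMonoidAlgebra.single ((m * N : ℕ) * σ) (y i) =
      AddMonoidAlgebra.single ((m * N : ℕ) * σ) (∑ i ∈ Finset.Icc 1 N, y i) from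
      fun y => (map_sum (AddMonoidAlgebra.singleAddHom _) _ _).symm]
    rw [← AddMonoidAlgebra.single_add, pow_mul, hsum, AddMonoidAlgebra.single_zero]
    rfl
  have hrel2 := congrArg (Ideal.Quotient.mk (auxRP (Ideal.span (Set.range a)))) hrel
  rw [map_add, map_sum, map_zero] at hrel2
  let p : Polynomial (MvPolynomial (Fin d) (ResidueField R)) := Polynomial.X ^ (m * N) +
    ∑ i ∈ Finset.Icc 1 N, Polynomial.C (MvPolynomial.map (residue R) (G i)) * Polynomial.X ^ (m * (N - i))
  refine ⟨p, ?_, ?_⟩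
  · refine Polynomial.monic_X_pow_add ?_
    rw [Polynomial.degree_lt_iff_coeff_zero]
    intro l hl
    rw [Polynomial.finset_sum_coeff]
    refine Finset.sum_eq_zero fun i hi => ?_
    rw [Finset.mem_Icc] at hi
    have : m * (N - i) < m * N := Nat.mul_lt_mul_of_pos_left (by omega) hm0
    rw [Polynomial.coeff_C_mul_X_pow, if_neg (by omega)]
  · rw [← hrel2, Polynomial.eval₂_add, Polynomial.eval₂_finset_sum, Polynomial.eval₂_X_pow, map_pow]
    congr 1
    refine Finset.sum_congr rfl fun i _ => ?_
    rw [map_mul, map_pow, ← auxPhi_map a hm (G i)]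
    rw [Polynomial.C_mul_X_pow_eq_monomial, Polynomial.eval₂_monomial]



theorem aux_finite_hom {k : Type*} [Field k] {d : ℕ} {B : Type*} [CommRing B] [IsReduced B]
    (φ : MvPolynomial (Fin d) k →+* B)
    (htf : ∀ s b, s ≠ 0 → φ s * b = 0 → b = 0) (hintg : ∀ b, φ.IsIntegralElem b) (n : ℕ)
    (hrank : ∀ s : Finset B, (∀ c : s → MvPolynomial (Fin d) k, ∑ i, φ (c i) * (i : B) = 0 → ∀ i, c i = 0) → s.card ≤ n) :
    ∃ (m : ℕ) (g : Fin m → B), ∀ b, ∃ c : Fin m → MvPolynomial (Fin d) k, ∑ i, φ (c i) * g i = b := by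
  letI : Algebra (MvPolynomial (Fin d) k) B := φ.toAlgebra
  have hsm : ∀ (s : MvPolynomial (Fin d) k) (b : B), s • b = φ s * b := fun s b => Algebra.smul_def s b
  haveI : Module.Finite (MvPolynomial (Fin d) k) B := by
    refine aux_finite_abs ?_ ?_ n ?_
    · intro s b hs hb
      exact htf s b hs (by rw [← hsm]; exact hb)
    · intro b; exact hintg b
    · intro s hs
      refine hrank s fun c hc => ?_
      refine Fintype.linearIndependent_iff.1 hs c ?_
      rw [← hc]
      exact Finset.sum_congr rfl fun i _ => hsm _ _
  obtain ⟨m, g, hg⟩ := Module.Finite.exists_fin (R := MvPolynomial (Fin d) k) (M := B)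
  refine ⟨m, g, fun b => ?_⟩
  have : b ∈ Submodule.span (MvPolynomial (Fin d) k) (Set.range g) := by rw [hg]; trivial
  obtain ⟨c, hc⟩ := (Submodule.mem_span_range_iff_exists_fun _).1 this
  refine ⟨c, ?_⟩
  rw [← hc]
  exact Finset.sum_congr rfl fun i _ => (hsm _ _).symm

theorem aux_integral_all {k : Type*} [CommRing k] {B : Type*} [CommRing B] (φ : k →+* B)
    {ι : Type*} (s : Finset ι) (g : ι → B) (hg : ∀ i ∈ s, φ.IsIntegralElem (g i)) :
    φ.IsIntegralElem (∑ i ∈ s, g i) := by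
  letI : Algebra k B := φ.toAlgebra
  exact IsIntegral.sum (R := k) g hg

theorem aux_M6 [CommRing R] [IsLocalRing R] [IsNoetherianRing R] {d : ℕ} (hd : 0 < d) (a : Fin d → R) (h : auxReg d a)
    (hJ : Ideal.span (Set.range a) ≤ maximalIdeal R)
    (hm : maximalIdeal R ≤ auxFp (Ideal.span (Set.range a)) 0) (E : ℕ) (hE : auxLen (Ideal.span (Set.range a)) = E) :
    ∃ (m : ℕ) (g : Fin m → auxRB (Ideal.span (Set.range a))), ∀ f : auxRB (Ideal.span (Set.range a)),
      ∃ H : Fin m → MvPolynomial (Fin d) R, f - ∑ i, auxPsi a (H i) * g i ∈ auxRP (Ideal.span (Set.range a)) := by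
  classical
  haveI := auxQ_reduced (Ideal.span (Set.range a))
  have hintg : ∀ b, (auxPhi a hm).IsIntegralElem b := by
    intro b
    obtain ⟨f, rfl⟩ := Ideal.Quotient.mk_surjective b
    have hmem : ∀ i, AddMonoidAlgebra.single i ((f : AddMonoidAlgebra R ℝ).coeff i) ∈ auxRB (Ideal.span (Set.range a)) := by
      intro i
      rw [mem_auxRB]
      intro j
      rw [AddMonoidAlgebra.coeff_single, Finsupp.single_apply]
      split_ifs with hij
      · rw [← hij]; exact mem_auxRB.1 f.2 i
      · exact Ideal.zero_mem _
    have hsum : f = ∑ i ∈ (f : AddMonoidAlgebra R ℝ).coeff.support,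
        (⟨AddMonoidAlgebra.single i ((f : AddMonoidAlgebra R ℝ).coeff i), hmem i⟩ : auxRB (Ideal.span (Set.range a))) := by
      apply Subtype.ext
      rw [AddSubmonoidClass.coe_finset_sum]
      ext j
      rw [AddMonoidAlgebra.coeff_sum, Finsupp.finsetSum_apply]
      simp only [AddMonoidAlgebra.coeff_single, Finsupp.single_apply]
      rw [Finset.sum_ite_eq']
      split_ifs with hj
      · rfl
      · exact Finsupp.notMem_support_iff.1 hj
    rw [hsum, map_sum]
    refine aux_integral_all (k := MvPolynomial (Fin d) (ResidueField R)) (B := auxRB (Ideal.span (Set.range a)) ⧸ auxRP (Ideal.span (Set.range a))) (auxPhi a hm) _ _ fun i _ => ?_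
    exact aux_homog_integral hd a h hJ hm E hE i _ _ rfl
  obtain ⟨m, g, hg⟩ := aux_finite_hom (k := ResidueField R) (B := auxRB (Ideal.span (Set.range a)) ⧸ auxRP (Ideal.span (Set.range a))) (auxPhi a hm) (auxPhi_tf a h hJ hm) hintg (E * (d + 1) ^ d) (by
    intro s hs
    have := aux_rank hd a h hm E hE (fun i : s => (i : auxRB (Ideal.span (Set.range a)) ⧸ auxRP (Ideal.span (Set.range a)))) hs
    rwa [Fintype.card_coe] at this)
  choose f hf using fun i => Ideal.Quotient.mk_surjective (g i)
  refine ⟨m, f, fun x => ?_⟩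
  obtain ⟨c, hc⟩ := hg (Ideal.Quotient.mk _ x)
  choose H hH using fun i => MvPolynomial.map_surjective (residue R) residue_surjective (c i)
  refine ⟨H, ?_⟩
  rw [← Ideal.Quotient.eq_zero_iff_mem, map_sub, map_sum, ← hc, sub_eq_zero]
  refine Finset.sum_congr rfl fun i _ => ?_
  rw [map_mul, ← auxPhi_map a hm, hH, hf]



theorem aux_M7a [CommRing R] [IsLocalRing R] [IsNoetherianRing R] {d : ℕ} (hd : 0 < d) (a : Fin d → R) (h : auxReg d a)
    (hJ : Ideal.span (Set.range a) ≤ maximalIdeal R)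
    (hm : maximalIdeal R ≤ auxFp (Ideal.span (Set.range a)) 0) (E : ℕ) (hE : auxLen (Ideal.span (Set.range a)) = E) :
    ∃ k : ℕ, ∀ α : ℝ, auxF (Ideal.span (Set.range a)) α ≤
      Ideal.span (Set.range a) ^ (⌈α - k⌉₊) ⊔ auxFp (Ideal.span (Set.range a)) α := by
  classical
  obtain ⟨m, g, hg⟩ := aux_M6 hd a h hJ hm E hE
  obtain ⟨k, hk⟩ : ∃ k : ℕ, ∀ (i : Fin m) (j : ℝ), (g i : AddMonoidAlgebra R ℝ).coeff j ≠ 0 → j ≤ k := by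
    have h1 : ∃ b : ℝ, ∀ j ∈ Finset.univ.biUnion (fun i : Fin m => (g i : AddMonoidAlgebra R ℝ).coeff.support), j ≤ b :=
      (Finset.bddAbove _)
    obtain ⟨b, hb⟩ := h1
    obtain ⟨k, hk⟩ := exists_nat_ge b
    refine ⟨k, fun i j hij => (hb j ?_).trans hk⟩
    rw [Finset.mem_biUnion]
    exact ⟨i, Finset.mem_univ i, Finsupp.mem_support_iff.2 hij⟩
  refine ⟨k, fun α x hx => ?_⟩
  obtain ⟨H, hH⟩ := hg ⟨AddMonoidAlgebra.single α x, by
    rw [mem_auxRB]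
    intro j
    rw [AddMonoidAlgebra.coeff_single, Finsupp.single_apply]
    split_ifs with hij
    · rw [← hij]; exact hx
    · exact Ideal.zero_mem _⟩
  have h2 := hH α
  have h3 : (((∑ i, auxPsi a (H i) * g i : auxRB (Ideal.span (Set.range a)))) : AddMonoidAlgebra R ℝ).coeff α ∈
      Ideal.span (Set.range a) ^ (⌈α - k⌉₊) := by
    rw [AddSubmonoidClass.coe_finset_sum, AddMonoidAlgebra.coeff_sum, Finsupp.finsetSum_apply]
    refine Ideal.sum_mem _ fun i _ => ?_
    refine aux_coeff_mul_mem _ (auxPsi a (H i) : AddMonoidAlgebra R ℝ) (g i : AddMonoidAlgebra R ℝ) α ?_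
    intro p q hpq
    by_cases hq : (g i : AddMonoidAlgebra R ℝ).coeff q = 0
    · rw [hq, mul_zero]; exact Ideal.zero_mem _
    have hqk := hk i q hq
    by_cases hp : ∃ j : ℕ, (j : ℝ) = p
    · obtain ⟨j, rfl⟩ := hp
      refine Ideal.mul_mem_right _ _ ?_
      rw [auxPsi_coeff]
      have h4 := aux_eval_mem a ⊤ j _ (MvPolynomial.homogeneousComponent_isHomogeneous j (H i)) (fun _ => trivial)
      rw [Ideal.top_mul] at h4
      refine Ideal.pow_le_pow_right ?_ h4
      rw [Nat.ceil_le]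
      linarith
    · push Not at hp
      rw [auxPsi_coeff_ne a p hp, zero_mul]; exact Ideal.zero_mem _
  have h5 : x = (((∑ i, auxPsi a (H i) * g i : auxRB (Ideal.span (Set.range a)))) : AddMonoidAlgebra R ℝ).coeff α +
      (x - (((∑ i, auxPsi a (H i) * g i : auxRB (Ideal.span (Set.range a)))) : AddMonoidAlgebra R ℝ).coeff α) := by ring
  rw [h5]
  refine Submodule.add_mem_sup h3 ?_
  rw [AddSubgroupClass.coe_sub, AddMonoidAlgebra.coeff_sub, Finsupp.sub_apply, AddMonoidAlgebra.coeff_single,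
    Finsupp.single_eq_same] at h2
  exact h2

theorem auxFp_eq_Fo [CommRing R] [IsNoetherianRing R] (J : Ideal R) (α : ℝ) : ∃ β, α < β ∧ auxFp J α ≤ auxF J β := by
  classical
  obtain ⟨s, hs⟩ := (isNoetherianRing_iff_ideal_fg R).1 inferInstance (auxFp J α)
  have h1 : ∀ t : Finset R, (∀ x ∈ t, x ∈ auxFp J α) → ∃ β, α < β ∧ ∀ x ∈ t, x ∈ auxFo J β := by
    intro t
    induction t using Finset.induction_on with
    | empty => exact fun _ => ⟨α + 1, by linarith, by simp⟩
    | insert y t _ ih =>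
      intro ht
      obtain ⟨β, h1, h2⟩ := ih (fun x hx => ht x (Finset.mem_insert_of_mem hx))
      obtain ⟨γ, h3, h4⟩ := ht y (Finset.mem_insert_self _ _)
      refine ⟨min β γ, lt_min h1 h3, fun x hx => ?_⟩
      rcases Finset.mem_insert.1 hx with rfl | hx
      · exact auxFo_anti J (min_le_right _ _) h4
      · exact auxFo_anti J (min_le_left _ _) (h2 x hx)
  obtain ⟨β, h2, h3⟩ := h1 s (fun x hx => by rw [← hs]; exact Ideal.subset_span hx)
  refine ⟨β, h2, ?_⟩
  rw [← hs]
  exact Ideal.span_le.2 fun x hx => auxFo_le_F J β (h3 x hx)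

theorem auxF_left [CommRing R] (J : Ideal R) (hfin : ∀ M, auxLen (J ^ M) ≠ ⊤) (σ : ℝ) :
    ∃ α, α < σ ∧ auxF J α ≤ auxF J σ := by
  obtain ⟨M, hM⟩ := exists_nat_ge σ
  have hle : ∀ α, α < σ → auxLen (auxF J α) ≤ auxLen (J ^ M) := fun α hα =>
    auxLen_anti ((aux_pow_le_F J M).trans (auxF_anti J (hα.le.trans hM)))
  have h1 : sSup (Set.image (fun α => auxLen (auxF J α)) {α | α < σ}) ∈ (Set.image (fun α => auxLen (auxF J α)) {α | α < σ}) := by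
    haveI : Nonempty (Set.image (fun α => auxLen (auxF J α)) {α | α < σ}) := ⟨_, σ - 1, by simp, rfl⟩
    refine ENat.sSup_mem_of_nonempty_of_lt_top ?_
    · refine lt_of_le_of_lt (sSup_le ?_) (lt_top_iff_ne_top.2 (hfin M))
      rintro _ ⟨α, hα, rfl⟩
      exact hle α hα
  obtain ⟨α, hα, he⟩ := h1
  refine ⟨α, hα, fun x hx => ?_⟩
  rw [mem_auxF]
  intro γ hγ
  by_contra hcon
  obtain ⟨γ', h2, h3⟩ := exists_between (max_lt hα hγ)
  have h4 := auxLen_strict (auxF_anti J ((le_max_left α γ).trans h2.le)) x hx (fun hx' => hcon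
    ((mem_auxF.1 hx') γ ((le_max_right _ _).trans_lt h2)))
  have h5 : auxLen (auxF J γ') ≤ auxLen (auxF J α) := by
    change _ ≤ (fun α => auxLen (auxF J α)) α
    rw [he]
    exact le_sSup ⟨γ', h3, rfl⟩
  have h6 : auxLen (auxF J α) ≠ ⊤ := ne_top_of_le_ne_top (hfin M) (hle α hα)
  exact absurd ((ENat.add_one_le_iff h6).1 (h4.trans h5)) (lt_irrefl _)

theorem aux_M7 [CommRing R] [IsLocalRing R] [IsNoetherianRing R]
    (hAU : IsReduced (AdicCompletion (maximalIdeal R) R)) {d : ℕ} (hd : 0 < d) (a : Fin d → R) (h : auxReg d a)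
    (hJ : Ideal.span (Set.range a) ≤ maximalIdeal R) (c : ℕ) (hc : maximalIdeal R ^ c ≤ Ideal.span (Set.range a))
    (E : ℕ) (hE : auxLen (Ideal.span (Set.range a)) = E) :
    ∃ k : ℕ, ∀ n : ℕ, auxF (Ideal.span (Set.range a)) n ≤ Ideal.span (Set.range a) ^ (n - k) := by
  have hm := aux_max_le_Fp _ c hc
  obtain ⟨k, hk⟩ := aux_M7a hd a h hJ hm E hE
  have hfin : ∀ M, auxLen (Ideal.span (Set.range a) ^ M) ≠ ⊤ := by
    intro M
    rw [auxLen_pow hd h, hE, ← Nat.cast_mul]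
    exact ENat.coe_ne_top _
  generalize Ideal.span (Set.range a) = J at *
  refine ⟨k, fun n => ?_⟩
  let T : Set ℝ := {α | n ≤ α ∧ auxF J n ≤ J ^ (n - k) ⊔ auxF J α}
  have hnT : (n : ℝ) ∈ T := ⟨le_rfl, le_sup_right⟩
  have hstep : ∀ α ∈ T, ∃ β ∈ T, α < β := by
    rintro α ⟨h1, h2⟩
    obtain ⟨β, h3, h4⟩ := auxFp_eq_Fo J α
    refine ⟨β, ⟨h1.trans h3.le, h2.trans (sup_le le_sup_left ((hk α).trans (sup_le ?_ ?_)))⟩, h3⟩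
    · refine le_trans (Ideal.pow_le_pow_right ?_) le_sup_left
      rw [Nat.sub_le_iff_le_add, ← Nat.cast_le (α := ℝ)]
      have := Nat.le_ceil (α - k)
      push_cast; linarith
    · exact h4.trans le_sup_right
  have hunb : ¬ BddAbove T := by
    intro hb
    have hlub := isLUB_csSup ⟨_, hnT⟩ hb
    have hσ : sSup T ∈ T := by
      obtain ⟨α, h1, h2⟩ := auxF_left J hfin (sSup T)
      obtain ⟨β, h3, h4⟩ := exists_lt_of_lt_csSup ⟨_, hnT⟩ h1
      exact ⟨hlub.1 hnT, h3.2.trans (sup_le_sup_left ((auxF_anti J h4.le).trans h2) _)⟩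
    obtain ⟨β, h1, h2⟩ := hstep _ hσ
    exact absurd (hlub.1 h1) (not_le.2 h2)
  obtain ⟨N, hN⟩ := aux_M8 hAU J hJ (c * (n - k))
  rw [not_bddAbove_iff] at hunb
  obtain ⟨α, ⟨-, h1⟩, h2⟩ := hunb N
  refine h1.trans (sup_le le_rfl ?_)
  refine le_trans (fun x hx => mem_auxF.1 hx N h2) (hN.trans ?_)
  rw [pow_mul]
  exact Ideal.pow_right_mono hc _



theorem aux_poly (d : ℕ) (c : ℕ → ℤ) (N : ℕ)
    (h : ∀ n ≥ N, ∑ i ∈ Finset.range (d + 1), c i * ((n + d - i).choose (d - i) : ℕ) ≤ 0) : c 0 ≤ 0 := by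
  rcases d with _ | d
  · have := h N le_rfl
    simpa using this
  by_contra hc
  push Not at hc
  let K : ℤ := ∑ i ∈ Finset.range (d + 1), |c (i + 1)|
  have hK : 0 ≤ K := Finset.sum_nonneg fun i _ => abs_nonneg _
  have key : ∀ n ≥ N, ((n + (d + 1)).choose (d + 1) : ℤ) ≤ K * ((n + d).choose d : ℕ) := by
    intro n hn
    have h1 := h n hn
    rw [Finset.sum_range_succ'] at h1
    have h2 : -(K * ((n + d).choose d : ℕ)) ≤ ∑ i ∈ Finset.range (d + 1), c (i + 1) * ((n + (d + 1) - (i + 1)).choose (d + 1 - (i + 1)) : ℕ) := by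
      rw [Finset.sum_mul, ← Finset.sum_neg_distrib]
      refine Finset.sum_le_sum fun i hi => ?_
      rw [Finset.mem_range] at hi
      have h3 : (n + (d + 1) - (i + 1)).choose (d + 1 - (i + 1)) ≤ (n + d).choose d := by
        have e1 : n + (d + 1) - (i + 1) = n + (d - i) := by omega
        have e2 : d + 1 - (i + 1) = d - i := by omega
        rw [e1, e2, Nat.choose_symm_add.symm, Nat.choose_symm_add.symm]
        exact Nat.choose_le_choose n (by omega)
      have h4 := neg_abs_le (c (i + 1))
      have h5 : ((n + (d + 1) - (i + 1)).choose (d + 1 - (i + 1)) : ℤ) ≤ ((n + d).choose d : ℕ) := by exact_mod_cast h3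
      have h6 : (0 : ℤ) ≤ ((n + (d + 1) - (i + 1)).choose (d + 1 - (i + 1)) : ℕ) := by positivity
      nlinarith [abs_nonneg (c (i + 1))]
    simp only [Nat.sub_zero] at h1
    have h7 : (0 : ℤ) ≤ ((n + (d + 1)).choose (d + 1) : ℕ) := by positivity
    nlinarith
  obtain ⟨n, hn⟩ : ∃ n : ℕ, N ≤ n ∧ K * (d + 1) < n + d + 1 := by
    refine ⟨N + (K * (d + 1)).toNat, by omega, ?_⟩
    have := Int.self_le_toNat (K * (d + 1))
    push_cast; omega
  have h1 := key n hn.1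
  have h2 : (n + d + 1) * (n + d).choose d = (n + (d + 1)).choose (d + 1) * (d + 1) := Nat.add_one_mul_choose_eq (n + d) d
  have h3 : (0 : ℤ) < ((n + d).choose d : ℕ) := by
    exact_mod_cast Nat.choose_pos (by omega)
  have h2' : ((n : ℤ) + d + 1) * ((n + d).choose d : ℕ) = ((n + (d + 1)).choose (d + 1) : ℕ) * (d + 1) := by exact_mod_cast h2
  have h4 : ((n : ℤ) + d + 1) * ((n + d).choose d : ℕ) ≤ (K * (d + 1)) * ((n + d).choose d : ℕ) := by
    rw [h2']
    nlinarith
  exact absurd (le_of_mul_le_mul_right h4 h3) (not_le.2 hn.2)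

theorem aux_choose_shift (d m k : ℕ) :
    (m + k + (d + 1)).choose (d + 1) ≤ (m + (d + 1)).choose (d + 1) + k * (m + k + d).choose d := by
  induction k with
  | zero => simp
  | succ k ih =>
    have e1 : (m + (k + 1) + (d + 1)).choose (d + 1) = (m + (k + 1) + d).choose d + (m + k + (d + 1)).choose (d + 1) := by
      have : m + (k + 1) + (d + 1) = (m + (k + 1) + d) + 1 := by omega
      rw [this, Nat.choose_succ_succ]
      congr 2
      omega
    have e2 : (m + k + d).choose d ≤ (m + (k + 1) + d).choose d := Nat.choose_le_choose d (by omega)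
    rw [e1]
    nlinarith

theorem aux_compare (d : ℕ) (hd : 0 < d) (L : ℕ → ℕ) (e : ℕ → ℤ) (E k : ℕ)
    (hup : ∀ n, L n ≤ E * (n + d - 1).choose d + L 0 * (n + d - 1).choose (d - 1))
    (hlo : ∀ m, E * (m + d).choose d ≤ L (m + k))
    (hP : ∃ N : ℕ, ∀ n ≥ N, (L n : ℤ) =
      ∑ i ∈ Finset.range (d + 1), (-1 : ℤ) ^ i * e i * ((n + d - i).choose (d - i))) :
    e 1 ≥ e 0 - L 0 := by
  obtain ⟨d, rfl⟩ : ∃ d', d = d' + 1 := ⟨d - 1, by omega⟩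
  obtain ⟨N, hN⟩ := hP
  have hsum : ∀ (A B : ℤ) (n : ℕ), ∑ i ∈ Finset.range (d + 1 + 1), (if i = 0 then A else if i = 1 then B else 0) * ((n + (d + 1) - i).choose (d + 1 - i) : ℤ)
      = A * ((n + (d + 1)).choose (d + 1) : ℕ) + B * ((n + d).choose d : ℕ) := by
    intro A B n
    rw [Finset.sum_range_succ', Finset.sum_range_succ', Finset.sum_eq_zero]
    · simp; ring_nf
    · intro i _
      simp
  have hup' : ∀ n, (L n : ℤ) ≤ E * ((n + (d + 1)).choose (d + 1) : ℕ) + (L 0 - E) * ((n + d).choose d : ℕ) := by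
    intro n
    have h1 := hup n
    have e1 : n + (d + 1) - 1 = n + d := by omega
    rw [e1, Nat.add_sub_cancel] at h1
    have h2 : (n + (d + 1)).choose (d + 1) = (n + d).choose d + (n + d).choose (d + 1) := Nat.choose_succ_succ (n + d) d
    rw [h2]
    have h1' : (L n : ℤ) ≤ E * ((n + d).choose (d + 1) : ℕ) + L 0 * ((n + d).choose d : ℕ) := by exact_mod_cast h1
    push_cast
    linarith
  have hlo' : ∀ n ≥ k, (E : ℤ) * ((n + (d + 1)).choose (d + 1) : ℕ) - E * k * ((n + d).choose d : ℕ) ≤ L n := by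
    intro n hn
    obtain ⟨m, rfl⟩ : ∃ m, n = m + k := ⟨n - k, by omega⟩
    have h1 := hlo m
    have h2 := aux_choose_shift d m k
    have h1' : (E : ℤ) * ((m + (d + 1)).choose (d + 1) : ℕ) ≤ L (m + k) := by exact_mod_cast h1
    have h2' : ((m + k + (d + 1)).choose (d + 1) : ℤ) ≤ ((m + (d + 1)).choose (d + 1) : ℕ) + k * ((m + k + d).choose d : ℕ) := by exact_mod_cast h2
    nlinarith
  have hA : e 0 - E ≤ 0 := by
    have := aux_poly (d + 1) (fun i => (-1) ^ i * e i - (if i = 0 then (E : ℤ) else if i = 1 then (L 0 - E : ℤ) else 0)) N (by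
      intro n hn
      simp only [sub_mul]
      rw [Finset.sum_sub_distrib, hsum, ← hN n hn]
      linarith [hup' n])
    simpa using this
  have hB : (E : ℤ) - e 0 ≤ 0 := by
    have := aux_poly (d + 1) (fun i => (if i = 0 then (E : ℤ) else if i = 1 then (- (E * k) : ℤ) else 0) - (-1) ^ i * e i) (max N k) (by
      intro n hn
      simp only [sub_mul]
      rw [Finset.sum_sub_distrib, hsum, ← hN n ((le_max_left _ _).trans hn)]
      linarith [hlo' n ((le_max_right _ _).trans hn)])
    simpa using this
  have hE : e 0 = E := by linarith
  have hC := aux_poly d (fun i => (-1) ^ (i + 1) * e (i + 1) - (if i = 0 then (L 0 - E : ℤ) else 0)) N (by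
      intro n hn
      have h1 := hup' n
      rw [hN n hn, Finset.sum_range_succ'] at h1
      simp only [sub_mul]
      rw [Finset.sum_sub_distrib]
      have h2 : ∑ i ∈ Finset.range (d + 1), (if i = 0 then (L 0 - E : ℤ) else 0) * ((n + d - i).choose (d - i) : ℤ) = (L 0 - E) * ((n + d).choose d : ℕ) := by
        rw [Finset.sum_range_succ', Finset.sum_eq_zero]
        · simp
        · intro i _; simp
      rw [h2]
      simp only [Nat.add_sub_add_right, ← Nat.add_assoc, pow_zero, Nat.sub_zero, one_mul, hE] at h1 ⊢
      linarith)
  simp at hC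
  rw [hE]
  linarith

theorem aux_mul_intCl [CommRing R] (I J : Ideal R) (hJI : J ≤ I) (n : ℕ) :
    J ^ n * intCl I ≤ intCl (I ^ (n + 1)) := by
  refine Ideal.mul_le.2 fun y hy z hz => ?_
  induction hz using Submodule.span_induction with
  | mem x hx =>
    refine Ideal.subset_span ?_
    obtain ⟨r, hr, a, ha, he⟩ := hx
    refine ⟨r, hr, fun i => y ^ i * a i, fun i hi => ?_, ?_⟩
    · rw [pow_succ, mul_pow]
      exact Ideal.mul_mem_mul (Ideal.pow_mem_pow (Ideal.pow_right_mono hJI n hy) i) (ha i hi)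
    · have : (y * x) ^ r + ∑ i ∈ Finset.Icc 1 r, y ^ i * a i * (y * x) ^ (r - i) =
        y ^ r * (x ^ r + ∑ i ∈ Finset.Icc 1 r, a i * x ^ (r - i)) := by
        rw [mul_add, mul_pow, Finset.mul_sum]
        congr 1
        refine Finset.sum_congr rfl fun i hi => ?_
        rw [Finset.mem_Icc] at hi
        rw [mul_pow]
        have e1 : y ^ r = y ^ i * y ^ (r - i) := by rw [← pow_add]; congr 1; omega
        rw [e1]; ring
      rw [this, he, mul_zero]
  | zero => rw [mul_zero]; exact Ideal.zero_mem _
  | add x z _ _ hx hz => rw [mul_add]; exact Ideal.add_mem _ hx hz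
  | smul r x _ hx =>
    rw [smul_eq_mul, mul_left_comm]
    exact Ideal.mul_mem_left _ _ hx

theorem aux_final [CommRing R] [IsLocalRing R] [IsNoetherianRing R]
    (hAU : IsReduced (AdicCompletion (maximalIdeal R) R)) {d : ℕ} (hd : 0 < d) (I : Ideal R) (hI : I ≤ maximalIdeal R) (a : Fin d → R) (h : auxReg d a)
    (hJI : Ideal.span (Set.range a) ≤ I) (c : ℕ) (hc : maximalIdeal R ^ c ≤ Ideal.span (Set.range a))
    (c' : ℕ) (hIJ : ∀ m, I ^ (m + c') ≤ Ideal.span (Set.range a) ^ m)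
    (L : ℕ → ℕ) (e : ℕ → ℤ) (hHilb : NormalHilbertData d I L e) : e 1 ≥ e 0 - L 0 := by
  obtain ⟨hL, hP⟩ := hHilb
  have hL' : ∀ n, auxLen (intCl (I ^ (n + 1))) = L n := by
    intro n
    have := hL n
    rw [mlen, ← Module.coe_length] at this
    exact_mod_cast this
  have hup0 : ∀ n, (L n : ℕ∞) ≤ ((n + d - 1).choose d : ℕ) * auxLen (Ideal.span (Set.range a)) + ((n + d - 1).choose (d - 1) : ℕ) * L 0 := by
    intro n
    rw [← hL', ← auxLen_pow hd h]
    refine (auxLen_anti (aux_mul_intCl I _ hJI n)).trans ?_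
    have h1 := auxLen_mul_le (auxMon a n) (intCl I)
    rw [auxMon_span] at h1
    refine h1.trans_eq ?_
    have h2 := hL' 0
    rw [zero_add, pow_one] at h2
    rw [h2, aux_card_mon d hd n]
  have hEfin : auxLen (Ideal.span (Set.range a)) ≠ ⊤ := by
    obtain ⟨k, hk⟩ : ∃ k, intCl (I ^ (k + 1)) ≤ Ideal.span (Set.range a) := by
      obtain ⟨N, hN⟩ := aux_M8 hAU _ (hJI.trans hI) c
      exact ⟨N, (aux_intCl_le_Fo I _ c' hIJ (N + 1)).trans ((auxFo_anti _ (by push_cast; linarith)).trans (hN.trans hc))⟩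
    refine ne_top_of_le_ne_top ?_ (auxLen_anti hk)
    rw [hL']; exact ENat.coe_ne_top _
  obtain ⟨E, hE⟩ := ENat.ne_top_iff_exists.1 hEfin
  obtain ⟨k, hk⟩ := aux_M7 hAU hd a h (hJI.trans hI) c hc E hE.symm
  refine aux_compare d hd L e E k ?_ ?_ hP
  · intro n
    have h1 := hup0 n
    rw [← hE] at h1
    have h2 : L n ≤ (n + d - 1).choose d * E + (n + d - 1).choose (d - 1) * L 0 := by exact_mod_cast h1
    linarith
  · intro m
    have h1 : intCl (I ^ (m + k + 1)) ≤ Ideal.span (Set.range a) ^ (m + 1) := by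
      refine (aux_intCl_le_Fo I _ c' hIJ (m + k + 1)).trans ((auxFo_le_F _ _).trans ((hk (m + k + 1)).trans ?_))
      exact Ideal.pow_le_pow_right (by omega)
    have h2 := auxLen_anti h1
    rw [auxLen_pow hd h, hL', ← hE] at h2
    have e1 : m + 1 + d - 1 = m + d := by omega
    rw [e1] at h2
    have h3 : (m + d).choose d * E ≤ L (m + k) := by exact_mod_cast h2
    linarith



theorem aux_ass [CommRing R] [IsNoetherianRing R] (Q : Ideal R) : ∃ S : Finset (Ideal R),
    (∀ p, p ∈ S ↔ p.IsPrime ∧ ∃ h, ∀ s, s ∈ p ↔ s * h ∈ Q) ∧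
    ∀ x h, x * h ∈ Q → h ∉ Q → ∃ p ∈ S, x ∈ p := by
  classical
  have key : ∀ p : Ideal R, p ∈ associatedPrimes R (R ⧸ Q) ↔ p.IsPrime ∧ ∃ h, ∀ s, s ∈ p ↔ s * h ∈ Q := by
    intro p
    rw [AssociatedPrimes.mem_iff, isAssociatedPrime_iff]
    refine and_congr_right fun _ => ?_
    have h0 : ∀ s h : R, s ∈ (⊥ : Submodule R (R ⧸ Q)).colon {Ideal.Quotient.mk Q h} ↔ s * h ∈ Q := by
      intro s h
      rw [Submodule.mem_colon_singleton, Submodule.mem_bot, ← Ideal.Quotient.eq_zero_iff_mem]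
      rfl
    constructor
    · rintro ⟨x, rfl⟩
      obtain ⟨h, rfl⟩ := Ideal.Quotient.mk_surjective x
      exact ⟨h, fun s => h0 s h⟩
    · rintro ⟨h, hh⟩
      refine ⟨Ideal.Quotient.mk Q h, ?_⟩
      ext s
      rw [hh, h0]
  refine ⟨(associatedPrimes.finite R (R ⧸ Q)).toFinset, fun p => ?_, fun x h hx hh => ?_⟩
  · rw [Set.Finite.mem_toFinset, key]
  · obtain ⟨P, h1, h2⟩ := exists_le_isAssociatedPrime_of_isNoetherianRing R (Ideal.Quotient.mk Q h)
      (fun h' => hh (Ideal.Quotient.eq_zero_iff_mem.1 h'))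
    refine ⟨P, (Set.Finite.mem_toFinset _).2 h1, h2 ?_⟩
    rw [Submodule.mem_colon_singleton, Submodule.mem_bot]
    exact Ideal.Quotient.eq_zero_iff_mem.2 hx

theorem aux_avoid [CommRing R] [IsLocalRing R] [Infinite (ResidueField R)] (I : Ideal R)
    (S : Finset (Ideal R)) (hS : ∀ N ∈ S, ¬ I ≤ N) : ∃ x ∈ I, ∀ N ∈ S, x ∉ N := by
  classical
  induction S using Finset.induction_on with
  | empty => exact ⟨0, I.zero_mem, by simp⟩
  | insert M S _ ih =>
    obtain ⟨x, hx, hxS⟩ := ih (fun N hN => hS N (Finset.mem_insert_of_mem hN))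
    by_cases hxM : x ∈ M
    swap
    · refine ⟨x, hx, fun N hN => ?_⟩
      rcases Finset.mem_insert.1 hN with rfl | hN
      · exact hxM
      · exact hxS N hN
    obtain ⟨y, hy, hyM⟩ := Set.not_subset.1 (hS M (Finset.mem_insert_self _ _))
    have hbad : Set.Finite (⋃ N ∈ S, {κ : ResidueField R | ∃ u, residue R u = κ ∧ y + u * x ∈ N}) := by
      refine Set.Finite.biUnion S.finite_toSet fun N hN => Set.Subsingleton.finite ?_
      rintro _ ⟨u, rfl, hu⟩ _ ⟨v, rfl, hv⟩
      by_contra hne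
      have h1 : (u - v) * x ∈ N := by
        have := N.sub_mem hu hv
        convert this using 1; ring
      have h2 : IsUnit (u - v) := by
        rw [← residue_ne_zero_iff_isUnit, map_sub, sub_ne_zero]
        exact hne
      exact hxS N hN ((Ideal.unit_mul_mem_iff_mem N h2).1 h1)
    obtain ⟨κ, hκ⟩ := hbad.exists_notMem
    obtain ⟨u, rfl⟩ := residue_surjective κ
    refine ⟨y + u * x, I.add_mem hy (I.mul_mem_left _ hx), fun N hN => ?_⟩
    rcases Finset.mem_insert.1 hN with rfl | hN
    · intro h
      exact hyM ((Ideal.add_mem_iff_left _ (Ideal.mul_mem_left _ _ hxM)).1 h)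
    · intro h
      exact hκ (Set.mem_biUnion hN ⟨u, rfl, h⟩)

theorem aux_saturate {T : Type*} [CommRing T] [IsNoetherianRing T] (A N : Ideal T) :
    ∃ S : Finset (Ideal T), (∀ P ∈ S, ¬ N ≤ P) ∧ ∃ n : ℕ, ∀ y, (∀ P ∈ S, y ∉ P) → ∀ g, y * g ∈ A →
      ∀ u ∈ N ^ n, u * g ∈ A := by
  classical
  obtain ⟨S, hS, -⟩ := aux_ass A
  let B : ℕ →o Submodule T T := ⟨fun n => Submodule.colon A ((N ^ n : Ideal T) : Set T), by
    intro n m hnm x hx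
    rw [Submodule.mem_colon] at hx ⊢
    exact fun p hp => hx p (Ideal.pow_le_pow_right hnm hp)⟩
  obtain ⟨n, hn⟩ := monotone_stabilizes_iff_noetherian.2 (inferInstanceAs (IsNoetherian T T)) B
  have hB : ∀ k g, g ∈ B k ↔ ∀ u ∈ N ^ k, u * g ∈ A := by
    intro k g
    change g ∈ Submodule.colon A ((N ^ k : Ideal T) : Set T) ↔ _
    rw [Submodule.mem_colon]
    refine forall₂_congr fun u _ => ?_
    rw [smul_eq_mul, mul_comm]
  refine ⟨S.filter (fun P => ¬ N ≤ P), fun P hP => (Finset.mem_filter.1 hP).2, n, ?_⟩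
  intro y hy g hg
  rw [← hB]
  by_contra hgB
  obtain ⟨S', hS', h2⟩ := aux_ass (B n)
  have hAB : A ≤ B n := fun a ha => (hB n a).2 fun u _ => A.mul_mem_left _ ha
  obtain ⟨P, hP, hyP⟩ := h2 y g (hAB hg) hgB
  obtain ⟨hPp, h, hh⟩ := (hS' P).1 hP
  have hh1 : h ∉ B n := fun h' => hPp.ne_top ((Ideal.eq_top_iff_one _).2 ((hh 1).2 (by rw [one_mul]; exact h')))
  have hNP : ¬ N ≤ P := by
    intro hle
    apply hh1
    rw [hn (n + 1) (by omega), hB]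
    have h3 : ∀ v ∈ N ^ n, ∀ w ∈ N, v * w * h ∈ A := by
      intro v hv w hw
      have h3 := (hB n _).1 ((hh w).1 (hle hw)) v hv
      rwa [mul_assoc]
    intro u hu
    rw [pow_succ] at hu
    induction hu using Submodule.mul_induction_on' with
    | mem_mul_mem v hv w hw => exact h3 v hv w hw
    | add a _ b _ ha hb => rw [add_mul]; exact A.add_mem ha hb
  obtain ⟨u, hu, huP⟩ := Set.not_subset.1 hNP
  refine hy P (Finset.mem_filter.2 ⟨(hS P).2 ⟨hPp, u ^ n * h, fun s => ⟨fun hs => ?_, fun hs => ?_⟩⟩, hNP⟩) hyP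
  · have h3 := (hB n _).1 ((hh s).1 hs) (u ^ n) (Ideal.pow_mem_pow hu n)
    convert h3 using 1; ring
  · have h3 : s * u ^ n ∈ P := (hh _).2 (by rw [mul_assoc]; exact hAB hs)
    exact (hPp.mem_or_mem h3).resolve_right fun h4 => huP (hPp.mem_of_pow_mem n h4)

/-- the extension of the ideal to its Rees algebra -/
def auxReesI {A : Type*} [CommRing A] (q : Ideal A) : Ideal (reesAlgebra q) where
  carrier := {f | ∀ i, (f : A[X]).coeff i ∈ q ^ (i + 1)}
  zero_mem' := fun i => by simp
  add_mem' := fun {f g} hf hg i => by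
    change ((f : A[X]) + (g : A[X])).coeff i ∈ _
    rw [Polynomial.coeff_add]; exact Ideal.add_mem _ (hf i) (hg i)
  smul_mem' := fun f g hg i => by
    change ((f : A[X]) * (g : A[X])).coeff i ∈ _
    rw [Polynomial.coeff_mul]
    refine Ideal.sum_mem _ fun p hp => ?_
    rw [Finset.HasAntidiagonal.mem_antidiagonal] at hp
    rw [← hp, add_assoc, pow_add]
    exact Ideal.mul_mem_mul ((mem_reesAlgebra_iff q _).1 f.2 p.1) (hg p.2)

theorem aux_superficial {A : Type*} [CommRing A] [IsNoetherianRing A] (q : Ideal A) :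
    ∃ S : Finset (Ideal A), (∀ N ∈ S, ¬ q ≤ N) ∧ ∀ x ∈ q, (∀ N ∈ S, x ∉ N) →
      ∃ n : ℕ, ∀ l ≥ n, ∀ r ∈ q ^ l, x * r ∈ q ^ (l + 2) → r ∈ q ^ (l + 1) := by
  classical
  let mo : ∀ x ∈ q, reesAlgebra q := fun x hx => ⟨Polynomial.monomial 1 x, reesAlgebra.monomial_mem.2 (by rwa [pow_one])⟩
  let N : Ideal (reesAlgebra q) := Ideal.span {f | ∃ x, ∃ hx : x ∈ q, f = mo x hx}
  let pull : Ideal (reesAlgebra q) → Ideal A := fun P =>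
    { carrier := {x | ∃ hx : x ∈ q, mo x hx ∈ P}
      zero_mem' := ⟨q.zero_mem, by
        have : mo 0 q.zero_mem = 0 := Subtype.ext (Polynomial.monomial_zero_right 1)
        rw [this]; exact P.zero_mem⟩
      add_mem' := by
        rintro x y ⟨hx, hx'⟩ ⟨hy, hy'⟩
        refine ⟨q.add_mem hx hy, ?_⟩
        have : mo (x + y) (q.add_mem hx hy) = mo x hx + mo y hy := Subtype.ext (map_add (Polynomial.monomial 1) x y)
        rw [this]; exact P.add_mem hx' hy'
      smul_mem' := by
        rintro c x ⟨hx, hx'⟩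
        refine ⟨q.mul_mem_left c hx, ?_⟩
        have : mo (c * x) (q.mul_mem_left c hx) = algebraMap A (reesAlgebra q) c * mo x hx := by
          apply Subtype.ext
          change Polynomial.monomial 1 (c * x) = Polynomial.C c * Polynomial.monomial 1 x
          rw [Polynomial.C_mul_monomial]
        have hh := P.mul_mem_left (algebraMap A (reesAlgebra q) c) hx'
        rw [← this] at hh
        exact hh }
  have hNpow : ∀ (n : ℕ) (w : A) (hw : w ∈ q ^ n), (⟨Polynomial.monomial n w, reesAlgebra.monomial_mem.2 hw⟩ : reesAlgebra q) ∈ N ^ n := by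
    intro n
    induction n with
    | zero => intro w hw; rw [pow_zero, Ideal.one_eq_top]; trivial
    | succ n ih =>
      intro w hw
      have hw' : w ∈ q ^ n * q := by rwa [← pow_succ]
      have hP : ∀ w ∈ q ^ n * q, ∃ g : reesAlgebra q, (g : A[X]) = Polynomial.monomial (n + 1) w ∧ g ∈ N ^ (n + 1) := by
        intro w hw
        induction hw using Submodule.mul_induction_on' with
        | mem_mul_mem v hv x hx =>
          refine ⟨⟨Polynomial.monomial n v, reesAlgebra.monomial_mem.2 hv⟩ * mo x hx, ?_, ?_⟩
          · change Polynomial.monomial n v * Polynomial.monomial 1 x = _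
            rw [Polynomial.monomial_mul_monomial]
          · rw [pow_succ]
            exact Ideal.mul_mem_mul (ih v hv) (Ideal.subset_span ⟨x, hx, rfl⟩)
        | add a _ b _ ha hb =>
          obtain ⟨g, h1, h2⟩ := ha
          obtain ⟨g', h1', h2'⟩ := hb
          refine ⟨g + g', ?_, Ideal.add_mem _ h2 h2'⟩
          rw [Subalgebra.coe_add, h1, h1', map_add]
      obtain ⟨g, h1, h2⟩ := hP w hw'
      convert h2
      exact h1.symm
  obtain ⟨S, hS, n, hn⟩ := aux_saturate (auxReesI q) N
  refine ⟨S.image pull, ?_, ?_⟩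
  · intro M hM
    obtain ⟨P, hP, rfl⟩ := Finset.mem_image.1 hM
    intro hle
    refine hS P hP (Ideal.span_le.2 ?_)
    rintro _ ⟨x, hx, rfl⟩
    obtain ⟨_, h⟩ := hle hx
    exact h
  intro x hx hxS
  have hy := hn (mo x hx) (fun P hP h => hxS (pull P) (Finset.mem_image_of_mem _ hP) ⟨hx, h⟩)
  -- the colon ideal
  obtain ⟨G, hG⟩ := (isNoetherianRing_iff_ideal_fg (reesAlgebra q)).1 inferInstance
    (Submodule.colon (auxReesI q) {mo x hx})
  have hK : ∀ g, g ∈ Submodule.colon (auxReesI q) {mo x hx} ↔ mo x hx * g ∈ auxReesI q := by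
    intro g; rw [Submodule.mem_colon_singleton, smul_eq_mul, mul_comm]
  have hgen : ∀ g ∈ G, ∀ w ∈ q ^ n, ∀ i, w * (g : A[X]).coeff i ∈ q ^ (i + n + 1) := by
    intro g hg w hw i
    have h1 := hy g ((hK g).1 (by rw [← hG]; exact Ideal.subset_span hg)) _ (hNpow n w hw) (i + n)
    change (Polynomial.monomial n w * (g : A[X])).coeff (i + n) ∈ _ at h1
    rwa [Polynomial.coeff_monomial_mul] at h1
  refine ⟨n + G.sup (fun g => (g : A[X]).natDegree), fun l hl r hr hxr => ?_⟩
  have h1 : (⟨Polynomial.monomial l r, reesAlgebra.monomial_mem.2 hr⟩ : reesAlgebra q) ∈ Ideal.span (G : Set (reesAlgebra q)) := by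
    rw [hG, hK]
    intro i
    change (Polynomial.monomial 1 x * Polynomial.monomial l r).coeff i ∈ _
    rw [Polynomial.monomial_mul_monomial, Polynomial.coeff_monomial]
    split_ifs with h
    · rw [← h]
      convert hxr using 2; ring
    · exact Ideal.zero_mem _
  obtain ⟨c, -, hc⟩ := Submodule.mem_span_finset.1 h1
  have h2 : r = ((∑ g ∈ G, c g • g : reesAlgebra q) : A[X]).coeff l := by
    rw [hc]; simp
  rw [h2, AddSubmonoidClass.coe_finset_sum, Polynomial.finset_sum_coeff]
  refine Ideal.sum_mem _ fun g hg => ?_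
  change ((c g : A[X]) * (g : A[X])).coeff l ∈ _
  rw [Polynomial.coeff_mul]
  refine Ideal.sum_mem _ fun p hp => ?_
  rw [Finset.HasAntidiagonal.mem_antidiagonal] at hp
  by_cases hdeg : (g : A[X]).natDegree < p.2
  · rw [Polynomial.coeff_eq_zero_of_natDegree_lt hdeg, mul_zero]; exact Ideal.zero_mem _
  have h3 : (g : A[X]).natDegree ≤ G.sup (fun g => (g : A[X]).natDegree) := Finset.le_sup (f := fun g : reesAlgebra q => (g : A[X]).natDegree) hg
  have h4 : (c g : A[X]).coeff p.1 ∈ q ^ (p.1 - n) * q ^ n := by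
    rw [← pow_add, Nat.sub_add_cancel (by omega)]
    exact (mem_reesAlgebra_iff q _).1 (c g).2 p.1
  have h5 : ∀ v ∈ q ^ (p.1 - n) * q ^ n, v * (g : A[X]).coeff p.2 ∈ q ^ (l + 1) := by
    intro v hv
    induction hv using Submodule.mul_induction_on' with
    | mem_mul_mem s hs t ht =>
      have e1 : l + 1 = (p.1 - n) + (p.2 + n + 1) := by omega
      rw [e1, pow_add, mul_assoc]
      exact Ideal.mul_mem_mul hs (hgen g hg t ht p.2)
    | add a _ b _ ha hb => rw [add_mul]; exact Ideal.add_mem _ ha hb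
  exact h5 _ h4

/-- with Artin-Rees: for regular `x`, colon is as expected -/
theorem aux_superficial2 {A : Type*} [CommRing A] [IsNoetherianRing A] (q : Ideal A) (x : A) (hx : x ∈ q)
    (hreg : ∀ r, x * r = 0 → r = 0) (n : ℕ) (hn : ∀ l ≥ n, ∀ r ∈ q ^ l, x * r ∈ q ^ (l + 2) → r ∈ q ^ (l + 1)) :
    ∃ n, ∀ l ≥ n, ∀ r, x * r ∈ q ^ (l + 1) → r ∈ q ^ l := by
  obtain ⟨k, hk⟩ := Ideal.exists_pow_inf_eq_pow_smul q (Ideal.span {x} : Submodule A A)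
  refine ⟨n + k, fun l hl r hr => ?_⟩
  have h1 : r ∈ q ^ (l + 1 - k) := by
    have h2 : x * r ∈ q ^ (l + 1) • (⊤ : Submodule A A) ⊓ Ideal.span {x} :=
      ⟨by simpa using hr, Ideal.mul_mem_right _ _ (Ideal.mem_span_singleton_self x)⟩
    rw [hk (l + 1) (by omega)] at h2
    have h3 := (Submodule.smul_mono le_rfl (inf_le_right : q ^ k • (⊤ : Submodule A A) ⊓ Ideal.span {x} ≤ Ideal.span {x}) : q ^ (l + 1 - k) • _ ≤ _) h2
    rw [smul_eq_mul] at h3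
    obtain ⟨z, hz, hz'⟩ := Ideal.mem_mul_span_singleton.1 h3
    have : r - z = 0 := hreg _ (by rw [mul_sub, ← hz']; ring)
    rw [sub_eq_zero] at this
    rwa [this]
  have h2 : ∀ j, j ≤ l → l + 1 - k ≤ j → r ∈ q ^ j := by
    intro j
    induction j with
    | zero => intro _ _; simp
    | succ j ih =>
      intro h3 h4
      by_cases h5 : l + 1 - k ≤ j
      · exact hn j (by omega) r (ih (by omega) h5) (Ideal.pow_le_pow_right (by omega) hr)
      · have : j + 1 = l + 1 - k := by omega
        rw [this]; exact h1
  by_cases hk0 : k = 0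
  · subst hk0
    exact Ideal.pow_le_pow_right (by omega) h1
  · exact h2 l le_rfl (by omega)



/-- there is a regular sequence of length `n` modulo `Q` -/
def auxD [CommRing R] [IsLocalRing R] : ℕ → Ideal R → Prop
  | 0, _ => True
  | n + 1, Q => ∃ x ∈ maximalIdeal R, (∀ r, x * r ∈ Q → r ∈ Q) ∧ auxD n (Q ⊔ Ideal.span {x})

theorem aux_mem_sup [CommRing R] {Q : Ideal R} {x y : R} : y ∈ Q ⊔ Ideal.span {x} ↔ ∃ t, y - x * t ∈ Q := by
  rw [Submodule.mem_sup]
  constructor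
  · rintro ⟨q, hq, z, hz, rfl⟩
    obtain ⟨t, rfl⟩ := Ideal.mem_span_singleton'.1 hz
    exact ⟨t, by convert hq using 1; ring⟩
  · rintro ⟨t, ht⟩
    exact ⟨_, ht, x * t, Ideal.mul_mem_right _ _ (Ideal.mem_span_singleton_self x), by ring⟩

/-- choosing a regular element in the maximal ideal -/
theorem aux_socle [CommRing R] [IsLocalRing R] [IsNoetherianRing R] (Q : Ideal R) (S : Finset (Ideal R))
    (hS : ∀ p, p ∈ S ↔ p.IsPrime ∧ ∃ h, ∀ s, s ∈ p ↔ s * h ∈ Q)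
    (hQ : ∀ h, (∀ s ∈ maximalIdeal R, s * h ∈ Q) → h ∈ Q) : ∀ p ∈ S, ¬ maximalIdeal R ≤ p := by
  intro p hp hle
  obtain ⟨hpp, h, hh⟩ := (hS p).1 hp
  have := hQ h (fun s hs => (hh s).1 (hle hs))
  exact hpp.ne_top ((Ideal.eq_top_iff_one _).2 ((hh 1).2 (by rwa [one_mul])))

theorem aux_exchange [CommRing R] [IsLocalRing R] [IsNoetherianRing R] [Infinite (ResidueField R)] (n : ℕ) :
    ∀ (Q : Ideal R), auxD (n + 1) Q → ∀ y ∈ maximalIdeal R, (∀ r, y * r ∈ Q → r ∈ Q) →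
      auxD n (Q ⊔ Ideal.span {y}) := by
  classical
  induction n with
  | zero => intro _ _ _ _ _; trivial
  | succ n ih =>
    intro Q hQ y hy hyr
    obtain ⟨x, hx, hxr, hD⟩ := hQ
    have hD' := hD
    obtain ⟨w, hw, hwr, -⟩ := hD'
    have hsx : ∀ h, (∀ s ∈ maximalIdeal R, s * h ∈ Q ⊔ Ideal.span {x}) → h ∈ Q ⊔ Ideal.span {x} :=
      fun h hh => hwr h (hh w hw)
    have hsy : ∀ h, (∀ s ∈ maximalIdeal R, s * h ∈ Q ⊔ Ideal.span {y}) → h ∈ Q ⊔ Ideal.span {y} := by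
      intro h hh
      obtain ⟨h', hh'⟩ := aux_mem_sup.1 (hh x hx)
      have h1 : h' ∈ Q ⊔ Ideal.span {x} := by
        refine hsx h' fun s hs => ?_
        obtain ⟨t, ht⟩ := aux_mem_sup.1 (hh s hs)
        refine aux_mem_sup.2 ⟨t, hyr _ ?_⟩
        have h2 := Q.sub_mem (Q.mul_mem_left x ht) (Q.mul_mem_left s hh')
        convert h2 using 1; ring
      obtain ⟨u, hu⟩ := aux_mem_sup.1 h1
      refine aux_mem_sup.2 ⟨u, hxr _ ?_⟩
      have h2 := Q.add_mem hh' (Q.mul_mem_left y hu)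
      convert h2 using 1; ring
    obtain ⟨S1, hS1, hS1'⟩ := aux_ass Q
    obtain ⟨S2, hS2, hS2'⟩ := aux_ass (Q ⊔ Ideal.span {x})
    obtain ⟨S3, hS3, hS3'⟩ := aux_ass (Q ⊔ Ideal.span {y})
    obtain ⟨z, hz, hzS⟩ := aux_avoid (maximalIdeal R) (S1 ∪ S2 ∪ S3) (by
      intro p hp
      rw [Finset.mem_union, Finset.mem_union] at hp
      rcases hp with (hp | hp) | hp
      · exact aux_socle Q S1 hS1 (fun h hh => hxr h (hh x hx)) p hp
      · exact aux_socle _ S2 hS2 hsx p hp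
      · exact aux_socle _ S3 hS3 hsy p hp)
    have hz1 : ∀ r, z * r ∈ Q → r ∈ Q := by
      intro r hr
      by_contra hcon
      obtain ⟨p, hp, hzp⟩ := hS1' z r hr hcon
      exact hzS p (by simp [hp]) hzp
    have hz2 : ∀ r, z * r ∈ Q ⊔ Ideal.span {x} → r ∈ Q ⊔ Ideal.span {x} := by
      intro r hr
      by_contra hcon
      obtain ⟨p, hp, hzp⟩ := hS2' z r hr hcon
      exact hzS p (by simp [hp]) hzp
    have hz3 : ∀ r, z * r ∈ Q ⊔ Ideal.span {y} → r ∈ Q ⊔ Ideal.span {y} := by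
      intro r hr
      by_contra hcon
      obtain ⟨p, hp, hzp⟩ := hS3' z r hr hcon
      exact hzS p (by simp [hp]) hzp
    have hswap : ∀ v, (∀ r, v * r ∈ Q → r ∈ Q) → (∀ r, z * r ∈ Q ⊔ Ideal.span {v} → r ∈ Q ⊔ Ideal.span {v}) →
        ∀ r, v * r ∈ Q ⊔ Ideal.span {z} → r ∈ Q ⊔ Ideal.span {z} := by
      intro v hv hzv r hr
      obtain ⟨t, ht⟩ := aux_mem_sup.1 hr
      have h1 : t ∈ Q ⊔ Ideal.span {v} := by
        refine hzv t (aux_mem_sup.2 ⟨r, ?_⟩)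
        have := Q.neg_mem ht
        convert this using 1; ring
      obtain ⟨u, hu⟩ := aux_mem_sup.1 h1
      refine aux_mem_sup.2 ⟨u, hv _ ?_⟩
      have h2 := Q.add_mem ht (Q.mul_mem_left z hu)
      convert h2 using 1; ring
    have h1 : auxD n (Q ⊔ Ideal.span {x} ⊔ Ideal.span {z}) := ih _ hD z hz hz2
    have h2 : auxD (n + 1) (Q ⊔ Ideal.span {z}) := ⟨x, hx, hswap x hxr hz2, by rwa [sup_right_comm]⟩
    have h3 := ih _ h2 y hy (hswap y hyr hz3)
    exact ⟨z, hz, hz3, by rwa [sup_right_comm]⟩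

theorem auxD_of_cm [CommRing R] [IsLocalRing R] [IsNoetherianRing R] (d : ℕ) (hdim : ringKrullDim R = d)
    (hCM : IsCMLocal R) : auxD d (⊥ : Ideal R) := by
  rw [IsCMLocal, hdim] at hCM
  have h0 : rdepth R (maximalIdeal R) R = (d : ℕ∞) := by exact_mod_cast hCM
  obtain ⟨rs, h1, h2, h3⟩ : (d : ℕ∞) ∈ {n : ℕ∞ | ∃ rs : List R, (rs.length : ℕ∞) = n ∧ (∀ x ∈ rs, x ∈ maximalIdeal R) ∧
    RingTheory.Sequence.IsRegular R rs} := by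
    rw [← h0]
    haveI : Nonempty {n : ℕ∞ | ∃ rs : List R, (rs.length : ℕ∞) = n ∧ (∀ x ∈ rs, x ∈ maximalIdeal R) ∧
      RingTheory.Sequence.IsRegular R rs} := ⟨0, [], by simp, by simp, RingTheory.Sequence.IsRegular.nil R R⟩
    refine ENat.sSup_mem_of_nonempty_of_lt_top ?_
    change rdepth R (maximalIdeal R) R < ⊤
    rw [h0]; exact ENat.coe_lt_top _
  have h1' : rs.length = d := by exact_mod_cast h1
  have h4 := h3.toIsWeaklyRegular
  rw [RingTheory.Sequence.isWeaklyRegular_iff] at h4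
  have key : ∀ j i, i + j = rs.length → auxD j (Ideal.ofList (rs.take i)) := by
    intro j
    induction j with
    | zero => intro _ _; trivial
    | succ j ih =>
      intro i hi
      have hi' : i < rs.length := by omega
      refine ⟨rs[i], h2 _ (List.getElem_mem hi'), fun r hr => ?_, ?_⟩
      · have h5 := h4 i hi'
        have h6 : Ideal.ofList (List.take i rs) • (⊤ : Submodule R R) = Ideal.ofList (List.take i rs) := by
          rw [smul_eq_mul, Ideal.mul_top]
        have h7 : (Submodule.Quotient.mk r : R ⧸ (Ideal.ofList (List.take i rs) • (⊤ : Submodule R R))) = 0 := by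
          apply h5
          change rs[i] • (Submodule.Quotient.mk r : R ⧸ (Ideal.ofList (List.take i rs) • (⊤ : Submodule R R))) = rs[i] • 0
          rw [smul_zero, ← Submodule.Quotient.mk_smul, Submodule.Quotient.mk_eq_zero, h6]
          exact hr
        rwa [Submodule.Quotient.mk_eq_zero, h6] at h7
      · have h8 := ih (i + 1) (by omega)
        have h9 : Ideal.ofList (rs.take (i + 1)) = Ideal.ofList (rs.take i) ⊔ Ideal.span {rs[i]} := by
          rw [List.take_add_one, Ideal.ofList_append, List.getElem?_eq_getElem hi', Option.toList_some, Ideal.ofList_singleton]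
        rwa [h9] at h8
  have := key rs.length 0 (by omega)
  rw [List.take_zero, Ideal.ofList_nil, h1'] at this
  exact this



theorem aux_step [CommRing R] [IsLocalRing R] [IsNoetherianRing R] [Infinite (ResidueField R)] (n : ℕ)
    (Q I : Ideal R) (hI : I.radical = maximalIdeal R) (hD : auxD (n + 1) Q) :
    ∃ x ∈ I, (∀ r, x * r ∈ Q → r ∈ Q) ∧ auxD n (Q ⊔ Ideal.span {x}) ∧
      ∃ N, ∀ l ≥ N, ∀ r, x * r ∈ I ^ (l + 1) ⊔ Q → r ∈ I ^ l ⊔ Q := by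
  classical
  obtain ⟨S, hS1, hS2⟩ := aux_superficial (I.map (Ideal.Quotient.mk Q))
  obtain ⟨T, hT1, hT2⟩ := aux_ass Q
  have hsoc := aux_socle Q T hT1 (by
    intro h hh
    obtain ⟨x, hx, hxr, _⟩ := hD
    exact hxr h (hh x hx))
  obtain ⟨x, hx, hxS⟩ := aux_avoid I (T ∪ S.image (Ideal.comap (Ideal.Quotient.mk Q))) (by
    intro N hN hle
    rcases Finset.mem_union.1 hN with hN | hN
    · have hp : N.IsPrime := ((hT1 N).1 hN).1
      apply hsoc N hN
      rw [← hI]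
      exact (hp.isRadical.radical_le_iff).2 hle
    · obtain ⟨M, hM, rfl⟩ := Finset.mem_image.1 hN
      exact hS1 M hM (Ideal.map_le_iff_le_comap.2 hle))
  have hreg : ∀ r, x * r ∈ Q → r ∈ Q := by
    intro r hr
    by_contra hrQ
    obtain ⟨p, hp, hxp⟩ := hT2 x r hr hrQ
    exact hxS p (Finset.mem_union_left _ hp) hxp
  have hxm : x ∈ maximalIdeal R := by rw [← hI]; exact Ideal.le_radical hx
  refine ⟨x, hx, hreg, aux_exchange n Q hD x hxm hreg, ?_⟩
  have hxq : Ideal.Quotient.mk Q x ∈ I.map (Ideal.Quotient.mk Q) := Ideal.mem_map_of_mem _ hx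
  obtain ⟨k, hk⟩ := hS2 _ hxq (by
    intro N hN h
    exact hxS _ (Finset.mem_union_right _ (Finset.mem_image_of_mem _ hN)) (Ideal.mem_comap.2 h))
  obtain ⟨N, hN⟩ := aux_superficial2 _ _ hxq (by
    intro r hr
    obtain ⟨r, rfl⟩ := Ideal.Quotient.mk_surjective r
    rw [← map_mul, Ideal.Quotient.eq_zero_iff_mem] at hr
    exact Ideal.Quotient.eq_zero_iff_mem.2 (hreg r hr)) k hk
  have key : ∀ l r, Ideal.Quotient.mk Q r ∈ (I.map (Ideal.Quotient.mk Q)) ^ l ↔ r ∈ I ^ l ⊔ Q := by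
    intro l r
    rw [← Ideal.map_pow, ← Ideal.mem_comap, Ideal.comap_map_of_surjective' _ Ideal.Quotient.mk_surjective, Ideal.mk_ker]
  refine ⟨N, fun l hl r hr => ?_⟩
  rw [← key] at hr ⊢
  rw [map_mul] at hr
  exact hN l hl _ hr

def auxRet [CommRing R] (I Q : Ideal R) : Prop :=
  ∀ K ≤ I, (∃ N, ∀ n ≥ N, I ^ (n + 1) ≤ K * I ^ n ⊔ Q) → ∃ N, ∀ n ≥ N, I ^ (n + 1) ≤ (K ⊔ Q) * I ^ n

theorem auxRet_step [CommRing R] (I Q : Ideal R) (x : R) (hx : x ∈ I) (h : auxRet I Q)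
    (hN : ∃ N, ∀ l ≥ N, ∀ r, x * r ∈ I ^ (l + 1) ⊔ Q → r ∈ I ^ l ⊔ Q) :
    auxRet I (Q ⊔ Ideal.span {x}) := by
  intro K hK hh
  obtain ⟨N1, hN1⟩ := hN
  obtain ⟨N2, hN2⟩ := hh
  have hxI : Ideal.span {x} ≤ I := (Ideal.span_singleton_le_iff_mem _).2 hx
  obtain ⟨N, hN⟩ := h (K ⊔ Ideal.span {x}) (sup_le hK hxI) ⟨max N1 N2, fun n hn => by
    intro y hy
    have h1 := hN2 n (le_trans (le_max_right _ _) hn) hy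
    rw [← sup_assoc, aux_mem_sup] at h1
    obtain ⟨r, hr⟩ := h1
    have hKI : K * I ^ n ≤ I ^ (n + 1) := by
      rw [pow_succ']; exact Ideal.mul_mono_left hK
    have h2 : x * r ∈ I ^ (n + 1) ⊔ Q := by
      have := Ideal.sub_mem _ (Ideal.mem_sup_left (T := Q) hy) (sup_le_sup_right hKI Q hr)
      simpa using this
    have h3 := hN1 n (le_trans (le_max_left _ _) hn) r h2
    obtain ⟨u, hu, v, hv, rfl⟩ := Submodule.mem_sup.1 h3
    have e : y = (y - x * (u + v)) + x * u + x * v := by ring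
    rw [e]
    refine Ideal.add_mem _ (Ideal.add_mem _ ?_ ?_) ?_
    · exact sup_le_sup_right (Ideal.mul_mono_left le_sup_left) Q hr
    · exact Ideal.mem_sup_left (Ideal.mul_mem_mul (Ideal.mem_sup_right (Ideal.mem_span_singleton_self x)) hu)
    · exact Ideal.mem_sup_right (Ideal.mul_mem_left _ _ hv)⟩
  refine ⟨N, fun n hn => (hN n hn).trans (Ideal.mul_mono_left ?_)⟩
  rw [sup_right_comm, sup_assoc]

theorem aux_dim_step [CommRing R] (Q : Ideal R) (x : R) (hx : ∀ r, x * r ∈ Q → r ∈ Q) :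
    ringKrullDim (R ⧸ (Q ⊔ Ideal.span {x})) + 1 ≤ ringKrullDim (R ⧸ Q) := by
  have h1 : Ideal.Quotient.mk Q x ∈ nonZeroDivisors (R ⧸ Q) := by
    rw [mem_nonZeroDivisors_iff_right]
    intro r hr
    obtain ⟨r, rfl⟩ := Ideal.Quotient.mk_surjective r
    rw [← map_mul, Ideal.Quotient.eq_zero_iff_mem, mul_comm] at hr
    exact Ideal.Quotient.eq_zero_iff_mem.2 (hx r hr)
  have h2 := ringKrullDim_quotient_succ_le_of_nonZeroDivisor h1
  have h3 := ringKrullDim_eq_of_ringEquiv (DoubleQuot.quotQuotEquivQuotSup Q (Ideal.span {x}))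
  rw [Ideal.map_span, Set.image_singleton] at h3
  rw [← h3]; exact h2

theorem aux_chain [CommRing R] [IsLocalRing R] [IsNoetherianRing R] [Infinite (ResidueField R)] (d : ℕ)
    (hdim : ringKrullDim R = d) (hCM : IsCMLocal R) (I : Ideal R) (hI : I.radical = maximalIdeal R) :
    ∀ i j, i + j = d → ∃ a : Fin i → R, auxReg i a ∧ Ideal.span (Set.range a) ≤ I ∧ auxD j (Ideal.span (Set.range a)) ∧
      ringKrullDim (R ⧸ Ideal.span (Set.range a)) + i ≤ d ∧ auxRet I (Ideal.span (Set.range a)) := by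
  intro i
  induction i with
  | zero =>
    intro j hj
    have e : Ideal.span (Set.range (Fin.elim0 : Fin 0 → R)) = ⊥ := by simp
    refine ⟨Fin.elim0, trivial, ?_⟩
    rw [e]
    refine ⟨bot_le, ?_, ?_, ?_⟩
    · rw [zero_add] at hj; subst hj; exact auxD_of_cm _ hdim hCM
    · rw [ringKrullDim_eq_of_ringEquiv (RingEquiv.quotientBot R), hdim]; simp
    · rintro K hK ⟨N, hN⟩
      refine ⟨N, fun n hn => ?_⟩
      simpa using hN n hn
  | succ i ih =>
    intro j hj
    obtain ⟨a, h1, h2, h3, h4, h5⟩ := ih (j + 1) (by omega)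
    obtain ⟨x, hx, hxr, hxD, hN⟩ := aux_step j _ I hI h3
    have e : Ideal.span (Set.range (Fin.cons x a : Fin (i + 1) → R)) = Ideal.span (Set.range a) ⊔ Ideal.span {x} := by
      rw [Fin.range_cons, Ideal.span_insert, sup_comm]
    refine ⟨Fin.cons x a, ⟨by simpa using h1, by simpa using hxr⟩, ?_⟩
    rw [e]
    refine ⟨sup_le h2 ((Ideal.span_singleton_le_iff_mem _).2 hx), hxD, ?_, auxRet_step I _ x hx h5 hN⟩
    refine le_trans ?_ h4
    have := aux_dim_step _ x hxr
    push_cast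
    rw [add_comm (i : WithBot ℕ∞) 1, ← add_assoc]
    gcongr

theorem aux_pow_le [CommRing R] [IsLocalRing R] [IsNoetherianRing R] (J : Ideal R) (h : ringKrullDim (R ⧸ J) ≤ 0) :
    ∃ c, maximalIdeal R ^ c ≤ J := by
  apply Ideal.exists_pow_le_of_le_radical_of_fg _ (IsNoetherian.noetherian _)
  rw [Ideal.radical_eq_sInf]
  refine le_sInf ?_
  rintro p ⟨hJp, hp⟩
  haveI : Ring.KrullDimLE 0 (R ⧸ J) := by
    rw [Ring.krullDimLE_iff]; exact_mod_cast h
  have hk : RingHom.ker (Ideal.Quotient.mk J) ≤ p := by rwa [Ideal.mk_ker]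
  haveI := Ideal.map_isPrime_of_surjective Ideal.Quotient.mk_surjective hk
  have hm : (p.map (Ideal.Quotient.mk J)).IsMaximal := Ideal.IsPrime.isMaximal' inferInstance
  have h2 := Ideal.comap_isMaximal_of_surjective (Ideal.Quotient.mk J) Ideal.Quotient.mk_surjective (K := p.map (Ideal.Quotient.mk J))
  rw [Ideal.comap_map_of_surjective' _ Ideal.Quotient.mk_surjective, Ideal.mk_ker, sup_eq_left.2 hJp] at h2
  exact (IsLocalRing.eq_maximalIdeal h2).ge

theorem aux_main
    (R : Type*) [CommRing R] [IsLocalRing R] [IsNoetherianRing R]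
    (d : ℕ) (hd : 0 < d) (hdim : ringKrullDim R = d)
    (hCM : IsCMLocal R) (hAU : AnalyticallyUnramified R)
    (hres : Infinite (ResidueField R))
    (I : Ideal R) (hI : IsMPrimary I)
    (L : ℕ → ℕ) (e : ℕ → ℤ) (hHilb : NormalHilbertData d I L e) :
    e 1 ≥ e 0 - L 0 := by
  have hIm : I ≤ maximalIdeal R := by
    rw [← show I.radical = maximalIdeal R from hI]; exact Ideal.le_radical
  obtain ⟨a, h1, h2, -, h4, h5⟩ := aux_chain d hdim hCM I hI d 0 rfl
  have h6 : ringKrullDim (R ⧸ Ideal.span (Set.range a)) ≤ 0 := by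
    generalize ringKrullDim (R ⧸ Ideal.span (Set.range a)) = z at h4
    induction z with
    | bot => exact bot_le
    | coe z =>
      have h7 : z + (d : ℕ∞) ≤ 0 + d := by rw [zero_add]; exact_mod_cast h4
      have := (ENat.add_le_add_iff_right (ENat.coe_ne_top d)).1 h7
      exact_mod_cast this
  obtain ⟨c, hc⟩ := aux_pow_le _ h6
  obtain ⟨N, hN⟩ := h5 ⊥ bot_le ⟨c, fun n hn => by
    refine le_trans ?_ le_sup_right
    exact le_trans (Ideal.pow_right_mono hIm _) (le_trans (Ideal.pow_le_pow_right (by omega)) hc)⟩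
  rw [bot_sup_eq] at hN
  refine aux_final hAU hd I hIm a h1 h2 c hc N ?_ L e hHilb
  intro m
  have h7 : I ^ (m + N) ≤ Ideal.span (Set.range a) ^ m * I ^ N := by
    induction m with
    | zero => simp
    | succ m ih =>
      have : m + 1 + N = (m + N) + 1 := by ring
      rw [this]
      refine (hN (m + N) (by omega)).trans ?_
      rw [pow_succ', mul_assoc]
      exact Ideal.mul_mono_right ih
  exact h7.trans Ideal.mul_le_left


theorem normal_e1_lower_bound
    (R : Type*) [CommRing R] [IsLocalRing R] [IsNoetherianRing R]
    (d : ℕ) (hd : 0 < d) (hdim : ringKrullDim R = d)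
    (hCM : IsCMLocal R) (hAU : AnalyticallyUnramified R)
    (hres : Infinite (ResidueField R))
    (I : Ideal R) (hI : IsMPrimary I)
    (L : ℕ → ℕ) (e : ℕ → ℤ) (hHilb : NormalHilbertData d I L e) :
    e 1 ≥ e 0 - L 0 := by
  exact aux_main R d hd hdim hCM hAU hres I hI L e hHilb
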